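/- Let Ω ⊂ ℝⁿ be a Lipschitz domain with constants m, r₀, let Q = Ω × (0,∞), let L be a nondivergence parabolic operator on Q with ellipticity constant ν, and let (ω^X) be the L-caloric measure for Q. Let Y = (y,s) ∈ ∂_pQ and let λ ≥ 1 satisfy λr₀ ≥ 4. Then for every R with 0 < R ≤ λr₀ there exists N₀ = N₀(n, ν, m, λ, R) such that for every ρ with 0 < 2ρ ≤ R, ω^X(Δ₁(Y)) ≥ 1/N₀ for all X ∈ Ω⁺_ρ(Y) = (Ω^{μρ'} ∩ B_{ρ'}(y)) × {s + ρ²}, where ρ' = min(ρ, r₀). -/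

import Mathlib

open MeasureTheory Set Metric Filter

noncomputable section

/-- Euclidean space `ℝⁿ`. -/
abbrev E (n : ℕ) : Type := EuclideanSpace ℝ (Fin n)

/-- Second spatial partial derivative `D_i D_j u` at a space-time point `X`. -/
def D2 {n : ℕ} (u : E n × ℝ → ℝ) (X : E n × ℝ) (i j : Fin n) : ℝ :=
  fderiv ℝ (fun x => fderiv ℝ (fun x' => u (x', X.2)) x (EuclideanSpace.single j 1))
    X.1 (EuclideanSpace.single i 1)

/-- Time derivative `D_t u` at a space-time point `X`. -/
def Dt {n : ℕ} (u : E n × ℝ → ℝ) (X : E n × ℝ) : ℝ :=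
  deriv (fun t => u (X.1, t)) X.2

/-- The value `Lu(X)` of the nondivergence parabolic operator with coefficients `a`. -/
def LVal {n : ℕ} (a : E n × ℝ → Fin n → Fin n → ℝ) (u : E n × ℝ → ℝ) (X : E n × ℝ) : ℝ :=
  (∑ i, ∑ j, a X i j * D2 u X i j) - Dt u X

/-- `u` is C² in `x` and C¹ in `t` at every point of `V`. -/
def ParabolicSmoothOn {n : ℕ} (u : E n × ℝ → ℝ) (V : Set (E n × ℝ)) : Prop :=
  ∀ X ∈ V, ContDiffAt ℝ 2 (fun x => u (x, X.2)) X.1 ∧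
    DifferentiableAt ℝ (fun t => u (X.1, t)) X.2

/-- `u` solves `Lu = 0` pointwise in `V` (being C² in `x`, C¹ in `t` there). -/
def SolvesL {n : ℕ} (a : E n × ℝ → Fin n → Fin n → ℝ) (u : E n × ℝ → ℝ)
    (V : Set (E n × ℝ)) : Prop :=
  ParabolicSmoothOn u V ∧ ∀ X ∈ V, LVal a u X = 0

/-- `a` is a smooth coefficient matrix on `S`, uniformly elliptic with constant `ν`
and with entries bounded by `ν⁻¹`. -/
def IsParabolicCoeff {n : ℕ} (ν : ℝ) (a : E n × ℝ → Fin n → Fin n → ℝ)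
    (S : Set (E n × ℝ)) : Prop :=
  (∀ i j, ContDiffOn ℝ (⊤ : ℕ∞) (fun X => a X i j) S) ∧
  ∀ X ∈ S, (∀ ξ : Fin n → ℝ, ν * ∑ i, ξ i ^ 2 ≤ ∑ i, ∑ j, a X i j * ξ i * ξ j) ∧
    ∀ i j, |a X i j| ≤ ν⁻¹

/-- The cylinder `Ω × (t₀, ∞)`. -/
def CylFrom {n : ℕ} (Ω : Set (E n)) (t₀ : ℝ) : Set (E n × ℝ) := Ω ×ˢ Ioi t₀

/-- The cylinder `Q = Ω × (0, ∞)`. -/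
def Cyl {n : ℕ} (Ω : Set (E n)) : Set (E n × ℝ) := CylFrom Ω 0

/-- Parabolic boundary of the cylinder `Ω × (t₀, ∞)`:
`(∂Ω × (t₀,∞)) ∪ (cl(Ω) × {t₀})`. -/
def pBFrom {n : ℕ} (Ω : Set (E n)) (t₀ : ℝ) : Set (E n × ℝ) :=
  (frontier Ω ×ˢ Ioi t₀) ∪ (closure Ω ×ˢ {t₀})

/-- Parabolic boundary of `Ω × (0, ∞)`. -/
def pB {n : ℕ} (Ω : Set (E n)) : Set (E n × ℝ) := pBFrom Ω 0

/-- The cylinder `C_{R,r}(Y) = B_R(y) × (s - r², s + r²)`. -/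
def CRr {n : ℕ} (Y : E n × ℝ) (R r : ℝ) : Set (E n × ℝ) :=
  ball Y.1 R ×ˢ Ioo (Y.2 - r ^ 2) (Y.2 + r ^ 2)

/-- The standard cylinder `C_r(Y) = B_r(y) × (s - r², s + r²)`. -/
def Cr {n : ℕ} (Y : E n × ℝ) (r : ℝ) : Set (E n × ℝ) := CRr Y r r

/-- `ω` is the `L`-caloric measure family for the cylinder `Ω × (t₀, ∞)`:
each `ω X` is a Borel probability measure on the parabolic boundary, and for every
bounded continuous `φ`, `X ↦ ∫ φ dω^X` is a (bounded) solution of `Lu = 0` in the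
cylinder extending continuously to `φ` at each point of the parabolic boundary. -/
def IsCaloricMeasureFrom {n : ℕ} (a : E n × ℝ → Fin n → Fin n → ℝ) (Ω : Set (E n))
    (t₀ : ℝ) (ω : E n × ℝ → Measure (E n × ℝ)) : Prop :=
  (∀ X ∈ CylFrom Ω t₀, IsProbabilityMeasure (ω X) ∧ ω X (pBFrom Ω t₀)ᶜ = 0) ∧
  ∀ φ : E n × ℝ → ℝ, Continuous φ → (∃ M, ∀ z, |φ z| ≤ M) →
    SolvesL a (fun X => ∫ z, φ z ∂ω X) (CylFrom Ω t₀) ∧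
    ∀ Z ∈ pBFrom Ω t₀, Tendsto (fun X => ∫ z, φ z ∂ω X)
      (nhdsWithin Z (CylFrom Ω t₀)) (nhds (φ Z))

/-- `ω` is the `L`-caloric measure family for `Q = Ω × (0, ∞)`. -/
def IsCaloricMeasure {n : ℕ} (a : E n × ℝ → Fin n → Fin n → ℝ) (Ω : Set (E n))
    (ω : E n × ℝ → Measure (E n × ℝ)) : Prop :=
  IsCaloricMeasureFrom a Ω 0 ω

/-- `Ω` is a Lipschitz domain with constants `m, r₀ > 0`: it is a nonempty open
connected set and near each boundary point, in a suitable orthonormal coordinate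
system centered at that point, it coincides with the region above the graph of a
function with `‖∇φ‖_{L^∞} ≤ m` (equivalently, `m`-Lipschitz). -/
def IsLipschitzDomain {n : ℕ} (hn : 0 < n) (Ω : Set (E n)) (m r₀ : ℝ) : Prop :=
  IsOpen Ω ∧ Ω.Nonempty ∧ IsConnected Ω ∧ 0 < m ∧ 0 < r₀ ∧
  ∀ y ∈ frontier Ω, ∃ (T : E n ≃ₗᵢ[ℝ] E n) (φ : E (n - 1) → ℝ),
    LipschitzWith m.toNNReal φ ∧
    ∀ x : E n, x ∈ Ω ∩ ball y r₀ ↔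
      ‖x - y‖ < r₀ ∧
        φ ((EuclideanSpace.equiv (Fin (n - 1)) ℝ).symm
            (fun i => T (x - y) (Fin.castLE (Nat.sub_le n 1) i))) <
          T (x - y) ⟨n - 1, Nat.sub_lt hn Nat.one_pos⟩

/-- The set `Ω^δ = {x ∈ Ω : dist(x, ∂Ω) > δ}`. -/
def innerSet {n : ℕ} (Ω : Set (E n)) (δ : ℝ) : Set (E n) :=
  {x ∈ Ω | δ < infDist x (frontier Ω)}

/-- The corkscrew property (2.3) with constant `μ`. -/
def Corkscrew {n : ℕ} (Ω : Set (E n)) (r₀ μ : ℝ) : Prop :=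
  ∀ y ∈ frontier Ω, ∀ r : ℝ, 0 < r → r < r₀ →
    (∃ y₁ : E n, ball y₁ (2 * μ * r) ⊆ ball y r ∩ Ω) ∧
    (∃ y₂ : E n, ball y₂ (2 * μ * r) ⊆ ball y r \ Ω)

open scoped Topology

/-! ### Part 1: second-order calculus and comparison tools -/

/-- `f` is differentiable near `0` and its derivative is differentiable at `0`,
with second derivative `q`. -/
def D2Along (f : ℝ → ℝ) (q : ℝ) : Prop :=
  ∃ f' : ℝ → ℝ, (∀ᶠ τ in 𝓝 (0 : ℝ), HasDerivAt f (f' τ) τ) ∧ HasDerivAt f' q 0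

lemma D2Along.add {f g : ℝ → ℝ} {p q : ℝ} (hf : D2Along f p) (hg : D2Along g q) :
    D2Along (fun τ => f τ + g τ) (p + q) := by
  obtain ⟨f', h1, h2⟩ := hf
  obtain ⟨g', h3, h4⟩ := hg
  refine ⟨fun τ => f' τ + g' τ, ?_, h2.add h4⟩
  filter_upwards [h1, h3] with τ a b using a.add b

lemma D2Along.const_mul {f : ℝ → ℝ} {p : ℝ} (hf : D2Along f p) (c : ℝ) :
    D2Along (fun τ => c * f τ) (c * p) := by
  obtain ⟨f', h1, h2⟩ := hf
  refine ⟨fun τ => c * f' τ, ?_, h2.const_mul c⟩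
  filter_upwards [h1] with τ a using a.const_mul c

lemma D2Along.neg {f : ℝ → ℝ} {p : ℝ} (hf : D2Along f p) :
    D2Along (fun τ => - f τ) (-p) := by
  obtain ⟨f', h1, h2⟩ := hf
  refine ⟨fun τ => - f' τ, ?_, h2.neg⟩
  filter_upwards [h1] with τ a using a.neg

lemma D2Along.sub {f g : ℝ → ℝ} {p q : ℝ} (hf : D2Along f p) (hg : D2Along g q) :
    D2Along (fun τ => f τ - g τ) (p - q) := by
  have := hf.add hg.neg
  simpa [sub_eq_add_neg] using this

lemma D2Along.congr {f g : ℝ → ℝ} {p : ℝ} (hf : D2Along f p) (h : g =ᶠ[𝓝 0] f) :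
    D2Along g p := by
  obtain ⟨f', h1, h2⟩ := hf
  refine ⟨f', ?_, h2⟩
  filter_upwards [h1, h.eventually_nhds] with τ a b using a.congr_of_eventuallyEq b

lemma D2Along.quad (a b c : ℝ) : D2Along (fun τ => a + b * τ + c * τ ^ 2) (2 * c) := by
  refine ⟨fun τ => b + 2 * c * τ, Eventually.of_forall fun τ => ?_, ?_⟩
  · have h1 := (((hasDerivAt_id τ).const_mul b).const_add a).add
      (((hasDerivAt_id τ).pow 2).const_mul c)
    refine h1.congr_deriv ?_
    simp; ring
  · have h1 := ((hasDerivAt_id (0:ℝ)).const_mul (2 * c)).const_add b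
    simpa using h1

lemma D2Along.nonneg_of_localMin {f : ℝ → ℝ} {q : ℝ} (hf : D2Along f q)
    (hm : IsLocalMin f 0) : 0 ≤ q := by
  by_contra hq
  push Not at hq
  obtain ⟨f', h1, h2⟩ := hf
  have e1 : deriv f =ᶠ[𝓝 0] f' := by
    filter_upwards [h1] with τ a using a.deriv
  have e2 : deriv (deriv f) 0 = q := by rw [e1.deriv_eq, h2.deriv]
  have hd : deriv f 0 = 0 := hm.deriv_eq_zero
  have hM := isLocalMax_of_deriv_deriv_neg (by rw [e2]; exact hq) hd h1.self_of_nhds.continuousAt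
  have hc : f =ᶠ[𝓝 0] fun _ => f 0 := by
    filter_upwards [hm, hM] with τ a b using le_antisymm b a
  have e3 : deriv f =ᶠ[𝓝 0] fun _ => (0:ℝ) := by
    filter_upwards [hc.eventually_nhds] with τ a
    rw [EventuallyEq.deriv_eq a]; simp
  have : deriv (deriv f) 0 = 0 := by rw [e3.deriv_eq]; simp
  linarith

/-- The quadratic form of `S`. -/
def qf {n : ℕ} (S : Fin n → Fin n → ℝ) (ξ : E n) : ℝ := ∑ i, ∑ j, S i j * ξ i * ξ j

/-- The pairing of two matrices. -/
def pr {n : ℕ} (P S : Fin n → Fin n → ℝ) : ℝ := ∑ i, ∑ j, P i j * S i j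

lemma pr_nonneg {n : ℕ} {P q : Fin n → Fin n → ℝ} (hP : ∀ ξ, 0 ≤ qf P ξ)
    (hs : ∀ i j, q i j = q j i) (hq : ∀ ξ, 0 ≤ qf q ξ) : 0 ≤ pr P q := by
  have hpsd : (Matrix.of q).PosSemidef := by
    rw [Matrix.posSemidef_iff_dotProduct_mulVec]
    refine ⟨?_, fun x => ?_⟩
    · ext i j
      simp [Matrix.conjTranspose_apply, hs j i]
    · have := hq (WithLp.toLp 2 x)
      simp only [qf, dotProduct, Matrix.mulVec, Matrix.of_apply, Finset.mul_sum] at this ⊢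
      refine this.trans (le_of_eq ?_)
      refine Finset.sum_congr rfl fun i _ => Finset.sum_congr rfl fun j _ => ?_
      simp; ring
  obtain ⟨m, A, hA⟩ := Matrix.posSemidef_iff_eq_sum_vecMulVec.mp hpsd
  have hA' : ∀ i j, q i j = ∑ k, A k i * A k j := by
    intro i j
    have := congrFun (congrFun hA i) j
    simpa [Matrix.sum_apply, Matrix.vecMulVec_apply] using this
  have : pr P q = ∑ k, qf P (WithLp.toLp 2 (A k)) := by
    simp only [pr, qf, hA', Finset.mul_sum]
    rw [show (∑ k, ∑ i, ∑ j, P i j * A k i * A k j) = ∑ i, ∑ k, ∑ j, P i j * A k i * A k j from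
      Finset.sum_comm]
    refine Finset.sum_congr rfl fun i _ => ?_
    rw [show (∑ k, ∑ j, P i j * A k i * A k j) = ∑ j, ∑ k, P i j * A k i * A k j from
      Finset.sum_comm]
    refine Finset.sum_congr rfl fun j _ => Finset.sum_congr rfl fun k _ => ?_
    ring
  rw [this]
  exact Finset.sum_nonneg fun k _ => hP _

lemma pr_sub {n : ℕ} (P q r : Fin n → Fin n → ℝ) :
    pr P (fun i j => q i j - r i j) = pr P q - pr P r := by
  simp [pr, mul_sub, Finset.sum_sub_distrib]

lemma pr_add {n : ℕ} (P q r : Fin n → Fin n → ℝ) :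
    pr P (fun i j => q i j + r i j) = pr P q + pr P r := by
  simp [pr, mul_add, Finset.sum_add_distrib]

lemma pr_smul {n : ℕ} (P q : Fin n → Fin n → ℝ) (c : ℝ) :
    pr P (fun i j => c * q i j) = c * pr P q := by
  simp only [pr, Finset.mul_sum]
  refine Finset.sum_congr rfl fun i _ => Finset.sum_congr rfl fun j _ => ?_
  ring

lemma qf_sub {n : ℕ} (q r : Fin n → Fin n → ℝ) (ξ : E n) :
    qf (fun i j => q i j - r i j) ξ = qf q ξ - qf r ξ := by
  simp [qf, sub_mul, Finset.sum_sub_distrib]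

lemma qf_add {n : ℕ} (q r : Fin n → Fin n → ℝ) (ξ : E n) :
    qf (fun i j => q i j + r i j) ξ = qf q ξ + qf r ξ := by
  simp [qf, add_mul, Finset.sum_add_distrib]

lemma qf_smul {n : ℕ} (q : Fin n → Fin n → ℝ) (ξ : E n) (c : ℝ) :
    qf (fun i j => c * q i j) ξ = c * qf q ξ := by
  simp only [qf, Finset.mul_sum]
  refine Finset.sum_congr rfl fun i _ => Finset.sum_congr rfl fun j _ => ?_
  ring

/-- Identity matrix. -/
def idm {n : ℕ} : Fin n → Fin n → ℝ := fun i j => if i = j then 1 else 0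

lemma norm_sq_E {n : ℕ} (ξ : E n) : ‖ξ‖ ^ 2 = ∑ i, ξ i ^ 2 := by
  rw [EuclideanSpace.norm_sq_eq]; simp

lemma qf_idm {n : ℕ} (ξ : E n) : qf idm ξ = ‖ξ‖ ^ 2 := by
  rw [norm_sq_E]; simp [qf, idm, pow_two]

lemma pr_idm {n : ℕ} (P : Fin n → Fin n → ℝ) : pr P idm = ∑ i, P i i := by
  simp [pr, idm]

/-- `z zᵀ`. -/
def outer {n : ℕ} (z : E n) : Fin n → Fin n → ℝ := fun i j => z i * z j

lemma pr_outer {n : ℕ} (P : Fin n → Fin n → ℝ) (z : E n) : pr P (outer z) = qf P z := by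
  simp [pr, qf, outer, mul_assoc]

lemma qf_outer {n : ℕ} (z ξ : E n) : qf (outer z) ξ = (inner ℝ z ξ) ^ 2 := by
  simp only [qf, outer, PiLp.inner_apply, pow_two, Finset.sum_mul_sum]
  refine Finset.sum_congr rfl fun i _ => Finset.sum_congr rfl fun j _ => ?_
  simp; ring

lemma pr_le {n : ℕ} {P q : Fin n → Fin n → ℝ} {c : ℝ} (hP : ∀ ξ, 0 ≤ qf P ξ)
    (hs : ∀ i j, q i j = q j i) (hq : ∀ ξ, qf q ξ ≤ c * ‖ξ‖ ^ 2) : pr P q ≤ c * ∑ i, P i i := by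
  have := pr_nonneg (P := P) (q := fun i j => c * idm i j - q i j) hP
    (by intro i j; simp only [hs i j, idm, eq_comm]) (by
      intro ξ; rw [qf_sub, qf_smul, qf_idm]; linarith [hq ξ])
  rw [pr_sub, pr_smul, pr_idm] at this
  linarith

/-- Second-order jet data of `G` at `X`. -/
structure Jet {n : ℕ} (G : E n × ℝ → ℝ) (X : E n × ℝ) (S : Fin n → Fin n → ℝ) (σ : ℝ) : Prop where
  symm : ∀ i j, S i j = S j i
  dx : ∀ ξ : E n, D2Along (fun τ : ℝ => G (X.1 + τ • ξ, X.2)) (qf S ξ)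
  dt : HasDerivAt (fun t => G (X.1, t)) σ X.2

lemma Jet.add {n : ℕ} {G H : E n × ℝ → ℝ} {X : E n × ℝ} {S T : Fin n → Fin n → ℝ} {σ τ : ℝ}
    (hG : Jet G X S σ) (hH : Jet H X T τ) :
    Jet (fun X => G X + H X) X (fun i j => S i j + T i j) (σ + τ) := by
  refine ⟨fun i j => by rw [hG.symm i j, hH.symm i j], fun ξ => ?_, hG.dt.add hH.dt⟩
  rw [qf_add]
  exact (hG.dx ξ).add (hH.dx ξ)

lemma Jet.const_mul {n : ℕ} {G : E n × ℝ → ℝ} {X : E n × ℝ} {S : Fin n → Fin n → ℝ} {σ : ℝ}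
    (hG : Jet G X S σ) (c : ℝ) :
    Jet (fun X => c * G X) X (fun i j => c * S i j) (c * σ) := by
  refine ⟨fun i j => by rw [hG.symm i j], fun ξ => ?_, hG.dt.const_mul c⟩
  rw [qf_smul]
  exact (hG.dx ξ).const_mul c

lemma Jet.sub {n : ℕ} {G H : E n × ℝ → ℝ} {X : E n × ℝ} {S T : Fin n → Fin n → ℝ} {σ τ : ℝ}
    (hG : Jet G X S σ) (hH : Jet H X T τ) :
    Jet (fun X => G X - H X) X (fun i j => S i j - T i j) (σ - τ) := by
  refine ⟨fun i j => by rw [hG.symm i j, hH.symm i j], fun ξ => ?_, hG.dt.sub hH.dt⟩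
  rw [qf_sub]
  exact (hG.dx ξ).sub (hH.dx ξ)

lemma Jet.const {n : ℕ} (c : ℝ) (X : E n × ℝ) :
    Jet (fun _ => c) X (fun _ _ => 0) 0 := by
  refine ⟨fun i j => rfl, fun ξ => ?_, hasDerivAt_const _ _⟩
  have := D2Along.quad c 0 0
  simpa [qf] using this

lemma E_sum_single {n : ℕ} (ξ : E n) : ξ = ∑ i, ξ i • EuclideanSpace.single i (1:ℝ) := by
  ext j
  simp [Pi.single_apply]

lemma jet_of_smooth {n : ℕ} {u : E n × ℝ → ℝ} {V : Set (E n × ℝ)} (hu : ParabolicSmoothOn u V)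
    {X : E n × ℝ} (hX : X ∈ V) : Jet u X (D2 u X) (Dt u X) := by
  obtain ⟨h1, h2⟩ := hu X hX
  set g : E n → ℝ := fun x => u (x, X.2) with hg
  have hdd : DifferentiableAt ℝ (fderiv ℝ g) X.1 :=
    (h1.fderiv_right (m := 1) (by norm_num)).differentiableAt (by norm_num)
  have hD2 : ∀ i j, D2 u X i j = fderiv ℝ (fderiv ℝ g) X.1 (EuclideanSpace.single i 1)
      (EuclideanSpace.single j 1) := by
    intro i j
    unfold D2
    change fderiv ℝ (fun x => fderiv ℝ g x (EuclideanSpace.single j 1)) X.1 _ = _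
    rw [fderiv_clm_apply hdd (differentiableAt_const _)]
    simp
  have hsym := (h1.isSymmSndFDerivAt (by simp))
  refine ⟨fun i j => ?_, fun ξ => ?_, h2.hasDerivAt⟩
  · rw [hD2, hD2]; exact hsym _ _
  · have hl : ∀ τ : ℝ, HasDerivAt (fun τ : ℝ => X.1 + τ • ξ) ξ τ := by
      intro τ
      simpa using ((hasDerivAt_id τ).smul_const ξ).const_add X.1
    have hev : ∀ᶠ x in 𝓝 X.1, DifferentiableAt ℝ g x := by
      have := h1.eventually (by simp)
      filter_upwards [this] with x hx using hx.differentiableAt (by norm_num)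
    have hc : Tendsto (fun τ : ℝ => X.1 + τ • ξ) (𝓝 0) (𝓝 X.1) := by
      have := (hl 0).continuousAt.tendsto
      simpa using this
    refine ⟨fun τ => fderiv ℝ g (X.1 + τ • ξ) ξ, ?_, ?_⟩
    · filter_upwards [hc.eventually hev] with τ hτ
      exact hτ.hasFDerivAt.comp_hasDerivAt τ (hl τ)
    · have hq : qf (D2 u X) ξ = fderiv ℝ (fderiv ℝ g) X.1 ξ ξ := by
        conv_rhs => rw [E_sum_single ξ]
        simp only [map_sum, map_smul, sum_apply, smul_apply,
          qf, hD2, smul_eq_mul, Finset.mul_sum]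
        rw [Finset.sum_comm]
        refine Finset.sum_congr rfl fun i _ => Finset.sum_congr rfl fun j _ => ?_
        ring
      rw [hq]
      have h0 : HasFDerivAt (fderiv ℝ g) (fderiv ℝ (fderiv ℝ g) X.1) (X.1 + (0:ℝ) • ξ) := by
        simpa using hdd.hasFDerivAt
      have := h0.comp_hasDerivAt (0:ℝ) (hl 0)
      exact (this.clm_apply (hasDerivAt_const (0:ℝ) ξ)).congr_deriv (by simp)

/-- Left-sided minimum gives nonpositive derivative. -/
lemma deriv_nonpos_of_left_min {f : ℝ → ℝ} {σ t : ℝ} (hf : HasDerivAt f σ t)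
    (hm : ∀ᶠ s in 𝓝[<] t, f t ≤ f s) : σ ≤ 0 := by
  have h1 : Tendsto (slope f t) (𝓝[<] t) (𝓝 σ) :=
    (hasDerivAt_iff_tendsto_slope.mp hf).mono_left (nhdsWithin_mono _ (fun s hs => ne_of_lt hs))
  refine le_of_tendsto h1 ?_
  filter_upwards [hm, self_mem_nhdsWithin] with s hs hlt
  rw [slope_def_field]
  exact div_nonpos_of_nonneg_of_nonpos (by linarith) (by have : s < t := hlt; linarith)

lemma abs_mp {α : Type*} [TopologicalSpace α] [T2Space α] {D K : Set α} {v : α → ℝ}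
    (hK : IsCompact K)
    (hDK : D ⊆ K) (hb : ∀ Z ∈ K, Z ∉ D → ∀ ε > 0, ∀ᶠ X in 𝓝[D] Z, -ε < v X)
    (hc : ContinuousOn v D) (hno : ∀ X ∈ D, v X < 0 → ¬ ∀ Y ∈ D, v X ≤ v Y) :
    ∀ X ∈ D, 0 ≤ v X := by
  intro X0 hX0
  by_contra hneg
  push Not at hneg
  set C := {X ∈ D | v X ≤ v X0} with hC
  have hCK : C ⊆ K := fun X hX => hDK hX.1
  have hcl : IsClosed C := by
    refine isClosed_of_closure_subset fun Z hZ => ?_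
    have hZK : Z ∈ K := (closure_minimal hCK hK.isClosed) hZ
    have hfr : ∃ᶠ X in 𝓝[D] Z, v X ≤ v X0 := by
      rw [mem_closure_iff_frequently] at hZ
      rw [frequently_nhdsWithin_iff]
      exact hZ.mono fun X hX => ⟨hX.2, hX.1⟩
    by_cases hZD : Z ∈ D
    · refine ⟨hZD, ?_⟩
      by_contra hlt
      push Not at hlt
      have := (hc Z hZD).tendsto.eventually (lt_mem_nhds hlt)
      obtain ⟨X, h1, h2⟩ := (hfr.and_eventually this).exists
      linarith
    · have := hb Z hZK hZD (- v X0) (by linarith)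
      obtain ⟨X, h1, h2⟩ := (hfr.and_eventually this).exists
      linarith
  have hcomp : IsCompact C := hK.of_isClosed_subset hcl hCK
  obtain ⟨X, hX, hmin⟩ := hcomp.exists_isMinOn ⟨X0, hX0, le_rfl⟩
    (hc.mono fun X hX => hX.1)
  refine hno X hX.1 (lt_of_le_of_lt hX.2 hneg) fun Y hY => ?_
  by_cases h : v Y ≤ v X0
  · exact hmin ⟨hY, h⟩
  · exact hX.2.trans (le_of_lt (not_le.mp h))

/-- Ellipticity and boundedness on a set. -/
def Ell {n : ℕ} (ν : ℝ) (a : E n × ℝ → Fin n → Fin n → ℝ) (V : Set (E n × ℝ)) : Prop :=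
  ∀ X ∈ V, (∀ ξ : E n, ν * ‖ξ‖ ^ 2 ≤ qf (a X) ξ) ∧ ∀ i j, |a X i j| ≤ ν⁻¹

lemma Ell.mono {n : ℕ} {ν : ℝ} {a : E n × ℝ → Fin n → Fin n → ℝ} {V W : Set (E n × ℝ)}
    (h : Ell ν a V) (hW : W ⊆ V) : Ell ν a W := fun X hX => h X (hW hX)

lemma IsParabolicCoeff.ell {n : ℕ} {ν : ℝ} {a : E n × ℝ → Fin n → Fin n → ℝ}
    {V : Set (E n × ℝ)} (h : IsParabolicCoeff ν a V) : Ell ν a V := by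
  intro X hX
  refine ⟨fun ξ => ?_, (h.2 X hX).2⟩
  rw [norm_sq_E]
  exact (h.2 X hX).1 _

lemma SolvesL.mono {n : ℕ} {a : E n × ℝ → Fin n → Fin n → ℝ} {u : E n × ℝ → ℝ}
    {V W : Set (E n × ℝ)} (h : SolvesL a u V) (hW : W ⊆ V) : SolvesL a u W :=
  ⟨fun X hX => h.1 X (hW hX), fun X hX => h.2 X (hW hX)⟩

lemma SolvesL.eq {n : ℕ} {a : E n × ℝ → Fin n → Fin n → ℝ} {u : E n × ℝ → ℝ}
    {V : Set (E n × ℝ)} (h : SolvesL a u V) {X : E n × ℝ} (hX : X ∈ V) :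
    pr (a X) (D2 u X) = Dt u X := by
  have := h.2 X hX
  unfold LVal at this
  unfold pr
  linarith

/-- `G` is a strict subsolution at `X`. -/
def StrictSub {n : ℕ} (a : E n × ℝ → Fin n → Fin n → ℝ) (G : E n × ℝ → ℝ) (X : E n × ℝ) : Prop :=
  ∃ S σ, Jet G X S σ ∧ σ < pr (a X) S

lemma no_min {n : ℕ} {ν : ℝ} (hν : 0 < ν) {a : E n × ℝ → Fin n → Fin n → ℝ} {u G : E n × ℝ → ℝ}
    {D : Set (E n × ℝ)} (hu : SolvesL a u D) (ha : Ell ν a D) {X : E n × ℝ} (hX : X ∈ D)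
    (hG : StrictSub a G X) (hsp : ∀ᶠ x in 𝓝 X.1, (x, X.2) ∈ D)
    (htm : ∀ᶠ t in 𝓝[<] X.2, (X.1, t) ∈ D) : ¬ ∀ Y ∈ D, u X - G X ≤ u Y - G Y := by
  intro hmin
  obtain ⟨S, σ, hJ, hlt⟩ := hG
  have hJv := (jet_of_smooth hu.1 hX).sub hJ
  have h1 : Dt u X - σ ≤ 0 := by
    refine deriv_nonpos_of_left_min hJv.dt ?_
    filter_upwards [htm] with t ht using hmin _ ht
  have h2 : 0 ≤ pr (a X) (fun i j => D2 u X i j - S i j) := by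
    refine pr_nonneg (fun ξ => ?_) hJv.symm (fun ξ => ?_)
    · exact le_trans (by positivity) ((ha X hX).1 ξ)
    · refine (hJv.dx ξ).nonneg_of_localMin ?_
      have hc : Tendsto (fun τ : ℝ => X.1 + τ • ξ) (𝓝 0) (𝓝 X.1) := by
        have : ContinuousAt (fun τ : ℝ => X.1 + τ • ξ) 0 := by fun_prop
        simpa using this.tendsto
      filter_upwards [hc.eventually hsp] with τ hτ
      simpa using hmin _ hτ
  rw [pr_sub, hu.eq hX] at h2
  linarith

lemma comparison {n : ℕ} {ν : ℝ} (hν : 0 < ν) {a : E n × ℝ → Fin n → Fin n → ℝ}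
    {u G : E n × ℝ → ℝ}
    {D K : Set (E n × ℝ)} (hu : SolvesL a u D) (ha : Ell ν a D) (hK : IsCompact K) (hDK : D ⊆ K)
    (huc : ContinuousOn u D) (hGc : ContinuousOn G D)
    (hG : ∀ X ∈ D, StrictSub a G X)
    (hsp : ∀ X ∈ D, ∀ᶠ x in 𝓝 X.1, (x, X.2) ∈ D)
    (htm : ∀ X ∈ D, ∀ᶠ t in 𝓝[<] X.2, (X.1, t) ∈ D)
    (hb : ∀ Z ∈ K, Z ∉ D → ∀ ε > 0, ∀ᶠ X in 𝓝[D] Z, G X - ε < u X) :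
    ∀ X ∈ D, G X ≤ u X := by
  intro X hX
  have := abs_mp (v := fun X => u X - G X) hK hDK ?_ (huc.sub hGc) ?_ X hX
  · linarith
  · intro Z hZ hZD ε hε
    filter_upwards [hb Z hZ hZD ε hε] with Y hY
    linarith
  · intro Y hY _
    exact no_min hν hu ha hY (hG Y hY) (hsp Y hY) (htm Y hY)

lemma Ell.trace_le {n : ℕ} {ν : ℝ} {a : E n × ℝ → Fin n → Fin n → ℝ} {V : Set (E n × ℝ)}
    (h : Ell ν a V) {X : E n × ℝ} (hX : X ∈ V) : ∑ i, a X i i ≤ n / ν := by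
  calc ∑ i, a X i i ≤ ∑ _i : Fin n, ν⁻¹ := Finset.sum_le_sum fun i _ =>
        (le_abs_self _).trans ((h X hX).2 i i)
    _ = n / ν := by simp [div_eq_mul_inv]

lemma jet_normsq {n : ℕ} (x0 : E n) (X : E n × ℝ) :
    Jet (fun X => ‖X.1 - x0‖ ^ 2) X (fun i j => 2 * idm i j) 0 := by
  refine ⟨fun i j => by simp [idm, eq_comm], fun ξ => ?_, hasDerivAt_const X.2 (‖X.1 - x0‖ ^ 2)⟩
  rw [qf_smul, qf_idm]
  refine (D2Along.quad (‖X.1 - x0‖ ^ 2) (2 * inner ℝ (X.1 - x0) ξ) (‖ξ‖ ^ 2)).congr ?_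
  refine Eventually.of_forall fun τ => ?_
  show ‖X.1 + τ • ξ - x0‖ ^ 2 = _
  rw [show X.1 + τ • ξ - x0 = (X.1 - x0) + τ • ξ by abel, norm_add_sq_real, inner_smul_right,
    norm_smul, mul_pow, Real.norm_eq_abs, sq_abs]
  ring

lemma jet_time {n : ℕ} (α : ℝ) (X : E n × ℝ) :
    Jet (fun X => X.2 - α) X (fun _ _ => 0) 1 := by
  refine ⟨fun i j => rfl, fun ξ => ?_, ?_⟩
  · have := D2Along.quad (X.2 - α) 0 0
    simpa [qf] using this
  · exact (hasDerivAt_id X.2).sub_const α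

/-- The parabolic paraboloid. -/
def bq {n : ℕ} (x0 : E n) (α K : ℝ) (X : E n × ℝ) : ℝ := ‖X.1 - x0‖ ^ 2 + K * (X.2 - α)

lemma bq_jet {n : ℕ} (x0 : E n) (α K : ℝ) (X : E n × ℝ) :
    Jet (bq x0 α K) X (fun i j => 2 * idm i j + K * (fun _ _ => (0:ℝ)) i j) (0 + K * 1) :=
  (jet_normsq x0 X).add ((jet_time α X).const_mul K)

lemma bq_pr {n : ℕ} {ν : ℝ} {a : E n × ℝ → Fin n → Fin n → ℝ} {V : Set (E n × ℝ)}
    (h : Ell ν a V) {X : E n × ℝ} (hX : X ∈ V) (K : ℝ) :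
    pr (a X) (fun i j => 2 * idm i j + K * (fun _ _ => (0:ℝ)) i j) ≤ 2 * n / ν := by
  have := h.trace_le hX
  rw [pr_add, pr_smul, pr_idm, pr_smul]
  have h0 : pr (a X) (fun _ _ => (0:ℝ)) = 0 := by simp [pr]
  rw [h0, mul_div_assoc]
  linarith

lemma bq_cont {n : ℕ} (x0 : E n) (α K : ℝ) : Continuous (bq x0 α K) := by
  unfold bq; fun_prop

/-- Constant minus paraboloid plus strict-or-weak subsolution is a strict subsolution. -/
lemma strictSub_sub_bq {n : ℕ} {ν : ℝ} {a : E n × ℝ → Fin n → Fin n → ℝ}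
    {V : Set (E n × ℝ)}
    (h : Ell ν a V) {X : E n × ℝ} (hX : X ∈ V) (x0 : E n) (α K c A : ℝ) (hA : 0 < A)
    (hK : 2 * n / ν < K) : StrictSub a (fun X => c - A * bq x0 α K X) X := by
  refine ⟨_, _, (Jet.const c X).sub ((bq_jet x0 α K X).const_mul A), ?_⟩
  rw [pr_sub, pr_smul]
  have h0 : pr (a X) (fun _ _ => (0:ℝ)) = 0 := by simp [pr]
  have := bq_pr h hX K
  rw [h0]
  nlinarith

lemma StrictSub.add {n : ℕ} {a : E n × ℝ → Fin n → Fin n → ℝ} {G H : E n × ℝ → ℝ}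
    {X : E n × ℝ} (hG : StrictSub a G X) (hH : StrictSub a H X) :
    StrictSub a (fun X => G X + H X) X := by
  obtain ⟨S, σ, h1, h2⟩ := hG
  obtain ⟨T, τ, h3, h4⟩ := hH
  refine ⟨_, _, h1.add h3, ?_⟩
  rw [pr_add]; linarith

lemma StrictSub.const_mul {n : ℕ} {a : E n × ℝ → Fin n → Fin n → ℝ} {G : E n × ℝ → ℝ}
    {X : E n × ℝ} (hG : StrictSub a G X) {c : ℝ} (hc : 0 < c) :
    StrictSub a (fun X => c * G X) X := by
  obtain ⟨S, σ, h1, h2⟩ := hG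
  refine ⟨_, _, h1.const_mul c, ?_⟩
  rw [pr_smul]; exact mul_lt_mul_of_pos_left h2 hc

/-- The moving coordinate of a tube. -/
def tz {n : ℕ} (p v : E n) (t0 : ℝ) (X : E n × ℝ) : E n := X.1 - p - (X.2 - t0) • v

/-- The tube subsolution. -/
def tubeG {n : ℕ} (p v : E n) (t0 r κ : ℝ) (X : E n × ℝ) : ℝ :=
  Real.exp (-κ * (X.2 - t0)) * (r ^ 2 - ‖tz p v t0 X‖ ^ 2) ^ 2

lemma tz_cont {n : ℕ} (p v : E n) (t0 : ℝ) : Continuous (tz p v t0) := by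
  unfold tz; fun_prop

lemma tubeG_cont {n : ℕ} (p v : E n) (t0 r κ : ℝ) : Continuous (tubeG p v t0 r κ) := by
  have := tz_cont p v t0
  unfold tubeG; fun_prop

lemma D2Along.quad_sq (a b c : ℝ) :
    D2Along (fun τ => (a + b * τ + c * τ ^ 2) ^ 2) (2 * b ^ 2 + 4 * a * c) := by
  have hd : ∀ τ : ℝ, HasDerivAt (fun τ => a + b * τ + c * τ ^ 2) (b + 2 * c * τ) τ := by
    intro τ
    have h1 := (((hasDerivAt_id τ).const_mul b).const_add a).add
      (((hasDerivAt_id τ).pow 2).const_mul c)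
    refine h1.congr_deriv ?_
    simp; ring
  have hd2 : ∀ τ : ℝ, HasDerivAt (fun τ => b + 2 * c * τ) (2 * c) τ := by
    intro τ
    have h1 := ((hasDerivAt_id τ).const_mul (2 * c)).const_add b
    simpa using h1
  refine ⟨fun τ => 2 * ((a + b * τ + c * τ ^ 2) * (b + 2 * c * τ)),
    Eventually.of_forall fun τ => ?_, ?_⟩
  · refine ((hd τ).pow 2).congr_deriv ?_
    simp; ring
  · refine (((hd 0).mul (hd2 0)).const_mul 2).congr_deriv ?_
    simp; ring

lemma tubeG_jet {n : ℕ} (p v : E n) (t0 r κ : ℝ) (X : E n × ℝ) :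
    Jet (tubeG p v t0 r κ) X
      (fun i j => Real.exp (-κ * (X.2 - t0)) * (8 * outer (tz p v t0 X) i j -
        (4 * (r ^ 2 - ‖tz p v t0 X‖ ^ 2)) * idm i j))
      (Real.exp (-κ * (X.2 - t0)) * (-κ * (r ^ 2 - ‖tz p v t0 X‖ ^ 2) ^ 2 +
        4 * (r ^ 2 - ‖tz p v t0 X‖ ^ 2) * inner ℝ (tz p v t0 X) v)) := by
  set z := tz p v t0 X with hz
  refine ⟨fun i j => by simp [idm, outer, eq_comm, mul_comm], fun ξ => ?_, ?_⟩
  · rw [qf_smul, qf_sub, qf_smul, qf_smul, qf_idm, qf_outer]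
    have := (D2Along.quad_sq (r ^ 2 - ‖z‖ ^ 2) (-2 * inner ℝ z ξ) (- ‖ξ‖ ^ 2)).const_mul
      (Real.exp (-κ * (X.2 - t0)))
    have h2 := this.congr (g := fun τ : ℝ => tubeG p v t0 r κ (X.1 + τ • ξ, X.2)) ?_
    · convert h2 using 1
      ring
    · refine Eventually.of_forall fun τ => ?_
      show Real.exp (-κ * (X.2 - t0)) * (r ^ 2 - ‖tz p v t0 (X.1 + τ • ξ, X.2)‖ ^ 2) ^ 2 = _
      have e : tz p v t0 (X.1 + τ • ξ, X.2) = z + τ • ξ := by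
        simp only [hz, tz]; abel
      rw [e, norm_add_sq_real, inner_smul_right, norm_smul, mul_pow, Real.norm_eq_abs, sq_abs]
      ring
  · have hline : HasDerivAt (fun t : ℝ => tz p v t0 (X.1, t)) (-v) X.2 := by
      have := (((hasDerivAt_id X.2).sub_const t0).smul_const v).const_sub (X.1 - p)
      simpa [tz] using this
    have hn := hline.norm_sq
    have hn2 := ((hn.const_sub (r ^ 2)).pow 2)
    have he : HasDerivAt (fun t : ℝ => Real.exp (-κ * (t - t0)))
        (Real.exp (-κ * (X.2 - t0)) * -κ) X.2 := by
      have := (((hasDerivAt_id X.2).sub_const t0).const_mul (-κ)).exp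
      simpa using this
    have := he.mul hn2
    refine this.congr_deriv ?_
    have e : tz p v t0 (X.1, X.2) = z := rfl
    simp only [e, inner_neg_right]
    simp
    ring

/-- Decay rate of the tube subsolution. -/
def kap (n : ℕ) (ν r V : ℝ) : ℝ := (4 * n / ν + 4 * r * V + 8 * ν) ^ 2 / (32 * ν * r ^ 2) + 1

lemma tubeG_strictSub {n : ℕ} {ν r V : ℝ} (hν : 0 < ν) (hr : 0 < r)
    {a : E n × ℝ → Fin n → Fin n → ℝ} {W : Set (E n × ℝ)}
    (h : Ell ν a W) {X : E n × ℝ} (hX : X ∈ W) (p v : E n) (t0 : ℝ) (hv : ‖v‖ ≤ V)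
    (hz : ‖tz p v t0 X‖ < r) : StrictSub a (tubeG p v t0 r (kap n ν r V)) X := by
  refine ⟨_, _, tubeG_jet p v t0 r _ X, ?_⟩
  set z := tz p v t0 X with hz'
  rw [pr_smul, pr_sub, pr_smul, pr_smul, pr_idm, pr_outer]
  refine mul_lt_mul_of_pos_left ?_ (Real.exp_pos _)
  have h1 := (h X hX).1 z
  have h2 := h.trace_le hX
  have h3 : |inner ℝ z v| ≤ r * V :=
    (abs_real_inner_le_norm z v).trans (mul_le_mul hz.le hv (norm_nonneg _) hr.le)
  have h3' := neg_le_of_abs_le h3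
  have h3'' := le_of_abs_le h3
  set ψ := r ^ 2 - ‖z‖ ^ 2 with hψ
  have hψ0 : 0 < ψ := by
    have : ‖z‖ ^ 2 < r ^ 2 := by
      have := norm_nonneg z
      nlinarith
    linarith
  set C := 4 * n / ν + 4 * r * V with hC
  have hk : kap n ν r V = (C + 8 * ν) ^ 2 / (32 * ν * r ^ 2) + 1 := rfl
  set k := kap n ν r V
  have hk2 : (k - 1) * (32 * ν * r ^ 2) = (C + 8 * ν) ^ 2 := by
    rw [hk]; field_simp; ring
  have e1 : ‖z‖ ^ 2 = r ^ 2 - ψ := by rw [hψ]; ring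
  have hψz : ψ * inner ℝ z v ≤ ψ * (r * V) := mul_le_mul_of_nonneg_left h3'' hψ0.le
  have hψt : ψ * ∑ i, a X i i ≤ ψ * (n / ν) := mul_le_mul_of_nonneg_left h2 hψ0.le
  rw [e1] at h1
  have hCψ : ψ * C = 4 * (ψ * (n / ν)) + 4 * (ψ * (r * V)) := by rw [hC]; ring
  have key : 0 < 8 * ν * (r ^ 2 - ψ) - C * ψ + k * ψ ^ 2 := by
    have hp : 0 < 32 * ν * r ^ 2 := by positivity
    have : 0 < (32 * ν * r ^ 2) * (8 * ν * (r ^ 2 - ψ) - C * ψ + k * ψ ^ 2) := by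
      have e : (32 * ν * r ^ 2) * (8 * ν * (r ^ 2 - ψ) - C * ψ + k * ψ ^ 2)
        = (16 * ν * r ^ 2 - (C + 8 * ν) * ψ) ^ 2 + ((k - 1) * (32 * ν * r ^ 2)
          - (C + 8 * ν) ^ 2) * ψ ^ 2 + (32 * ν * r ^ 2) * ψ ^ 2 := by ring
      rw [e, hk2]
      have : 0 < (32 * ν * r ^ 2) * ψ ^ 2 := by positivity
      nlinarith [sq_nonneg (16 * ν * r ^ 2 - (C + 8 * ν) * ψ)]
    exact (mul_pos_iff_of_pos_left hp).mp this
  nlinarith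

lemma tubeG_le {n : ℕ} (p v : E n) {t0 r κ : ℝ} (hκ : 0 ≤ κ) {X : E n × ℝ} (hX : t0 ≤ X.2)
    (hz : ‖tz p v t0 X‖ ≤ r) : tubeG p v t0 r κ X ≤ r ^ 4 := by
  unfold tubeG
  have h1 : Real.exp (-κ * (X.2 - t0)) ≤ 1 := by
    rw [Real.exp_le_one_iff]; nlinarith
  have h2 : ‖tz p v t0 X‖ ^ 2 ≤ r ^ 2 := by
    have := norm_nonneg (tz p v t0 X); nlinarith
  have h3 : (r ^ 2 - ‖tz p v t0 X‖ ^ 2) ^ 2 ≤ r ^ 4 := by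
    have : 0 ≤ ‖tz p v t0 X‖ ^ 2 := by positivity
    nlinarith
  calc _ ≤ 1 * (r ^ 2 - ‖tz p v t0 X‖ ^ 2) ^ 2 := mul_le_mul_of_nonneg_right h1 (by positivity)
    _ ≤ r ^ 4 := by linarith

lemma kap_pos {n : ℕ} {ν r V : ℝ} (hν : 0 < ν) : 0 < kap n ν r V := by
  unfold kap; positivity

/-! ### Part 2: Hölder estimate by doubling of variables -/

lemma D2Along.sqrt_line {ρ : ℝ} (hρ : 0 < ρ) :
    D2Along (fun τ => √(ρ + 2 * τ)) (-1 / (√ρ) ^ 3) := by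
  have hl : ∀ τ : ℝ, HasDerivAt (fun τ : ℝ => ρ + 2 * τ) 2 τ := by
    intro τ
    simpa using ((hasDerivAt_id τ).const_mul 2).const_add ρ
  have hpos : ∀ᶠ τ in 𝓝 (0:ℝ), 0 < ρ + 2 * τ := by
    have : ContinuousAt (fun τ : ℝ => ρ + 2 * τ) 0 := (hl 0).continuousAt
    exact this.tendsto.eventually (lt_mem_nhds (by simpa using hρ))
  have hs : ∀ τ : ℝ, 0 < ρ + 2 * τ → HasDerivAt (fun τ => √(ρ + 2 * τ)) (√(ρ + 2 * τ))⁻¹ τ := by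
    intro τ hτ
    refine ((hl τ).sqrt hτ.ne').congr_deriv ?_
    have : √(ρ + 2 * τ) ≠ 0 := (Real.sqrt_pos.mpr hτ).ne'
    field_simp
  refine ⟨fun τ => (√(ρ + 2 * τ))⁻¹, ?_, ?_⟩
  · filter_upwards [hpos] with τ hτ using hs τ hτ
  · have h0 : (0:ℝ) < ρ + 2 * 0 := by simpa using hρ
    refine ((hs 0 h0).inv (Real.sqrt_pos.mpr h0).ne').congr_deriv ?_
    simp only [mul_zero, add_zero]
    have : √ρ ≠ 0 := (Real.sqrt_pos.mpr hρ).ne'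
    field_simp

lemma sqrt_le_quartic {w s : ℝ} (hw : 0 < w) (hs : 0 ≤ s) :
    √s ≤ (s ^ 2 + 3 * w ^ 4) / (4 * w ^ 3) := by
  rw [le_div_iff₀ (by positivity)]
  set σ := √s with hσ
  have hσ0 : 0 ≤ σ := Real.sqrt_nonneg _
  have : s = σ ^ 2 := (Real.sq_sqrt hs).symm
  rw [this]
  nlinarith [mul_nonneg (sq_nonneg (σ - w)) (add_nonneg (add_nonneg (sq_nonneg σ)
    (mul_nonneg (mul_nonneg zero_le_two hσ0) hw.le)) (mul_nonneg zero_le_three (sq_nonneg w)))]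

lemma qf_zero_vec {n : ℕ} (S : Fin n → Fin n → ℝ) : qf S 0 = 0 := by simp [qf]

/-- Linear algebra core of the doubling argument. -/
lemma doubling_algebra {n : ℕ} (hn : 0 < n) {ν θ b c' : ℝ} (hν : 0 < ν) (hν1 : ν ≤ 1)
    (hb : 0 ≤ b) (hc' : 0 ≤ c')
    {A0 A1 X Y : Fin n → Fin n → ℝ} (hA0 : ∀ ξ : E n, ν * ‖ξ‖ ^ 2 ≤ qf A0 ξ)
    (hA0b : ∀ i j, |A0 i j| ≤ ν⁻¹)
    (hosc : ∀ i j, |A0 i j - A1 i j| ≤ θ) (hθ : 12 * n * (n * θ) ≤ ν)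
    (hX : ∀ i j, X i j = X j i) (hY : ∀ i j, Y i j = Y j i) {e : E n} (he : ‖e‖ = 1)
    (h1 : ∀ ξ : E n, qf X ξ ≤ (b / 2 + 2 * c') * ‖ξ‖ ^ 2)
    (h2 : ∀ ξ : E n, - qf Y ξ ≤ (b / 2 + 2 * c') * ‖ξ‖ ^ 2)
    (h3 : ∀ ξ : E n, qf X ξ - qf Y ξ ≤ 4 * c' * ‖ξ‖ ^ 2)
    (h4 : qf X e - qf Y e ≤ - b + 4 * c') :
    pr A0 X - pr A1 Y ≤ - (ν * b / 8) + c' * (3 / 2 * ν + 4 * n / ν) := by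
  have hθ0 : 0 ≤ θ := (abs_nonneg _).trans (hosc ⟨0, hn⟩ ⟨0, hn⟩)
  have hn1 : (1:ℝ) ≤ n := by exact_mod_cast hn
  set Θ : ℝ := n * θ with hΘ
  have hΘ0 : 0 ≤ Θ := by positivity
  have hΘν : 12 * Θ ≤ ν := by nlinarith
  -- form bound for differences
  have hform : ∀ ξ : E n, |qf (fun i j => A1 i j - A0 i j) ξ| ≤ Θ * ‖ξ‖ ^ 2 := by
    intro ξ
    have hs : ∑ i, ∑ j, |ξ i| * |ξ j| ≤ n * ‖ξ‖ ^ 2 := by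
      rw [← Finset.sum_mul_sum, norm_sq_E]
      have := Finset.sum_mul_sq_le_sq_mul_sq Finset.univ (fun i => |ξ i|) (fun _ => (1:ℝ))
      simp only [mul_one, sq_abs, one_pow, Finset.sum_const, Finset.card_univ, Fintype.card_fin,
        nsmul_eq_mul] at this
      nlinarith
    calc |qf (fun i j => A1 i j - A0 i j) ξ| ≤ ∑ i, ∑ j, θ * (|ξ i| * |ξ j|) := by
          unfold qf
          refine (Finset.abs_sum_le_sum_abs _ _).trans (Finset.sum_le_sum fun i _ => ?_)
          refine (Finset.abs_sum_le_sum_abs _ _).trans (Finset.sum_le_sum fun j _ => ?_)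
          rw [abs_mul, abs_mul, mul_assoc]
          refine mul_le_mul_of_nonneg_right ?_ (by positivity)
          rw [abs_sub_comm]; exact hosc i j
      _ = θ * ∑ i, ∑ j, |ξ i| * |ξ j| := by simp only [Finset.mul_sum]
      _ ≤ θ * (n * ‖ξ‖ ^ 2) := mul_le_mul_of_nonneg_left hs hθ0
      _ = Θ * ‖ξ‖ ^ 2 := by rw [hΘ]; ring
  set L := b / 2 + 2 * c' with hL
  have hL0 : 0 ≤ L := by positivity
  have t1 : pr (fun i j => (idm i j : ℝ)) X ≤ L * n := by
    have := pr_le (P := fun i j : Fin n => (idm i j : ℝ)) (q := X) (c := L)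
      (fun ξ => by rw [qf_idm]; positivity) hX h1
    refine this.trans (le_of_eq ?_)
    simp [idm]
  set P2 : Fin n → Fin n → ℝ := fun i j => (A1 i j - A0 i j) + Θ * idm i j with hP2
  have t2 : pr P2 (fun i j => - 1 * Y i j) ≤ L * (2 * Θ * n) := by
    have := pr_le (P := P2) (q := fun i j => - 1 * Y i j) (c := L) (fun ξ => by
      rw [hP2, qf_add, qf_smul, qf_idm]
      have := neg_le_of_abs_le (hform ξ); linarith) (fun i j => by rw [hY i j])
      (fun ξ => by rw [qf_smul]; linarith [h2 ξ])
    refine this.trans (mul_le_mul_of_nonneg_left ?_ hL0)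
    calc ∑ i, P2 i i ≤ ∑ _i : Fin n, 2 * Θ := Finset.sum_le_sum fun i _ => by
          simp only [hP2, idm, if_true]
          have := hosc i i
          rw [abs_sub_comm] at this
          have := le_of_abs_le this
          have : θ ≤ Θ := by rw [hΘ]; nlinarith
          linarith
      _ = 2 * Θ * n := by simp; ring
  set H : Fin n → Fin n → ℝ := fun i j => (A0 i j - Θ * idm i j) - (ν / 4) * outer e i j with hH
  have t3 : pr H (fun i j => X i j - Y i j) ≤ 4 * c' * (n / ν) := by
    have := pr_le (P := H) (q := fun i j => X i j - Y i j) (c := 4 * c') (fun ξ => by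
      rw [hH, qf_sub, qf_sub, qf_smul, qf_smul, qf_idm, qf_outer]
      have hi : (inner ℝ e ξ) ^ 2 ≤ ‖ξ‖ ^ 2 := by
        have := abs_real_inner_le_norm e ξ
        rw [he, one_mul] at this
        rw [← sq_abs]
        have := abs_nonneg (inner ℝ e ξ)
        nlinarith
      have := hA0 ξ
      have : 0 ≤ ‖ξ‖ ^ 2 := by positivity
      nlinarith) (fun i j => by rw [hX i j, hY i j]) (fun ξ => by rw [qf_sub]; exact h3 ξ)
    refine this.trans (mul_le_mul_of_nonneg_left ?_ (by positivity))
    calc ∑ i, H i i ≤ ∑ _i : Fin n, ν⁻¹ := Finset.sum_le_sum fun i _ => by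
          simp only [hH, idm, if_true, outer]
          have := le_of_abs_le (hA0b i i)
          nlinarith [mul_self_nonneg (e i)]
      _ = n / ν := by simp [div_eq_mul_inv]
  have dec : pr A0 X - pr A1 Y = Θ * pr (fun i j => (idm i j : ℝ)) X
      + pr P2 (fun i j => - 1 * Y i j) + pr H (fun i j => X i j - Y i j)
      + ν / 4 * (qf X e - qf Y e) := by
    have e1 : ∀ S : Fin n → Fin n → ℝ, qf S e = pr (outer e) S := by
      intro S
      simp only [qf, pr, outer]
      refine Finset.sum_congr rfl fun i _ => Finset.sum_congr rfl fun j _ => ?_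
      ring
    rw [e1, e1]
    simp only [pr, Finset.mul_sum, ← Finset.sum_sub_distrib, ← Finset.sum_add_distrib]
    refine Finset.sum_congr rfl fun i _ => Finset.sum_congr rfl fun j _ => ?_
    simp only [hP2, hH]
    ring
  rw [dec]
  have s1 : Θ * pr (fun i j => (idm i j : ℝ)) X ≤ Θ * (L * n) := mul_le_mul_of_nonneg_left t1 hΘ0
  have s4 : ν / 4 * (qf X e - qf Y e) ≤ ν / 4 * (- b + 4 * c') :=
    mul_le_mul_of_nonneg_left h4 (by positivity)
  have s5 : 3 * (n * Θ) * L ≤ ν / 4 * L := mul_le_mul_of_nonneg_right (by linarith) hL0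
  have s6 : ν / 4 * L = ν * b / 8 + ν * c' / 2 := by rw [hL]; ring
  have s7 : 4 * c' * (n / ν) = c' * (4 * n / ν) := by ring
  nlinarith

/-- Constant of the Hölder estimate. -/
def hB (n : ℕ) (ν r M : ℝ) : ℝ := 2 * M / √r * (25 * (3 + 4 * n / ν) / ν)

set_option maxHeartbeats 1000000 in
lemma holder {n : ℕ} (hn : 0 < n) {ν : ℝ} (hν : 0 < ν) (hν1 : ν ≤ 1)
    {a : E n × ℝ → Fin n → Fin n → ℝ} {u : E n × ℝ → ℝ} {p : E n} {t0 r M θ : ℝ} (hr : 0 < r)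
    (hM : 0 < M) (hu : SolvesL a u (closedBall p r ×ˢ Icc (t0 - r ^ 2) t0))
    (ha : Ell ν a (closedBall p r ×ˢ Icc (t0 - r ^ 2) t0))
    (huc : ContinuousOn u (closedBall p r ×ˢ Icc (t0 - r ^ 2) t0))
    (hub : ∀ X ∈ closedBall p r ×ˢ Icc (t0 - r ^ 2) t0, |u X| ≤ M)
    (hosc : ∀ X ∈ closedBall p r ×ˢ Icc (t0 - r ^ 2) t0,
      ∀ Y ∈ closedBall p r ×ˢ Icc (t0 - r ^ 2) t0, ∀ i j, |a X i j - a Y i j| ≤ θ)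
    (hθ : 12 * n * (n * θ) ≤ ν) :
    ∀ x ∈ closedBall p r, u (x, t0) - u (p, t0) ≤
      hB n ν r M * √‖x - p‖ + 2 * M / r ^ 2 * ‖x - p‖ ^ 2 := by
  set box := closedBall p r ×ˢ Icc (t0 - r ^ 2) t0 with hbox
  set B := hB n ν r M with hBdef
  set c' := 2 * M / r ^ 2 with hc'
  have hc'0 : 0 < c' := by positivity
  have hB0 : 0 < B := by rw [hBdef]; unfold hB; positivity
  have hcr : c' * r ^ 2 = 2 * M := by rw [hc']; field_simp
  set Φ : (E n × E n) × ℝ → ℝ := fun Z => u (Z.1.1, Z.2) - u (Z.1.2, Z.2)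
    - B * √‖Z.1.1 - Z.1.2‖ - c' * (‖Z.1.1 - p‖ ^ 2 + ‖Z.1.2 - p‖ ^ 2) - c' * (t0 - Z.2) with hΦ
  set K := (closedBall p r ×ˢ closedBall p r) ×ˢ Icc (t0 - r ^ 2) t0 with hK
  have hKc : IsCompact K := ((isCompact_closedBall p r).prod (isCompact_closedBall p r)).prod
    isCompact_Icc
  have hc1 : ContinuousOn (fun Z : (E n × E n) × ℝ => u (Z.1.1, Z.2)) K :=
    huc.comp (by fun_prop) (fun Z hZ => ⟨hZ.1.1, hZ.2⟩)
  have hc2 : ContinuousOn (fun Z : (E n × E n) × ℝ => u (Z.1.2, Z.2)) K :=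
    huc.comp (by fun_prop) (fun Z hZ => ⟨hZ.1.2, hZ.2⟩)
  have hΦc : ContinuousOn Φ K := by
    refine (((hc1.sub hc2).sub ?_).sub ?_).sub ?_ <;> exact Continuous.continuousOn (by fun_prop)
  have hpp : ((p, p), t0) ∈ K := by
    refine ⟨⟨mem_closedBall_self hr.le, mem_closedBall_self hr.le⟩, ?_, le_rfl⟩
    have : 0 < r ^ 2 := by positivity
    linarith
  obtain ⟨⟨⟨x, y⟩, t⟩, hZK, hmax⟩ := hKc.exists_isMaxOn ⟨_, hpp⟩ hΦc
  suffices hle : Φ ((x, y), t) ≤ 0 by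
    intro x' hx'
    have hxK : ((x', p), t0) ∈ K := ⟨⟨hx', hpp.1.1⟩, hpp.2⟩
    have := (hmax hxK).trans hle
    simp only [hΦ, sub_self, norm_zero] at this
    linarith
  by_contra hpos
  push Not at hpos
  have hx : ‖x - p‖ ≤ r := by simpa [dist_eq_norm] using hZK.1.1
  have hy : ‖y - p‖ ≤ r := by simpa [dist_eq_norm] using hZK.1.2
  have ht : t ∈ Icc (t0 - r ^ 2) t0 := hZK.2
  have hX : (x, t) ∈ box := ⟨hZK.1.1, ht⟩
  have hY : (y, t) ∈ box := ⟨hZK.1.2, ht⟩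
  have hux := abs_le.mp (hub _ hX)
  have huy := abs_le.mp (hub _ hY)
  have hpos' : 0 < u (x, t) - u (y, t) - B * √‖x - y‖ - c' * (‖x - p‖ ^ 2 + ‖y - p‖ ^ 2)
    - c' * (t0 - t) := hpos
  have hBs : 0 ≤ B * √‖x - y‖ := by positivity
  have hxn : 0 ≤ c' * ‖x - p‖ ^ 2 := by positivity
  have hyn : 0 ≤ c' * ‖y - p‖ ^ 2 := by positivity
  have htn : 0 ≤ c' * (t0 - t) := mul_nonneg hc'0.le (by linarith [ht.2])
  have hx' : ‖x - p‖ < r := by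
    refine lt_of_le_of_ne hx fun h => ?_
    rw [h] at hpos'; linarith [hux.2, huy.1]
  have hy' : ‖y - p‖ < r := by
    refine lt_of_le_of_ne hy fun h => ?_
    rw [h] at hpos'; linarith [hux.2, huy.1]
  have ht' : t0 - r ^ 2 < t := by
    refine lt_of_le_of_ne ht.1 fun h => ?_
    have : c' * (t0 - t) = c' * r ^ 2 := by rw [← h]; ring
    linarith [hux.2, huy.1]
  have hxy : x ≠ y := by
    intro h
    rw [h] at hpos' hxn hBs
    have hyy : u (y, t) - u (y, t) = 0 := sub_self _
    rw [hyy] at hpos'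
    linarith
  set z := x - y with hz
  have hzp : 0 < ‖z‖ := by rw [norm_pos_iff, hz]; exact sub_ne_zero.mpr hxy
  set w := √‖z‖ with hw
  have hwp : 0 < w := Real.sqrt_pos.mpr hzp
  have hw2 : w ^ 2 = ‖z‖ := Real.sq_sqrt hzp.le
  have jx := jet_of_smooth hu.1 hX
  have jy := jet_of_smooth hu.1 hY
  -- general test
  have test : ∀ (ξ η : E n) (h : ℝ → ℝ) (q : ℝ), D2Along h q →
      (∀ᶠ τ in 𝓝 (0:ℝ), √‖z + τ • (ξ - η)‖ ≤ h τ) → h 0 = w →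
      qf (D2 u (x, t)) ξ - qf (D2 u (y, t)) η ≤ B * q + 2 * c' * (‖ξ‖ ^ 2 + ‖η‖ ^ 2) := by
    intro ξ η h q hD hle h0
    have d1 := (jx.dx ξ).sub (jy.dx η)
    have d2 := (jet_normsq p (x, t)).dx ξ
    have d3 := (jet_normsq p (y, t)).dx η
    have D := ((hD.const_mul B).add ((d2.add d3).const_mul c')).sub d1
    have := D.nonneg_of_localMin ?_
    · rw [qf_smul, qf_smul, qf_idm, qf_idm] at this
      linarith
    · have hcx : Tendsto (fun τ : ℝ => x + τ • ξ) (𝓝 0) (𝓝 x) := by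
        have : ContinuousAt (fun τ : ℝ => x + τ • ξ) 0 := by fun_prop
        simpa using this.tendsto
      have hcy : Tendsto (fun τ : ℝ => y + τ • η) (𝓝 0) (𝓝 y) := by
        have : ContinuousAt (fun τ : ℝ => y + τ • η) 0 := by fun_prop
        simpa using this.tendsto
      have ex := hcx.eventually (isOpen_ball.mem_nhds (show x ∈ ball p r by
        simpa [dist_eq_norm] using hx'))
      have ey := hcy.eventually (isOpen_ball.mem_nhds (show y ∈ ball p r by
        simpa [dist_eq_norm] using hy'))
      filter_upwards [hle, ex, ey] with τ hτ hex hey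
      have hm := hmax (show ((x + τ • ξ, y + τ • η), t) ∈ K from
        ⟨⟨ball_subset_closedBall hex, ball_subset_closedBall hey⟩, ht⟩)
      simp only [hΦ, mem_ofPred_eq] at hm
      rw [show x + τ • ξ - (y + τ • η) = z + τ • (ξ - η) by rw [hz, smul_sub]; abel] at hm
      have := mul_le_mul_of_nonneg_left hτ hB0.le
      simp only [zero_smul, add_zero, h0]
      linarith
  have hquart : ∀ ξ : E n, D2Along (fun τ : ℝ => (‖z + τ • ξ‖ ^ 2 + 3 * w ^ 4) / (4 * w ^ 3))
      (1 / (2 * w ^ 3) * ‖ξ‖ ^ 2) := by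
    intro ξ
    have := (((jet_normsq (0 : E n) (z, t)).dx ξ).add (D2Along.quad (3 * w ^ 4) 0 0)).const_mul
      (1 / (4 * w ^ 3))
    rw [qf_smul, qf_idm] at this
    convert this using 1
    · funext τ; simp; ring
    · field_simp; ring
  have hq0 : (‖z‖ ^ 2 + 3 * w ^ 4) / (4 * w ^ 3) = w := by
    rw [← hw2]; field_simp; ring
  have T1 : ∀ ξ : E n, qf (D2 u (x, t)) ξ ≤ (B / w ^ 3 / 2 + 2 * c') * ‖ξ‖ ^ 2 := by
    intro ξ
    have := test ξ 0 _ _ (hquart ξ) (Eventually.of_forall fun τ => by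
      rw [sub_zero]; exact sqrt_le_quartic hwp (norm_nonneg _)) (by simpa using hq0)
    rw [qf_zero_vec, norm_zero] at this
    have e : B * (1 / (2 * w ^ 3) * ‖ξ‖ ^ 2) = B / w ^ 3 / 2 * ‖ξ‖ ^ 2 := by field_simp
    rw [e] at this
    linarith
  have T2 : ∀ ξ : E n, - qf (D2 u (y, t)) ξ ≤ (B / w ^ 3 / 2 + 2 * c') * ‖ξ‖ ^ 2 := by
    intro ξ
    have := test 0 ξ _ _ (hquart (-ξ)) (Eventually.of_forall fun τ => by
      rw [zero_sub]; exact sqrt_le_quartic hwp (norm_nonneg _)) (by simpa using hq0)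
    rw [qf_zero_vec, norm_zero, norm_neg] at this
    have e : B * (1 / (2 * w ^ 3) * ‖ξ‖ ^ 2) = B / w ^ 3 / 2 * ‖ξ‖ ^ 2 := by field_simp
    rw [e] at this
    linarith
  have T3 : ∀ ξ : E n, qf (D2 u (x, t)) ξ - qf (D2 u (y, t)) ξ ≤ 4 * c' * ‖ξ‖ ^ 2 := by
    intro ξ
    have := test ξ ξ _ _ (D2Along.quad w 0 0) (Eventually.of_forall fun τ => by
      simp [hw]) (by simp)
    linarith
  set e : E n := (‖z‖)⁻¹ • z with he
  have he1 : ‖e‖ = 1 := by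
    rw [he, norm_smul, norm_inv, norm_norm, inv_mul_cancel₀ hzp.ne']
  have T4 : qf (D2 u (x, t)) e - qf (D2 u (y, t)) e ≤ - (B / w ^ 3) + 4 * c' := by
    have := test e (-e) _ _ (D2Along.sqrt_line hzp) ?_ (by simp [hw])
    · have q1 : qf (D2 u (y, t)) (-e) = qf (D2 u (y, t)) e := by simp [qf]
      rw [q1, norm_neg, he1] at this
      have e2 : B * (-1 / w ^ 3) = - (B / w ^ 3) := by ring
      rw [e2] at this
      linarith
    · have hpos : ∀ᶠ τ in 𝓝 (0:ℝ), 0 < ‖z‖ + 2 * τ := by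
        have : ContinuousAt (fun τ : ℝ => ‖z‖ + 2 * τ) 0 := by fun_prop
        exact this.tendsto.eventually (lt_mem_nhds (by simpa using hzp))
      filter_upwards [hpos] with τ hτ
      have e3 : z + τ • (e - -e) = (‖z‖ + 2 * τ) • e := by
        have : ‖z‖ • e = z := by
          rw [he, smul_smul, mul_inv_cancel₀ hzp.ne', one_smul]
        rw [add_smul, this, sub_neg_eq_add, ← two_smul ℝ e, smul_smul, mul_comm 2 τ]
      rw [e3, norm_smul, he1, mul_one, Real.norm_eq_abs, abs_of_pos hτ]
  -- time derivative
  have hT : - c' ≤ Dt u (x, t) - Dt u (y, t) := by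
    have hd : HasDerivAt (fun s => (-c') * (s - t0) - (u (x, s) - u (y, s)))
        (-c' - (Dt u (x, t) - Dt u (y, t))) t := by
      have h1 := ((hasDerivAt_id t).sub_const t0).const_mul (-c')
      rw [mul_one] at h1
      exact h1.sub (jx.dt.sub jy.dt)
    have := deriv_nonpos_of_left_min hd ?_
    · linarith
    · have : ∀ᶠ s in 𝓝[<] t, t0 - r ^ 2 < s :=
        mem_nhdsWithin_of_mem_nhds (lt_mem_nhds ht')
      filter_upwards [this, self_mem_nhdsWithin] with s hs hst
      have hm := hmax (show ((x, y), s) ∈ K from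
        ⟨hZK.1, hs.le, (le_of_lt hst).trans ht.2⟩)
      simp only [hΦ, mem_ofPred_eq] at hm
      linarith
  have key := doubling_algebra hn hν hν1 (b := B / w ^ 3) (c' := c') (by positivity) hc'0.le
    (ha _ hX).1 (ha _ hX).2 (hosc _ hX _ hY) hθ jx.symm jy.symm he1 T1 T2 T3 T4
  rw [hu.eq hX, hu.eq hY] at key
  -- final contradiction
  have hzr : ‖z‖ ≤ 2 * r := by
    have : z = (x - p) - (y - p) := by rw [hz]; abel
    rw [this]
    exact (norm_sub_le _ _).trans (by linarith)
  have hw3 : w ^ 3 ≤ 3 * (√r) ^ 3 := by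
    have h1 : w ^ 2 ≤ 2 * (√r) ^ 2 := by rw [hw2, Real.sq_sqrt hr.le]; exact hzr
    have hs : 0 < √r := Real.sqrt_pos.mpr hr
    have h2 : w ≤ 3 / 2 * √r := by
      by_contra hcon
      push Not at hcon
      nlinarith
    calc w ^ 3 = w ^ 2 * w := by ring
      _ ≤ (2 * (√r) ^ 2) * (3 / 2 * √r) := mul_le_mul h1 h2 hwp.le (by positivity)
      _ = 3 * (√r) ^ 3 := by ring
  have hBw : 25 / 3 * (c' * (3 + 4 * n / ν) / ν) ≤ B / w ^ 3 := by
    rw [le_div_iff₀ (by positivity)]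
    have hs : 0 < √r := Real.sqrt_pos.mpr hr
    have hss : r = (√r) ^ 2 := (Real.sq_sqrt hr.le).symm
    have e1 : B = 25 / 3 * (c' * (3 + 4 * n / ν) / ν) * (3 * (√r) ^ 3) := by
      rw [hBdef, hc']; unfold hB
      have : r ^ 2 = (√r) ^ 4 := by rw [show (√r) ^ 4 = ((√r) ^ 2) ^ 2 by ring, Real.sq_sqrt hr.le]
      rw [this]
      field_simp
    rw [e1]
    exact mul_le_mul_of_nonneg_left hw3 (by positivity)
  have hfin : ν * (25 / 3 * (c' * (3 + 4 * n / ν) / ν)) ≤ ν * (B / w ^ 3) :=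
    mul_le_mul_of_nonneg_left hBw hν.le
  have e5 : ν * (25 / 3 * (c' * (3 + 4 * n / ν) / ν)) = 25 / 3 * (c' * (3 + 4 * n / ν)) := by
    field_simp
  rw [e5] at hfin
  have hnn : 0 ≤ c' * (4 * n / ν) := by positivity
  have hcν : c' * ν ≤ c' * 1 := mul_le_mul_of_nonneg_left hν1 hc'0.le
  have e6 : c' * (3 / 2 * ν + 4 * n / ν) = 3 / 2 * (c' * ν) + c' * (4 * n / ν) := by ring
  have e7 : c' * (3 + 4 * n / ν) = 3 * c' + c' * (4 * n / ν) := by ring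
  have e8 : ν * (B / w ^ 3) / 8 = (ν * (B / w ^ 3)) * (1 / 8) := by ring
  rw [e6, e8] at key
  rw [e7] at hfin
  clear_value w
  linarith

/-! ### Part 3: bounded solutions do not create spikes -/

lemma SolvesL.neg {n : ℕ} {a : E n × ℝ → Fin n → Fin n → ℝ} {u : E n × ℝ → ℝ}
    {V : Set (E n × ℝ)} (h : SolvesL a u V) : SolvesL a (fun X => - u X) V := by
  refine ⟨fun X hX => ⟨(h.1 X hX).1.neg, (h.1 X hX).2.neg⟩, fun X hX => ?_⟩
  have h2 := h.2 X hX
  have e1 : ∀ i j, D2 (fun X => - u X) X i j = - D2 u X i j := by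
    intro i j
    unfold D2
    have : (fun x => fderiv ℝ (fun x' => - u (x', X.2)) x (EuclideanSpace.single j 1))
      = fun x => - (fderiv ℝ (fun x' => u (x', X.2)) x (EuclideanSpace.single j 1)) := by
      funext x
      rw [fderiv_fun_neg]; rfl
    rw [this, fderiv_fun_neg]; rfl
  have e2 : Dt (fun X => - u X) X = - Dt u X := by
    unfold Dt
    exact deriv.fun_neg
  unfold LVal at h2 ⊢
  simp only [e1, e2, mul_neg, Finset.sum_neg_distrib]
  linarith

/-- The half open tube. -/
def tubeD {n : ℕ} (p v : E n) (t0 t1 r : ℝ) : Set (E n × ℝ) :=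
  {X | t0 < X.2 ∧ X.2 ≤ t1 ∧ ‖tz p v t0 X‖ < r}

/-- The closed tube. -/
def tubeK {n : ℕ} (p v : E n) (t0 t1 r : ℝ) : Set (E n × ℝ) :=
  {X | t0 ≤ X.2 ∧ X.2 ≤ t1 ∧ ‖tz p v t0 X‖ ≤ r}

lemma tubeD_sub {n : ℕ} (p v : E n) (t0 t1 r : ℝ) : tubeD p v t0 t1 r ⊆ tubeK p v t0 t1 r :=
  fun _ hX => ⟨hX.1.le, hX.2.1, hX.2.2.le⟩

lemma tubeK_compact {n : ℕ} (p v : E n) (t0 t1 r : ℝ) : IsCompact (tubeK p v t0 t1 r) := by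
  have hc := tz_cont p v t0
  have hcl : IsClosed (tubeK p v t0 t1 r) := by
    refine IsClosed.inter (isClosed_le continuous_const continuous_snd)
      (IsClosed.inter (isClosed_le continuous_snd continuous_const)
      (isClosed_le hc.norm continuous_const))
  refine ((isCompact_closedBall p (r + (t1 - t0) * ‖v‖)).prod
    (isCompact_Icc (a := t0) (b := t1))).of_isClosed_subset hcl ?_
  rintro X ⟨h1, h2, h3⟩
  refine ⟨?_, h1, h2⟩
  rw [mem_closedBall, dist_eq_norm]
  have : X.1 - p = tz p v t0 X + (X.2 - t0) • v := by unfold tz; abel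
  rw [this]
  refine (norm_add_le _ _).trans (add_le_add h3 ?_)
  rw [norm_smul, Real.norm_eq_abs, abs_of_nonneg (by linarith)]
  exact mul_le_mul_of_nonneg_right (by linarith) (norm_nonneg _)

lemma tubeD_space {n : ℕ} {p v : E n} {t0 t1 r : ℝ} {X : E n × ℝ} (hX : X ∈ tubeD p v t0 t1 r) :
    ∀ᶠ x in 𝓝 X.1, (x, X.2) ∈ tubeD p v t0 t1 r := by
  have hc : Continuous fun x => ‖tz p v t0 (x, X.2)‖ := by unfold tz; fun_prop
  have := hc.continuousAt.tendsto.eventually (gt_mem_nhds (show ‖tz p v t0 (X.1, X.2)‖ < r from hX.2.2))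
  filter_upwards [this] with x hx using ⟨hX.1, hX.2.1, hx⟩

lemma tubeD_time {n : ℕ} {p v : E n} {t0 t1 r : ℝ} {X : E n × ℝ} (hX : X ∈ tubeD p v t0 t1 r) :
    ∀ᶠ t in 𝓝[<] X.2, (X.1, t) ∈ tubeD p v t0 t1 r := by
  have hc : Continuous fun t => ‖tz p v t0 (X.1, t)‖ := by unfold tz; fun_prop
  have := hc.continuousAt.tendsto.eventually (gt_mem_nhds (show ‖tz p v t0 (X.1, X.2)‖ < r from hX.2.2))
  have h2 : ∀ᶠ t in 𝓝 X.2, t0 < t := lt_mem_nhds hX.1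
  filter_upwards [mem_nhdsWithin_of_mem_nhds this, mem_nhdsWithin_of_mem_nhds h2,
    self_mem_nhdsWithin] with t h3 h4 h5
  exact ⟨h4, (le_of_lt h5).trans hX.2.1, h3⟩

lemma tubeD_sub_tubeD {n : ℕ} {p v : E n} {t0 t1 r : ℝ} :
    ∀ X ∈ tubeK p v t0 t1 r, X ∉ tubeD p v t0 t1 r → X.2 = t0 ∨ ‖tz p v t0 X‖ = r := by
  rintro X ⟨h1, h2, h3⟩ hX
  by_contra hcon
  push Not at hcon
  exact hX ⟨lt_of_le_of_ne h1 (Ne.symm hcon.1), h2, lt_of_le_of_ne h3 hcon.2⟩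

/-- A straight tube contains only points near the endpoint segment. -/
lemma tubeK_near {n : ℕ} {p x : E n} {t0 t1 r : ℝ} (ht : t0 < t1) {X : E n × ℝ}
    (hX : X ∈ tubeK p ((t1 - t0)⁻¹ • (x - p)) t0 t1 r) :
    ∃ z ∈ segment ℝ p x, ‖X.1 - z‖ ≤ r := by
  obtain ⟨h1, h2, h3⟩ := hX
  have hp : 0 < t1 - t0 := by linarith
  refine ⟨p + ((X.2 - t0) / (t1 - t0)) • (x - p), ?_, ?_⟩
  · rw [segment_eq_image']
    exact ⟨(X.2 - t0) / (t1 - t0), ⟨div_nonneg (by linarith) hp.le,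
      (div_le_one hp).mpr (by linarith)⟩, rfl⟩
  · convert h3 using 2
    unfold tz
    rw [smul_smul, div_eq_mul_inv]; abel

lemma S_case1 {n : ℕ} {ν : ℝ} (hν : 0 < ν)
    {a : E n × ℝ → Fin n → Fin n → ℝ} {u : E n × ℝ → ℝ} {x0 : E n} {ρ α β A K δ c0 : ℝ}
    (hu : SolvesL a u (ball x0 ρ ×ˢ Ioc α β)) (ha : Ell ν a (ball x0 ρ ×ˢ Ioc α β))
    (huc : ContinuousOn u (ball x0 ρ ×ˢ Ioc α β)) (hA : 0 < A) (hδ : 0 < δ)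
    (hK : 2 * n / ν < K)
    (hlow : ∀ X ∈ ball x0 ρ ×ˢ Ioc α β, c0 - A * bq x0 α K X - δ ≤ u X)
    {x : E n} {t R1 : ℝ} (hR1 : 0 < R1) (ht : t ∈ Ioc α β) (hxb : ‖x - x0‖ + R1 < ρ)
    (hbd : ∀ y ∈ closedBall x R1, ∀ ε > 0,
      ∀ᶠ X in 𝓝[ball x0 ρ ×ˢ Ioc α β] (y, α), c0 - ε < u X) :
    c0 - A * bq x0 α K (x, t) - δ / R1 ^ 2 * (K * (t - α)) ≤ u (x, t) := by
  set D := ball x R1 ×ˢ Ioc α t with hD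
  have hK0 : 0 < K := lt_of_le_of_lt (by positivity) hK
  have hsub : D ⊆ ball x0 ρ ×ˢ Ioc α β := by
    rintro X ⟨h1, h2⟩
    refine ⟨?_, h2.1, h2.2.trans ht.2⟩
    rw [mem_ball, dist_eq_norm] at h1 ⊢
    have : X.1 - x0 = (X.1 - x) + (x - x0) := by abel
    rw [this]
    exact lt_of_le_of_lt (norm_add_le _ _) (by linarith)
  set G : E n × ℝ → ℝ := fun X => (c0 - A * bq x0 α K X) + (0 - δ / R1 ^ 2 * bq x α K X) with hG
  have hGc : Continuous G := by
    have := bq_cont x0 α K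
    have := bq_cont x α K
    rw [hG]; fun_prop
  have := comparison (G := G) hν (hu.mono hsub) (ha.mono hsub) (D := D)
    ((isCompact_closedBall x R1).prod (isCompact_Icc (a := α) (b := t)))
    (prod_mono ball_subset_closedBall Ioc_subset_Icc_self) (huc.mono hsub) hGc.continuousOn
    (fun X hX => (strictSub_sub_bq (ha.mono hsub) hX x0 α K c0 A hA hK).add
      (strictSub_sub_bq (ha.mono hsub) hX x α K 0 _ (by positivity) hK))
    (fun X hX => ?_) (fun X hX => ?_) (fun Z hZ hZD ε hε => ?_)
    (x, t) ⟨mem_ball_self hR1, ht.1, le_rfl⟩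
  · simp only [hG] at this
    have e : bq x α K (x, t) = K * (t - α) := by simp [bq]
    rw [e] at this
    linarith
  · filter_upwards [isOpen_ball.mem_nhds hX.1] with y hy using ⟨hy, hX.2⟩
  · filter_upwards [mem_nhdsWithin_of_mem_nhds (lt_mem_nhds hX.2.1), self_mem_nhdsWithin]
      with s h1 h2 using ⟨hX.1, h1, (le_of_lt h2).trans hX.2.2⟩
  · by_cases hZα : Z.2 = α
    · have h1 := hbd Z.1 hZ.1 ε hε
      rw [show (Z.1, α) = Z by rw [← hZα]] at h1
      filter_upwards [nhdsWithin_mono _ hsub h1, self_mem_nhdsWithin] with X h2 h3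
      have b1 : ∀ y : E n, 0 ≤ bq y α K X := by
        intro y; unfold bq
        have := h3.2.1
        have : 0 < X.2 - α := by linarith
        positivity
      have q1 : 0 ≤ A * bq x0 α K X := mul_nonneg hA.le (b1 _)
      have q2 : 0 ≤ δ / R1 ^ 2 * bq x α K X := mul_nonneg (by positivity) (b1 _)
      simp only [hG]; linarith
    · have hZn : ‖Z.1 - x‖ = R1 := by
        have h1 : ‖Z.1 - x‖ ≤ R1 := by simpa [dist_eq_norm] using hZ.1
        refine le_antisymm h1 (not_lt.mp fun h2 => hZD ⟨?_, ?_, hZ.2.2⟩)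
        · simpa [dist_eq_norm] using h2
        · exact lt_of_le_of_ne hZ.2.1 (Ne.symm hZα)
      have hc : Continuous fun X : E n × ℝ => δ / R1 ^ 2 * ‖X.1 - x‖ ^ 2 := by fun_prop
      have h1 := hc.continuousAt (x := Z) |>.tendsto.eventually
        (lt_mem_nhds (show δ - ε < δ / R1 ^ 2 * ‖Z.1 - x‖ ^ 2 by
          rw [hZn, div_mul_cancel₀ _ (by positivity)]; linarith))
      filter_upwards [mem_nhdsWithin_of_mem_nhds h1, self_mem_nhdsWithin] with X h2 h3
      have h4 := hlow X (hsub h3)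
      have : 0 ≤ δ / R1 ^ 2 * (K * (X.2 - α)) := by
        have := h3.2.1
        have : 0 < X.2 - α := by linarith
        positivity
      simp only [hG]
      have e : bq x α K X = ‖X.1 - x‖ ^ 2 + K * (X.2 - α) := rfl
      rw [e, mul_add]
      linarith

lemma S_case2 {n : ℕ} {ν : ℝ} (hν : 0 < ν)
    {a : E n × ℝ → Fin n → Fin n → ℝ} {u : E n × ℝ → ℝ} {x0 : E n} {ρ α β A K δ c0 : ℝ}
    (hu : SolvesL a u (ball x0 ρ ×ˢ Ioc α β)) (ha : Ell ν a (ball x0 ρ ×ˢ Ioc α β))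
    (huc : ContinuousOn u (ball x0 ρ ×ˢ Ioc α β)) (hA : 0 < A) (hδ : 0 < δ)
    (hK : 2 * n / ν < K)
    (hlow : ∀ X ∈ ball x0 ρ ×ˢ Ioc α β, c0 - A * bq x0 α K X - δ ≤ u X)
    {x p : E n} {t t' r1 R1 V : ℝ} (hr1 : 0 < r1) (ht' : α < t') (htt : t' < t) (htβ : t ≤ β)
    (hxb : ‖x - x0‖ + R1 + r1 < ρ) (hp : ‖p - x‖ ≤ R1) (hV : ‖(t - t')⁻¹ • (x - p)‖ ≤ V)
    (hst : ∀ y ∈ closedBall p r1, c0 - δ / 2 ≤ u (y, t')) :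
    c0 - A * bq x0 α K (x, t) - δ + δ / 2 * Real.exp (- kap n ν r1 V * (t - t')) ≤ u (x, t) := by
  set v := (t - t')⁻¹ • (x - p) with hv
  set κ := kap n ν r1 V with hκ
  have hK0 : 0 < K := lt_of_le_of_lt (by positivity) hK
  have hκ0 : 0 < κ := kap_pos hν
  have hsub : tubeK p v t' t r1 ⊆ ball x0 ρ ×ˢ Ioc α β := by
    intro X hX
    obtain ⟨z, hz, hzn⟩ := tubeK_near htt hX
    refine ⟨?_, lt_of_lt_of_le ht' hX.1, hX.2.1.trans htβ⟩
    rw [mem_ball, dist_eq_norm]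
    have hzx : ‖z - x‖ ≤ R1 := by
      have h1 : z ∈ closedBall x R1 := by
        refine (convex_closedBall x R1).segment_subset ?_ ?_ hz
        · simpa [dist_eq_norm] using hp
        · exact mem_closedBall_self ((norm_nonneg _).trans hp)
      simpa [dist_eq_norm] using h1
    have : X.1 - x0 = (X.1 - z) + (z - x) + (x - x0) := by abel
    rw [this]
    have h1 := norm_add_le ((X.1 - z) + (z - x)) (x - x0)
    have h2 := norm_add_le (X.1 - z) (z - x)
    linarith
  have hsubD := (tubeD_sub p v t' t r1).trans hsub
  set G : E n × ℝ → ℝ := fun X => ((c0 - δ) - A * bq x0 α K X)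
    + δ / (2 * r1 ^ 4) * tubeG p v t' r1 κ X with hG
  have hGc : Continuous G := by
    have := bq_cont x0 α K
    have := tubeG_cont p v t' r1 κ
    rw [hG]; fun_prop
  have hmem : (x, t) ∈ tubeD p v t' t r1 := by
    refine ⟨htt, le_rfl, ?_⟩
    have : tz p v t' (x, t) = 0 := by
      simp only [tz, hv, smul_smul]
      rw [mul_inv_cancel₀ (by linarith), one_smul]; abel
    rw [this, norm_zero]; exact hr1
  have := comparison (G := G) hν (hu.mono hsubD) (ha.mono hsubD) (tubeK_compact p v t' t r1)
    (tubeD_sub p v t' t r1) (huc.mono hsubD) hGc.continuousOn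
    (fun X hX => (strictSub_sub_bq (ha.mono hsubD) hX x0 α K (c0 - δ) A hA hK).add
      ((tubeG_strictSub hν hr1 (ha.mono hsubD) hX p v t' hV hX.2.2).const_mul (by positivity)))
    (fun X hX => tubeD_space hX) (fun X hX => tubeD_time hX) (fun Z hZ hZD ε hε => ?_)
    (x, t) hmem
  · simp only [hG] at this
    have e : tubeG p v t' r1 κ (x, t) = Real.exp (- κ * (t - t')) * r1 ^ 4 := by
      have : tz p v t' (x, t) = 0 := by
        simp only [tz, hv, smul_smul]
        rw [mul_inv_cancel₀ (by linarith), one_smul]; abel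
      simp only [tubeG, this, norm_zero]; ring
    rw [e] at this
    have e2 : δ / (2 * r1 ^ 4) * (Real.exp (- κ * (t - t')) * r1 ^ 4)
      = δ / 2 * Real.exp (- κ * (t - t')) := by field_simp
    rw [e2] at this
    linarith
  · have hZin := hsub hZ
    have hle : G Z ≤ u Z := by
      rcases tubeD_sub_tubeD Z hZ hZD with h | h
      · have h1 := hst Z.1 (by
          rw [mem_closedBall, dist_eq_norm]
          have := hZ.2.2
          simpa [tz, h] using this)
        rw [show (Z.1, t') = Z by rw [← h]] at h1
        have h2 := tubeG_le p v hκ0.le (X := Z) hZ.1 hZ.2.2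
        have h3 : δ / (2 * r1 ^ 4) * tubeG p v t' r1 κ Z ≤ δ / (2 * r1 ^ 4) * r1 ^ 4 :=
          mul_le_mul_of_nonneg_left h2 (by positivity)
        have h4 : δ / (2 * r1 ^ 4) * r1 ^ 4 = δ / 2 := by field_simp
        have h5 : 0 ≤ A * bq x0 α K Z := by
          have := hZin.2.1
          have : 0 < Z.2 - α := by linarith
          unfold bq; positivity
        simp only [hG]; linarith
      · have h1 := hlow Z hZin
        have h2 : tubeG p v t' r1 κ Z = 0 := by simp [tubeG, h]
        simp only [hG, h2]; linarith
    have hc := ((huc Z hZin).mono hsubD).sub (hGc.continuousAt (x := Z)).continuousWithinAt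
    have := hc.tendsto.eventually (lt_mem_nhds (show -ε < u Z - G Z by linarith))
    filter_upwards [this] with X hX
    have hX' : -ε < u X - G X := hX
    linarith

lemma spike_alg1 {M C δ g r b : ℝ} (hM : 0 < M) (hC : 0 < C) (hr : 0 < r)
    (hg : g = δ / (4 * M * (C + 1))) (hg0 : 0 < g) (hg1 : g ≤ 1) (hb0 : 0 ≤ b)
    (hb : b ≤ g ^ 2 * r) : 2 * M / √r * C * √b + 2 * M / r ^ 2 * b ^ 2 ≤ δ / 2 := by
  have hsr : 0 < √r := Real.sqrt_pos.mpr hr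
  have h3 : √b ≤ g * √r := by
    calc √b ≤ √(g ^ 2 * r) := Real.sqrt_le_sqrt hb
      _ = g * √r := by rw [Real.sqrt_mul (by positivity), Real.sqrt_sq hg0.le]
  have h2 : 2 * M / √r * C * √b ≤ 2 * M * C * g := by
    calc 2 * M / √r * C * √b ≤ 2 * M / √r * C * (g * √r) :=
          mul_le_mul_of_nonneg_left h3 (by positivity)
      _ = 2 * M * C * g := by field_simp
  have h5 : 2 * M / r ^ 2 * b ^ 2 ≤ 2 * M * g := by
    have h6 : b ^ 2 ≤ (g ^ 2 * r) ^ 2 := pow_le_pow_left₀ hb0 hb 2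
    calc 2 * M / r ^ 2 * b ^ 2 ≤ 2 * M / r ^ 2 * (g ^ 2 * r) ^ 2 :=
          mul_le_mul_of_nonneg_left h6 (by positivity)
      _ = 2 * M * g ^ 4 := by field_simp
      _ ≤ 2 * M * g := by
        refine mul_le_mul_of_nonneg_left ?_ (by positivity)
        exact pow_le_of_le_one hg0.le hg1 (by norm_num)
  have h7 : 2 * M * C * g + 2 * M * g = δ / 2 := by rw [hg]; field_simp; ring
  linarith

lemma spike_alg2 {n : ℕ} {ν s k q : ℝ} (hν : 0 < ν) (hs : 0 < s) (hq : 0 < q) (hq1 : q ≤ 1) :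
    kap n ν (s * (q / 2)) (2 * k / q) * (q ^ 2 / 2)
      ≤ (4 * n / ν + 4 * (s * k) + 8 * ν) ^ 2 / (16 * ν * s ^ 2) + 1 := by
  have e : kap n ν (s * (q / 2)) (2 * k / q) * (q ^ 2 / 2)
      = (4 * n / ν + 4 * (s * k) + 8 * ν) ^ 2 / (16 * ν * s ^ 2) + q ^ 2 / 2 := by
    unfold kap
    rw [show 4 * (s * (q / 2)) * (2 * k / q) = 4 * (s * k) by field_simp]
    generalize 4 * n / ν + 4 * (s * k) + 8 * ν = Z
    field_simp
    try ring
  rw [e]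
  nlinarith

set_option maxHeartbeats 1000000 in
lemma no_spike {n : ℕ} (hn : 0 < n) {ν : ℝ} (hν : 0 < ν) (hν1 : ν ≤ 1)
    {a : E n × ℝ → Fin n → Fin n → ℝ} {u : E n × ℝ → ℝ} {x0 : E n} {ρ α β M θ c0 : ℝ}
    (hρ : 0 < ρ) (hM : 0 < M)
    (hu : SolvesL a u (ball x0 ρ ×ˢ Ioc α β)) (ha : Ell ν a (ball x0 ρ ×ˢ Ioc α β))
    (huc : ContinuousOn u (ball x0 ρ ×ˢ Ioc α β))
    (hub : ∀ X ∈ ball x0 ρ ×ˢ Ioc α β, |u X| ≤ M) (hc0 : c0 ≤ M)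
    (hosc : ∀ X ∈ ball x0 ρ ×ˢ Ioc α β,
      ∀ Y ∈ ball x0 ρ ×ˢ Ioc α β, ∀ i j, |a X i j - a Y i j| ≤ θ)
    (hθ : 12 * n * (n * θ) ≤ ν) (P : Set (E n))
    (hP : ∀ p ∈ P, p ∈ ball x0 ρ → ∀ t ∈ Ioc α β, c0 ≤ u (p, t))
    (hbd : ∀ y ∈ ball x0 ρ, y ∉ P → ∀ ε > 0,
      ∀ᶠ X in 𝓝[ball x0 ρ ×ˢ Ioc α β] (y, α), c0 - ε < u X) :
    ∀ X ∈ ball x0 ρ ×ˢ Ioc α β, c0 - 3 * M / ρ ^ 2 * bq x0 α (2 * n / ν + 1) X ≤ u X := by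
  set D := ball x0 ρ ×ˢ Ioc α β with hD
  set A := 3 * M / ρ ^ 2 with hA
  have hA0 : 0 < A := by positivity
  set K : ℝ := 2 * n / ν + 1 with hK
  have hK0 : 0 < K := by positivity
  have hKn : 2 * n / ν < K := by rw [hK]; linarith
  have hbq0 : ∀ X ∈ D, 0 ≤ A * bq x0 α K X := by
    intro X hX
    have := hX.2.1
    have : 0 < X.2 - α := by linarith
    unfold bq; positivity
  by_contra hcon
  push Not at hcon
  obtain ⟨Xs, hXs, hXsn⟩ := hcon
  set V : E n × ℝ → ℝ := fun X => u X - c0 + A * bq x0 α K X with hV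
  have hbb : BddBelow (V '' D) := by
    refine ⟨-2 * M, ?_⟩
    rintro _ ⟨X, hX, rfl⟩
    have := (abs_le.mp (hub X hX)).1
    have := hbq0 X hX
    simp only [hV]; linarith
  obtain ⟨δ, hδdef⟩ : ∃ δ, δ = - sInf (V '' D) := ⟨_, rfl⟩
  have hδ : 0 < δ := by
    have := csInf_le hbb ⟨Xs, hXs, rfl⟩
    have h2 : V Xs < 0 := by simp only [hV]; linarith
    linarith
  have hδM : δ ≤ 2 * M := by
    have : -2 * M ≤ sInf (V '' D) := by
      refine le_csInf ⟨_, ⟨Xs, hXs, rfl⟩⟩ ?_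
      rintro _ ⟨X, hX, rfl⟩
      have := (abs_le.mp (hub X hX)).1
      have := hbq0 X hX
      simp only [hV]; linarith
    linarith
  have hlow : ∀ X ∈ D, c0 - A * bq x0 α K X - δ ≤ u X := by
    intro X hX
    have := csInf_le hbb ⟨X, hX, rfl⟩
    simp only [hV] at this
    linarith
  have hAρ : A * ρ ^ 2 = 3 * M := by rw [hA]; field_simp
  -- far from the centre V is nonnegative
  have hfar : ∀ X ∈ D, 2 / 3 * ρ ^ 2 ≤ ‖X.1 - x0‖ ^ 2 → 0 ≤ V X := by
    intro X hX h
    have h1 := (abs_le.mp (hub X hX)).1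
    have h2 : A * (2 / 3 * ρ ^ 2) ≤ A * bq x0 α K X := by
      refine mul_le_mul_of_nonneg_left ?_ hA0.le
      have := hX.2.1
      have : 0 < K * (X.2 - α) := mul_pos hK0 (by linarith)
      unfold bq; linarith
    simp only [hV]; nlinarith
  -- Claim 1
  have claim1 : ∀ σ0 > 0, ∀ η > 0, η ≤ δ → ∃ X ∈ D, X.2 < α + σ0 ∧ V X < - δ + η := by
    intro σ0 hσ0 η hη hηδ
    by_contra hcon
    push Not at hcon
    set G : E n × ℝ → ℝ := fun X => (c0 - δ + η) - A * bq x0 α K X with hG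
    have hGc : Continuous G := by
      have := bq_cont x0 α K
      rw [hG]; fun_prop
    have hall := comparison (G := G) hν hu ha (D := D)
      ((isCompact_closedBall x0 ρ).prod (isCompact_Icc (a := α) (b := β)))
      (prod_mono ball_subset_closedBall Ioc_subset_Icc_self) huc hGc.continuousOn
      (fun X hX => strictSub_sub_bq ha hX x0 α K _ A hA0 hKn)
      (fun X hX => by filter_upwards [isOpen_ball.mem_nhds hX.1] with y hy using ⟨hy, hX.2⟩)
      (fun X hX => by
        filter_upwards [mem_nhdsWithin_of_mem_nhds (lt_mem_nhds hX.2.1), self_mem_nhdsWithin]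
          with s h1 h2 using ⟨hX.1, h1, (le_of_lt h2).trans hX.2.2⟩)
      (fun Z hZ hZD ε hε => by
        by_cases hZα : Z.2 = α
        · have hc : ContinuousAt (fun X : E n × ℝ => X.2) Z := continuousAt_snd
          have := hc.tendsto.eventually (gt_mem_nhds (show Z.2 < α + σ0 by linarith))
          filter_upwards [mem_nhdsWithin_of_mem_nhds this, self_mem_nhdsWithin] with X h1 h2
          have := hcon X h2 h1
          simp only [hV] at this
          simp only [hG]; linarith
        · have hZn : ‖Z.1 - x0‖ = ρ := by
            have h1 : ‖Z.1 - x0‖ ≤ ρ := by simpa [dist_eq_norm] using hZ.1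
            refine le_antisymm h1 (not_lt.mp fun h2 => hZD ⟨?_, ?_, hZ.2.2⟩)
            · simpa [dist_eq_norm] using h2
            · exact lt_of_le_of_ne hZ.2.1 (Ne.symm hZα)
          have hc : Continuous fun X : E n × ℝ => ‖X.1 - x0‖ ^ 2 := by fun_prop
          have h1 := hc.continuousAt (x := Z) |>.tendsto.eventually
            (lt_mem_nhds (show 2 / 3 * ρ ^ 2 < ‖Z.1 - x0‖ ^ 2 by
              rw [hZn]; nlinarith))
          filter_upwards [mem_nhdsWithin_of_mem_nhds h1, self_mem_nhdsWithin] with X h2 h3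
          have := hfar X h3 h2.le
          simp only [hV] at this
          simp only [hG]; linarith)
    have : -δ + η ≤ sInf (V '' D) := by
      refine le_csInf ⟨_, ⟨Xs, hXs, rfl⟩⟩ ?_
      rintro _ ⟨X, hX, rfl⟩
      have := hall X hX
      simp only [hG] at this
      simp only [hV]; linarith
    linarith
  -- constants
  obtain ⟨C, hC⟩ : ∃ z : ℝ, z = 25 * (3 + 4 * n / ν) / ν := ⟨_, rfl⟩
  have hC0 : 0 < C := by rw [hC]; positivity
  obtain ⟨g, hg⟩ : ∃ z : ℝ, z = δ / (4 * M * (C + 1)) := ⟨_, rfl⟩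
  have hg0 : 0 < g := by rw [hg]; positivity
  have hg1 : g ≤ 1 := by
    rw [hg, div_le_one (by positivity)]; nlinarith
  obtain ⟨s, hs⟩ : ∃ z : ℝ, z = g ^ 2 := ⟨_, rfl⟩
  have hs0 : 0 < s := by rw [hs]; positivity
  have hs1 : s ≤ 1 := by rw [hs]; nlinarith
  obtain ⟨k, hk⟩ : ∃ z : ℝ, z = √(2 * K) := ⟨_, rfl⟩
  have hk0 : 0 < k := by rw [hk]; exact Real.sqrt_pos.mpr (by positivity)
  have hk2 : k ^ 2 = 2 * K := by rw [hk]; exact Real.sq_sqrt (by positivity)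
  obtain ⟨κ0, hκ0⟩ : ∃ z : ℝ, z = (4 * n / ν + 4 * (s * k) + 8 * ν) ^ 2 / (16 * ν * s ^ 2) + 1 := ⟨_, rfl⟩
  obtain ⟨q1, hq1⟩ : ∃ z : ℝ, z = min 1 (ρ / (12 * (k + 1))) := ⟨_, rfl⟩
  have hq10 : 0 < q1 := by rw [hq1]; positivity
  obtain ⟨η, hη⟩ : ∃ z : ℝ, z = δ / 2 * Real.exp (-κ0) := ⟨_, rfl⟩
  have hη0 : 0 < η := by rw [hη]; positivity
  have hηδ : η ≤ δ / 2 := by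
    have : Real.exp (-κ0) ≤ 1 := by
      rw [Real.exp_le_one_iff]
      have : 0 ≤ κ0 := by rw [hκ0]; positivity
      linarith
    rw [hη]; nlinarith
  obtain ⟨⟨x, t⟩, hXD, hXt, hXV⟩ := claim1 (q1 ^ 2) (by positivity) η hη0 (by linarith)
  have htα : α < t := hXD.2.1
  obtain ⟨q, hq⟩ : ∃ q, q = √(t - α) := ⟨_, rfl⟩
  have hq0 : 0 < q := by rw [hq]; exact Real.sqrt_pos.mpr (by linarith)
  have hq2 : t - α = q ^ 2 := by rw [hq, Real.sq_sqrt (by linarith)]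
  have hqq : q < q1 := by
    have : q ^ 2 < q1 ^ 2 := by
      have : t < α + q1 ^ 2 := hXt
      linarith
    exact lt_of_pow_lt_pow_left₀ 2 hq10.le this
  have hq_1 : q ≤ 1 := hqq.le.trans (by rw [hq1]; exact min_le_left _ _)
  have hqρ : 12 * (k * q + q) < ρ := by
    have : q < ρ / (12 * (k + 1)) := lt_of_lt_of_le hqq (by rw [hq1]; exact min_le_right _ _)
    rw [lt_div_iff₀ (by positivity)] at this
    linarith
  have hxn : ‖x - x0‖ < 5 / 6 * ρ := by
    by_contra hcon
    push Not at hcon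
    have := hfar (x, t) hXD (by
      show 2 / 3 * ρ ^ 2 ≤ ‖x - x0‖ ^ 2
      nlinarith)
    linarith
  have hR1 : 0 < k * q := by positivity
  have hVx : u (x, t) - c0 + A * bq x0 α K (x, t) < -δ + η := hXV
  by_cases hcase : ∃ p ∈ P, p ∈ closedBall x (k * q)
  · obtain ⟨p, hpP, hpx⟩ := hcase
    have hpx' : ‖p - x‖ ≤ k * q := by simpa [dist_eq_norm] using hpx
    obtain ⟨r, hr⟩ : ∃ z : ℝ, z = q / 2 := ⟨_, rfl⟩
    have hr0 : 0 < r := by rw [hr]; positivity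
    obtain ⟨t', ht'⟩ : ∃ z : ℝ, z = α + q ^ 2 / 2 := ⟨_, rfl⟩
    have hr2 : r ^ 2 = q ^ 2 / 4 := by rw [hr]; ring
    have hq20 : 0 < q ^ 2 := by positivity
    have hsub : closedBall p r ×ˢ Icc (t' - r ^ 2) t' ⊆ D := by
      rintro X ⟨h1, h2⟩
      have h1' : ‖X.1 - p‖ ≤ r := by simpa [dist_eq_norm] using h1
      refine ⟨?_, by linarith [h2.1], ?_⟩
      · rw [mem_ball, dist_eq_norm]
        have : X.1 - x0 = (X.1 - p) + (p - x) + (x - x0) := by abel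
        rw [this]
        have h1 := norm_add_le ((X.1 - p) + (p - x)) (x - x0)
        have h2 := norm_add_le (X.1 - p) (p - x)
        linarith
      · have := h2.2
        have : t ≤ β := hXD.2.2
        linarith
    have hpb : p ∈ ball x0 ρ := by
      rw [mem_ball, dist_eq_norm]
      have : p - x0 = (p - x) + (x - x0) := by abel
      rw [this]
      have h1 := norm_add_le (p - x) (x - x0)
      linarith
    have hpt : c0 ≤ u (p, t') := by
      refine hP p hpP hpb t' ⟨by linarith, ?_⟩
      have : t ≤ β := hXD.2.2
      linarith
    have hH := holder hn hν hν1 hr0 hM (hu.neg.mono hsub) (ha.mono hsub) ((huc.mono hsub).neg)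
      (fun X hX => by show |-u X| ≤ M; rw [abs_neg]; exact hub X (hsub hX))
      (fun X hX Y hY => hosc X (hsub hX) Y (hsub hY)) hθ
    have hst : ∀ y ∈ closedBall p (s * r), c0 - δ / 2 ≤ u (y, t') := by
      intro y hy
      have hy' : ‖y - p‖ ≤ s * r := by simpa [dist_eq_norm] using hy
      have h1 := hH y (closedBall_subset_closedBall (mul_le_of_le_one_left hr0.le hs1) hy)
      have h2 := spike_alg1 hM hC0 hr0 hg hg0 hg1 (norm_nonneg (y - p)) (by rw [← hs]; exact hy')
      have h4 : hB n ν r M = 2 * M / √r * C := by rw [hC]; rfl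
      rw [h4] at h1
      linarith
    have htt : t - t' = q ^ 2 / 2 := by rw [ht']; linarith
    have hV' : ‖(t - t')⁻¹ • (x - p)‖ ≤ 2 * k / q := by
      rw [norm_smul, htt, norm_inv, Real.norm_eq_abs, abs_of_pos (by positivity), norm_sub_rev]
      calc (q ^ 2 / 2)⁻¹ * ‖p - x‖ ≤ (q ^ 2 / 2)⁻¹ * (k * q) :=
            mul_le_mul_of_nonneg_left hpx' (by positivity)
        _ = 2 * k / q := by field_simp
    have hfin := S_case2 hν hu ha huc hA0 hδ hKn hlow (x := x) (p := p) (t := t) (t' := t')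
      (r1 := s * r) (R1 := k * q) (V := 2 * k / q) (by positivity) (by linarith) (by linarith)
      hXD.2.2 (by nlinarith) hpx' hV' hst
    have hexp : kap n ν (s * r) (2 * k / q) * (t - t') ≤ κ0 := by
      rw [htt, hr, hκ0]
      exact spike_alg2 hν hs0 hq0 hq_1
    have hexp2 : Real.exp (-κ0) ≤ Real.exp (- kap n ν (s * r) (2 * k / q) * (t - t')) := by
      rw [Real.exp_le_exp]; linarith
    have : η ≤ δ / 2 * Real.exp (- kap n ν (s * r) (2 * k / q) * (t - t')) := by
      rw [hη]; exact mul_le_mul_of_nonneg_left hexp2 (by positivity)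
    linarith
  · push Not at hcase
    have hfin := S_case1 hν hu ha huc hA0 hδ hKn hlow (x := x) (t := t) hR1 hXD.2
      (by linarith) (fun y hy ε hε => by
        refine hbd y ?_ (fun hyP => hcase y hyP hy) ε hε
        have hy' : ‖y - x‖ ≤ k * q := by simpa [dist_eq_norm] using hy
        rw [mem_ball, dist_eq_norm]
        have : y - x0 = (y - x) + (x - x0) := by abel
        rw [this]
        have h1 := norm_add_le (y - x) (x - x0)
        linarith)
    have e : δ / (k * q) ^ 2 * (K * (t - α)) = δ / 2 := by
      rw [hq2, mul_pow, hk2]; field_simp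
    rw [e] at hfin
    linarith

lemma near_lower {n : ℕ} (hn : 0 < n) {ν : ℝ} (hν : 0 < ν) (hν1 : ν ≤ 1)
    {a : E n × ℝ → Fin n → Fin n → ℝ} {u : E n × ℝ → ℝ} {x0 : E n} {t0 ρ M θ c : ℝ}
    (hρ : 0 < ρ) (hM : 0 < M) {F box : Set (E n × ℝ)}
    (hbox : box = closedBall x0 ρ ×ˢ Icc (t0 - ρ) (t0 + ρ))
    (hu : SolvesL a u box) (ha : Ell ν a box)
    (hub : ∀ X ∈ box, |u X| ≤ M)
    (hosc : ∀ X ∈ box, ∀ Y ∈ box, ∀ i j, |a X i j - a Y i j| ≤ θ)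
    (hθ : 12 * n * (n * θ) ≤ ν)
    (hcont : ∀ X ∈ box, X ∉ F → ContinuousAt u X)
    (hFc : IsCompact (F ∩ box)) (h0 : (x0, t0) ∈ F)
    (hv : ∀ X ∈ F ∩ box, ∀ t ∈ Icc (t0 - ρ) (t0 + ρ), c ≤ u (X.1, t))
    (hh : ∀ X ∈ F ∩ box, ∀ x ∈ closedBall x0 ρ, c ≤ u (x, X.2)) :
    ∀ ε > 0, ∀ᶠ X in 𝓝 (x0, t0), c - ε < u X := by
  intro ε hε
  have h0b : (x0, t0) ∈ box := by
    rw [hbox]; exact ⟨mem_closedBall_self hρ.le, by constructor <;> simp <;> linarith⟩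
  have hcM : c ≤ M := by
    have := hh (x0, t0) ⟨h0, h0b⟩ x0 (mem_closedBall_self hρ.le)
    have := (abs_le.mp (hub _ h0b)).2
    linarith
  obtain ⟨T, hT⟩ : ∃ T : Set ℝ, T = Prod.snd '' (F ∩ box) := ⟨_, rfl⟩
  have hTc : IsCompact T := by rw [hT]; exact hFc.image continuous_snd
  have ht0T : t0 ∈ T := by rw [hT]; exact ⟨(x0, t0), ⟨h0, h0b⟩, rfl⟩
  obtain ⟨A, hA⟩ : ∃ A : ℝ, A = 3 * M / ρ ^ 2 := ⟨_, rfl⟩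
  have hA0 : 0 < A := by rw [hA]; positivity
  obtain ⟨K, hK⟩ : ∃ K : ℝ, K = 2 * n / ν + 1 := ⟨_, rfl⟩
  have hK0 : 0 < K := by rw [hK]; positivity
  have hfree : ∀ X ∈ box, X.2 ∉ T → ContinuousAt u X := by
    intro X hX hXT
    refine hcont X hX fun hXF => hXT ?_
    rw [hT]; exact ⟨X, ⟨hXF, hX⟩, rfl⟩
  -- lower bound above a point of T
  have W : ∀ τ ∈ T, ∀ x1 ∈ ball x0 ρ, ∀ t1, τ ≤ t1 → t1 ≤ t0 + ρ →
      c - A * (‖x1 - x0‖ ^ 2 + K * (t1 - τ)) ≤ u (x1, t1) := by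
    intro τ hτ x1 hx1 t1 hτ1 ht1
    obtain ⟨α, ⟨⟨hατ, hαt⟩, hαT⟩, hαmax⟩ := ((isCompact_Icc (a := τ) (b := t1)).inter hTc).exists_isGreatest
      ⟨τ, ⟨le_rfl, hτ1⟩, hτ⟩
    have hα := hαT
    rw [hT] at hα
    obtain ⟨Z, hZ, hZα⟩ := hα
    have hZb : Z.2 ∈ Icc (t0 - ρ) (t0 + ρ) := by
      have := hZ.2; rw [hbox] at this; exact this.2
    rw [hZα] at hZb
    have hslice : ∀ x ∈ closedBall x0 ρ, c ≤ u (x, α) := by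
      intro x hx; rw [← hZα]; exact hh Z hZ x hx
    have hxn : 0 ≤ A * (‖x1 - x0‖ ^ 2) := by positivity
    rcases eq_or_lt_of_le hαt with hα1 | hα1
    · have := hslice x1 (ball_subset_closedBall hx1)
      rw [hα1] at this
      have h2 : 0 ≤ A * (K * (t1 - τ)) := by
        have : 0 ≤ t1 - τ := by linarith
        positivity
      nlinarith
    · have hsub : ball x0 ρ ×ˢ Ioc α t1 ⊆ box := by
        rw [hbox]
        rintro X ⟨h1, h2⟩
        exact ⟨ball_subset_closedBall h1, by linarith [h2.1, hZb.1], by linarith [h2.2]⟩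
      have hnT : ∀ t ∈ Ioc α t1, t ∉ T := by
        intro t ht htT
        have := hαmax ⟨⟨by linarith [ht.1], ht.2⟩, htT⟩
        linarith [ht.1]
      have := no_spike hn hν hν1 hρ hM (hu.mono hsub) (ha.mono hsub)
        (fun X hX => (hfree X (hsub hX) (hnT _ hX.2)).continuousWithinAt)
        (fun X hX => hub X (hsub hX)) hcM
        (fun X hX Y hY => hosc X (hsub hX) Y (hsub hY)) hθ {p | (p, α) ∈ F}
        (fun p hp hpb t ht => by
          have hpb' : (p, α) ∈ box := by
            rw [hbox]; exact ⟨ball_subset_closedBall hpb, hZb⟩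
          exact hv (p, α) ⟨hp, hpb'⟩ t ⟨by linarith [ht.1, hZb.1], by linarith [ht.2]⟩)
        (fun y hy hyP ε hε => by
          have hyb : (y, α) ∈ box := by
            rw [hbox]; exact ⟨ball_subset_closedBall hy, hZb⟩
          have h1 := hcont (y, α) hyb hyP
          have h2 := hslice y (ball_subset_closedBall hy)
          exact mem_nhdsWithin_of_mem_nhds
            (h1.eventually (lt_mem_nhds (show c - ε < u (y, α) by linarith))))
        (x1, t1) ⟨hx1, hα1, le_rfl⟩
      rw [← hA, ← hK] at this
      unfold bq at this
      have h3 : A * (K * (t1 - α)) ≤ A * (K * (t1 - τ)) := by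
        have : t1 - α ≤ t1 - τ := by linarith
        gcongr
      simp only at this
      nlinarith
  have hnear : ∀ σ > 0, ∀ᶠ X : E n × ℝ in 𝓝 (x0, t0),
      X.1 ∈ ball x0 ρ ∧ X.2 ∈ Ioo (t0 - σ) (t0 + σ) := by
    intro σ hσ
    have : ball x0 ρ ×ˢ Ioo (t0 - σ) (t0 + σ) ∈ 𝓝 (x0, t0) :=
      prod_mem_nhds (ball_mem_nhds _ hρ) (Ioo_mem_nhds (by linarith) (by linarith))
    filter_upwards [this] with X hX using hX
  have hquad : ∀ σ : ℝ, A * (K * σ) < ε → ∀ᶠ X : E n × ℝ in 𝓝 (x0, t0),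
      A * (‖X.1 - x0‖ ^ 2 + K * σ) < ε := by
    intro σ hσ
    have hc : Continuous fun X : E n × ℝ => A * (‖X.1 - x0‖ ^ 2 + K * σ) := by fun_prop
    exact hc.continuousAt.eventually (gt_mem_nhds (by simpa using hσ))
  obtain ⟨σ, hσ⟩ : ∃ σ : ℝ, σ = min ρ (ε / (2 * A * K)) := ⟨_, rfl⟩
  have hσ0 : 0 < σ := by rw [hσ]; positivity
  have hσρ : σ ≤ ρ := by rw [hσ]; exact min_le_left _ _
  have hσε : A * (K * σ) < ε := by
    have : σ ≤ ε / (2 * A * K) := by rw [hσ]; exact min_le_right _ _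
    rw [le_div_iff₀ (by positivity)] at this
    nlinarith
  -- times ≥ t0
  have up : ∀ᶠ X : E n × ℝ in 𝓝 (x0, t0), t0 ≤ X.2 → c - ε < u X := by
    filter_upwards [hnear σ hσ0, hquad σ hσε] with X h1 h2 h3
    have h4 := W t0 ht0T X.1 h1.1 X.2 h3 (by linarith [h1.2.2])
    have h5 : A * (‖X.1 - x0‖ ^ 2 + K * (X.2 - t0)) ≤ A * (‖X.1 - x0‖ ^ 2 + K * σ) := by
      have : X.2 - t0 ≤ σ := by linarith [h1.2.2]
      gcongr
    have h6 : u (X.1, X.2) = u X := rfl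
    linarith
  have down : ∀ᶠ X : E n × ℝ in 𝓝 (x0, t0), X.2 < t0 → c - ε < u X := by
    by_cases hacc : ∃ τ ∈ T, t0 - σ < τ ∧ τ < t0
    · obtain ⟨τ, hτT, hτ1, hτ2⟩ := hacc
      filter_upwards [hnear (t0 - τ) (by linarith), hquad σ hσε] with X h1 h2 h3
      have h4 := W τ hτT X.1 h1.1 X.2 (by linarith [h1.2.1]) (by linarith)
      have h5 : A * (‖X.1 - x0‖ ^ 2 + K * (X.2 - τ)) ≤ A * (‖X.1 - x0‖ ^ 2 + K * σ) := by
        have : X.2 - τ ≤ σ := by linarith [h1.2.2]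
        gcongr
      have h6 : u (X.1, X.2) = u X := rfl
      linarith
    · push Not at hacc
      obtain ⟨r, hr⟩ : ∃ r : ℝ, r = min (min ρ 1) (σ / 2) := ⟨_, rfl⟩
      have hr0 : 0 < r := by rw [hr]; positivity
      have hr1 : r ≤ 1 := by rw [hr]; exact (min_le_left _ _).trans (min_le_right _ _)
      have hrρ : r ≤ ρ := by rw [hr]; exact (min_le_left _ _).trans (min_le_left _ _)
      have hrσ : r ≤ σ / 2 := by rw [hr]; exact min_le_right _ _
      have hrr : r ^ 2 ≤ σ / 2 := by nlinarith
      have hcc : Continuous fun X : E n × ℝ =>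
          hB n ν r M * √‖X.1 - x0‖ + 2 * M / r ^ 2 * ‖X.1 - x0‖ ^ 2 := by fun_prop
      have hsm := hcc.continuousAt (x := (x0, t0)) |>.eventually
        (gt_mem_nhds (show _ < ε by simpa using hε))
      have hnb : ∀ᶠ X : E n × ℝ in 𝓝 (x0, t0), X.1 ∈ closedBall x0 r :=
        continuousAt_fst.eventually (closedBall_mem_nhds x0 hr0)
      filter_upwards [hnear (σ / 2) (by positivity), hsm, hnb] with X h1 h2 h3 h4
      have hsub : closedBall x0 r ×ˢ Icc (X.2 - r ^ 2) X.2 ⊆ box := by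
        rw [hbox]
        rintro Z ⟨h5, h6⟩
        exact ⟨closedBall_subset_closedBall hrρ h5, by linarith [h6.1, h1.2.1], by linarith [h6.2]⟩
      have hH := holder hn hν hν1 hr0 hM (hu.neg.mono hsub) (ha.mono hsub)
        (fun Z hZ => ((hfree Z (hsub hZ) (fun hZT => by
          have := hacc Z.2 hZT (by linarith [hZ.2.1, h1.2.1])
          linarith [hZ.2.2])).neg).continuousWithinAt)
        (fun Z hZ => by show |-u Z| ≤ M; rw [abs_neg]; exact hub Z (hsub hZ))
        (fun Z hZ Y hY => hosc Z (hsub hZ) Y (hsub hY)) hθ X.1 h3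
      have h5 := hv (x0, t0) ⟨h0, h0b⟩ X.2 ⟨by linarith [h1.2.1], by linarith⟩
      have h6 : u (X.1, X.2) = u X := rfl
      simp only at h5 h2 hH
      linarith
  filter_upwards [up, down] with X h1 h2
  rcases le_or_gt t0 X.2 with h | h
  · exact h1 h
  · exact h2 h

lemma baire_lower {n : ℕ} (hn : 0 < n) {ν : ℝ} (hν : 0 < ν) (hν1 : ν ≤ 1)
    {a : E n × ℝ → Fin n → Fin n → ℝ} {u : E n × ℝ → ℝ} {M : ℝ}
    (hM : 0 < M) {Q U G : Set (E n × ℝ)} (hQ : IsOpen Q) (hU : IsOpen U) (hG : IsClosed G)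
    (hu : SolvesL a u Q) (ha : Ell ν a Q) (hac : ∀ i j, ContinuousOn (fun X => a X i j) Q)
    (hub : ∀ X ∈ Q, |u X| ≤ M)
    (hcont : ∀ X ∈ Q, X ∉ G → ContinuousAt u X) (j : ℕ)
    (hv : ∀ X ∈ Q ∩ G, X ∈ U → ∀ t, |t - X.2| < 1 / (j + 1) → (X.1, t) ∈ Q →
      |u (X.1, t) - u X| ≤ j * |t - X.2|)
    (hh : ∀ X ∈ Q ∩ G, X ∈ U → ∀ x, ‖x - X.1‖ < 1 / (j + 1) → (x, X.2) ∈ Q →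
      |u (x, X.2) - u X| ≤ j * ‖x - X.1‖) {X0 : E n × ℝ} (h0 : X0 ∈ Q ∩ G) (h0U : X0 ∈ U) :
    ∀ ε > 0, ∀ᶠ X in 𝓝 X0, u X0 - ε < u X := by
  intro ε hε
  obtain ⟨x0, t0⟩ := X0
  have hn' : (0 : ℝ) < n := by exact_mod_cast hn
  obtain ⟨θ, hθ⟩ : ∃ θ : ℝ, θ = ν / (12 * n * n) := ⟨_, rfl⟩
  have hθ0 : 0 < θ := by rw [hθ]; positivity
  have hev : ∀ᶠ Y in 𝓝 (x0, t0), Y ∈ Q ∧ Y ∈ U ∧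
      ∀ i j, |a Y i j - a (x0, t0) i j| < θ / 2 := by
    have hQe : ∀ᶠ Y in 𝓝 (x0, t0), Y ∈ Q := hQ.mem_nhds h0.1
    have hUe : ∀ᶠ Y in 𝓝 (x0, t0), Y ∈ U := hU.mem_nhds h0U
    refine hQe.and (hUe.and ?_)
    rw [eventually_all]; intro i
    rw [eventually_all]; intro j
    have := ((hac i j).continuousAt (hQ.mem_nhds h0.1))
    have := Metric.continuousAt_iff'.mp this (θ / 2) (by positivity)
    filter_upwards [this] with Y hY
    simpa [Real.dist_eq] using hY
  obtain ⟨ρ1, hρ1, hball⟩ := Metric.eventually_nhds_iff.mp hev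
  obtain ⟨ρ, hρ⟩ : ∃ ρ : ℝ, ρ = min (ρ1 / 2) (min (1 / (4 * (j + 1))) (ε / (8 * (j + 1)))) :=
    ⟨_, rfl⟩
  have hρ0 : 0 < ρ := by rw [hρ]; positivity
  have hρa : ρ ≤ ρ1 / 2 := by rw [hρ]; exact min_le_left _ _
  have hρb : ρ ≤ 1 / (4 * (j + 1)) := by
    rw [hρ]; exact (min_le_right _ _).trans (min_le_left _ _)
  have hρc : ρ ≤ ε / (8 * (j + 1)) := by
    rw [hρ]; exact (min_le_right _ _).trans (min_le_right _ _)
  have hρj : 2 * ρ < 1 / (j + 1) := by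
    have : (1 : ℝ) / (4 * (j + 1)) = 1 / (j + 1) / 4 := by field_simp
    have h2 : (0 : ℝ) < 1 / (j + 1) := by positivity
    linarith
  have hjρ : 4 * (j * ρ) ≤ ε / 2 := by
    rw [le_div_iff₀ (by positivity)] at hρc
    nlinarith
  have hbox : ∀ Y ∈ closedBall x0 ρ ×ˢ Icc (t0 - ρ) (t0 + ρ), Y ∈ Q ∧ Y ∈ U ∧
      ∀ i j, |a Y i j - a (x0, t0) i j| < θ / 2 := by
    rintro ⟨x, t⟩ ⟨h1, h2⟩
    refine hball ?_
    rw [Prod.dist_eq]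
    refine max_lt ?_ ?_
    · have : dist x x0 ≤ ρ := h1
      simp only; linarith
    · simp only [Real.dist_eq]
      have : |t - t0| ≤ ρ := abs_le.mpr ⟨by linarith [h2.1], by linarith [h2.2]⟩
      linarith
  have hsub : closedBall x0 ρ ×ˢ Icc (t0 - ρ) (t0 + ρ) ⊆ Q := fun Y hY => (hbox Y hY).1
  have hsc : ∀ X ∈ (Q ∩ G) ∩ closedBall x0 ρ ×ˢ Icc (t0 - ρ) (t0 + ρ),
      u (x0, t0) - j * (2 * ρ) ≤ u X := by
    rintro ⟨x, t⟩ ⟨h1, h2⟩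
    have hx : ‖x0 - x‖ ≤ ρ := by
      have : x ∈ closedBall x0 ρ := h2.1
      rw [norm_sub_rev]; simpa [dist_eq_norm] using this
    have ht : |t - t0| ≤ ρ := abs_le.mpr ⟨by linarith [h2.2.1], by linarith [h2.2.2]⟩
    have hm : (x0, t) ∈ Q := hsub ⟨mem_closedBall_self hρ0.le, h2.2⟩
    have e1 := hh (x, t) h1 (hbox _ h2).2.1 x0 (by simp only; linarith) hm
    have e2 := hv (x0, t0) h0 h0U t (by simp only; linarith) hm
    simp only at e1 e2
    have f1 : (j : ℝ) * ‖x0 - x‖ ≤ j * ρ := by gcongr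
    have f2 : (j : ℝ) * |t - t0| ≤ j * ρ := by gcongr
    have g1 := abs_le.mp e1
    have g2 := abs_le.mp e2
    linarith [g1.2, g2.1]
  have := near_lower (c := u (x0, t0) - ε / 2) (F := Q ∩ G) (θ := θ) hn hν hν1 hρ0 hM rfl
    (hu.mono hsub) (ha.mono hsub) (fun X hX => hub X (hsub hX))
    (fun X hX Y hY i j => by
      have h1 := abs_le.mp ((hbox X hX).2.2 i j).le
      have h2 := abs_le.mp ((hbox Y hY).2.2 i j).le
      exact abs_le.mpr ⟨by linarith [h1.1, h2.2], by linarith [h1.2, h2.1]⟩)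
    (by rw [hθ]; apply le_of_eq; field_simp)
    (fun X hX hXF => hcont X (hsub hX) fun h => hXF ⟨hsub hX, h⟩)
    (by
      have : (Q ∩ G) ∩ closedBall x0 ρ ×ˢ Icc (t0 - ρ) (t0 + ρ)
          = closedBall x0 ρ ×ˢ Icc (t0 - ρ) (t0 + ρ) ∩ G := by
        ext X; constructor
        · rintro ⟨⟨_, h⟩, h'⟩; exact ⟨h', h⟩
        · rintro ⟨h, h'⟩; exact ⟨⟨hsub h, h'⟩, h⟩
      rw [this]
      exact ((isCompact_closedBall x0 ρ).prod isCompact_Icc).inter_right hG)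
    h0
    (fun X hX t ht => by
      have e := hv X hX.1 (hbox _ hX.2).2.1 t
        (lt_of_le_of_lt (abs_le.mpr ⟨by linarith [ht.1, hX.2.2.2], by linarith [ht.2, hX.2.2.1]⟩) hρj)
        (hsub ⟨hX.2.1, ht⟩)
      have f : (j : ℝ) * |t - X.2| ≤ j * (2 * ρ) := by
        gcongr
        exact abs_le.mpr ⟨by linarith [ht.1, hX.2.2.2], by linarith [ht.2, hX.2.2.1]⟩
      have := hsc X hX
      have := (abs_le.mp e).1
      linarith)
    (fun X hX x hx => by
      have hd : ‖x - X.1‖ ≤ 2 * ρ := by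
        rw [← dist_eq_norm]
        have h1 : dist x x0 ≤ ρ := hx
        have h2 : dist X.1 x0 ≤ ρ := hX.2.1
        linarith [dist_triangle_right x X.1 x0]
      have e := hh X hX.1 (hbox _ hX.2).2.1 x (lt_of_le_of_lt hd hρj) (hsub ⟨hx, hX.2.2⟩)
      have f : (j : ℝ) * ‖x - X.1‖ ≤ j * (2 * ρ) := by gcongr
      have := hsc X hX
      have := (abs_le.mp e).1
      linarith)
    (ε / 2) (by positivity)
  filter_upwards [this] with X hX
  linarith

lemma joint_cont {n : ℕ} (hn : 0 < n) {ν : ℝ} (hν : 0 < ν) (hν1 : ν ≤ 1)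
    {a : E n × ℝ → Fin n → Fin n → ℝ} {u : E n × ℝ → ℝ} {M : ℝ}
    (hM : 0 < M) {Q : Set (E n × ℝ)} (hQ : IsOpen Q)
    (hu : SolvesL a u Q) (ha : Ell ν a Q) (hac : ∀ i j, ContinuousOn (fun X => a X i j) Q)
    (hub : ∀ X ∈ Q, |u X| ≤ M) : ∀ X ∈ Q, ContinuousAt u X := by
  obtain ⟨G, hGd⟩ : ∃ G : Set (E n × ℝ), G = {X | ∀ᶠ Y in 𝓝 X, ContinuousAt u Y}ᶜ := ⟨_, rfl⟩
  have hG : IsClosed G := by rw [hGd]; exact isOpen_setOfPred_eventually_nhds.isClosed_compl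
  have hcont : ∀ X, X ∉ G → ContinuousAt u X := by
    intro X hX
    rw [hGd, mem_compl_iff, not_not] at hX
    exact Filter.Eventually.self_of_nhds hX
  by_contra hcon
  push Not at hcon
  obtain ⟨X1, hX1, hX1n⟩ := hcon
  have hX1G : X1 ∈ G := by by_contra h; exact hX1n (hcont X1 h)
  obtain ⟨F, hF⟩ : ∃ F, F = Q ∩ G := ⟨_, rfl⟩
  have hlc : IsLocallyClosed F := by rw [hF]; exact hQ.isLocallyClosed.inter hG.isLocallyClosed
  have : LocallyCompactSpace F := hlc.locallyCompactSpace
  have : Nonempty F := ⟨⟨X1, by rw [hF]; exact ⟨hX1, hX1G⟩⟩⟩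
  let B : ℕ → Set (E n × ℝ) := fun j => {X |
    (∀ t, |t - X.2| < 1 / (j + 1) → (X.1, t) ∈ Q → |u (X.1, t) - u X| ≤ j * |t - X.2|) ∧
    (∀ x, ‖x - X.1‖ < 1 / (j + 1) → (x, X.2) ∈ Q → |u (x, X.2) - u X| ≤ j * ‖x - X.1‖)}
  -- separate continuity
  have cx : ∀ X ∈ Q, ContinuousAt (fun x => u (x, X.2)) X.1 :=
    fun X hX => (hu.1 X hX).1.continuousAt
  have ct : ∀ X ∈ Q, ContinuousAt (fun t => u (X.1, t)) X.2 :=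
    fun X hX => (hu.1 X hX).2.continuousAt
  have hBcl : ∀ j, IsClosed ((Subtype.val : F → E n × ℝ) ⁻¹' B j) := by
    intro j
    rw [isClosed_preimage_val]
    rintro ⟨x, t⟩ ⟨hXF, hXc⟩
    have hXQ : (x, t) ∈ Q := by rw [hF] at hXF; exact hXF.1
    have : (𝓝[F ∩ B j] (x, t)).NeBot := mem_closure_iff_nhdsWithin_neBot.mp hXc
    have hfst : Tendsto (fun Z : E n × ℝ => Z.1) (𝓝[F ∩ B j] (x, t)) (𝓝 x) :=
      (continuousAt_fst (p := (x, t))).tendsto.mono_left nhdsWithin_le_nhds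
    have hsnd : Tendsto (fun Z : E n × ℝ => Z.2) (𝓝[F ∩ B j] (x, t)) (𝓝 t) :=
      (continuousAt_snd (p := (x, t))).tendsto.mono_left nhdsWithin_le_nhds
    have hux : ∀ t', (x, t') ∈ Q →
        Tendsto (fun Z : E n × ℝ => u (Z.1, t')) (𝓝[F ∩ B j] (x, t)) (𝓝 (u (x, t'))) :=
      fun t' ht' => (cx (x, t') ht').tendsto.comp hfst
    have hut : ∀ x', (x', t) ∈ Q →
        Tendsto (fun Z : E n × ℝ => u (x', Z.2)) (𝓝[F ∩ B j] (x, t)) (𝓝 (u (x', t))) :=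
      fun x' hx' => (ct (x', t) hx').tendsto.comp hsnd
    have hBm : ∀ᶠ Z in 𝓝[F ∩ B j] (x, t), Z ∈ B j := by
      filter_upwards [self_mem_nhdsWithin] with Z hZ using hZ.2
    have hlt : ∀ t', |t' - t| < 1 / ((j : ℝ) + 1) →
        ∀ᶠ Z in 𝓝[F ∩ B j] (x, t), |t' - Z.2| < 1 / ((j : ℝ) + 1) := by
      intro t' ht'
      exact ((tendsto_const_nhds.sub hsnd).abs).eventually (gt_mem_nhds ht')
    have hlx : ∀ x', ‖x' - x‖ < 1 / ((j : ℝ) + 1) →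
        ∀ᶠ Z in 𝓝[F ∩ B j] (x, t), ‖x' - Z.1‖ < 1 / ((j : ℝ) + 1) := by
      intro t' ht'
      exact ((tendsto_const_nhds.sub hfst).norm).eventually (gt_mem_nhds ht')
    have hinQ : ∀ t', (x, t') ∈ Q → ∀ᶠ Z in 𝓝[F ∩ B j] (x, t), (Z.1, t') ∈ Q := by
      intro t' ht'
      exact (hfst.prodMk_nhds tendsto_const_nhds).eventually (hQ.mem_nhds ht')
    have hinQ' : ∀ x', (x', t) ∈ Q → ∀ᶠ Z in 𝓝[F ∩ B j] (x, t), (x', Z.2) ∈ Q := by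
      intro t' ht'
      exact (tendsto_const_nhds.prodMk_nhds hsnd).eventually (hQ.mem_nhds ht')
    have huu : Tendsto u (𝓝[F ∩ B j] (x, t)) (𝓝 (u (x, t))) := by
      have h1 : Tendsto (fun Z : E n × ℝ => u (Z.1, t) - u Z) (𝓝[F ∩ B j] (x, t)) (𝓝 0) := by
        refine squeeze_zero_norm' (a := fun Z => j * |t - Z.2|) ?_ ?_
        · filter_upwards [hBm, hlt t (by simp; positivity), hinQ t hXQ] with Z h1 h2 h3
          exact h1.1 t h2 h3
        · have : Tendsto (fun Z : E n × ℝ => (j : ℝ) * |t - Z.2|) (𝓝[F ∩ B j] (x, t))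
            (𝓝 (j * |t - t|)) := ((tendsto_const_nhds.sub hsnd).abs).const_mul _
          simpa using this
      have h2 := (hux t hXQ).sub h1
      simpa using h2
    refine ⟨fun t' ht' hQ' => ?_, fun x' hx' hQ' => ?_⟩
    · refine le_of_tendsto_of_tendsto ((hux t' hQ').sub huu).abs
        (((tendsto_const_nhds (x := t')).sub hsnd).abs.const_mul (j : ℝ)) ?_
      filter_upwards [hBm, hlt t' ht', hinQ t' hQ'] with Z h1 h2 h3
      exact h1.1 t' h2 h3
    · refine le_of_tendsto_of_tendsto ((hut x' hQ').sub huu).abs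
        (((tendsto_const_nhds (x := x')).sub hfst).norm.const_mul (j : ℝ)) ?_
      filter_upwards [hBm, hlx x' hx', hinQ' x' hQ'] with Z h1 h2 h3
      exact h1.2 x' h2 h3
  have hBu : ⋃ j, ((Subtype.val : F → E n × ℝ) ⁻¹' B j) = univ := by
    rw [eq_univ_iff_forall]
    rintro ⟨X, hX⟩
    rw [hF] at hX
    obtain ⟨c1, hc1⟩ := (hu.1 X hX.1).2.isBigO_sub.bound
    obtain ⟨c2, hc2⟩ := ((hu.1 X hX.1).1.differentiableAt (by norm_num)).isBigO_sub.bound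
    obtain ⟨e1, he1, hc1⟩ := Metric.eventually_nhds_iff.mp hc1
    obtain ⟨e2, he2, hc2⟩ := Metric.eventually_nhds_iff.mp hc2
    obtain ⟨j, hj⟩ := exists_nat_gt (max (max c1 c2) (max (1 / e1) (1 / e2)))
    have j1 : c1 ≤ j := ((le_max_left _ _).trans (le_max_left _ _)).trans hj.le
    have j2 : c2 ≤ j := ((le_max_right _ _).trans (le_max_left _ _)).trans hj.le
    have j3 : 1 / e1 ≤ j := ((le_max_left _ _).trans (le_max_right _ _)).trans hj.le
    have j4 : 1 / e2 ≤ j := ((le_max_right _ _).trans (le_max_right _ _)).trans hj.le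
    have key : ∀ e : ℝ, 0 < e → 1 / e ≤ j → 1 / ((j : ℝ) + 1) ≤ e := by
      intro e he h
      rw [div_le_iff₀ he] at h
      rw [div_le_iff₀ (by positivity)]; nlinarith
    refine mem_iUnion.mpr ⟨j, ?_, ?_⟩
    · intro t ht _
      have := hc1 (y := t) (by rw [Real.dist_eq]; exact lt_of_lt_of_le ht (key e1 he1 j3))
      simp only [Real.norm_eq_abs] at this
      exact this.trans (by gcongr)
    · intro x hx _
      have := hc2 (y := x) (by rw [dist_eq_norm]; exact lt_of_lt_of_le hx (key e2 he2 j4))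
      simp only [Real.norm_eq_abs] at this
      exact this.trans (by gcongr)
  obtain ⟨j, ⟨⟨X0, hX0F⟩, hX0⟩⟩ := nonempty_interior_of_iUnion_of_closed hBcl hBu
  rw [mem_interior] at hX0
  obtain ⟨U', hU's, hU'o, hX0U'⟩ := hX0
  obtain ⟨U, hU, rfl⟩ := isOpen_induced_iff.mp hU'o
  have hUB : ∀ X ∈ Q ∩ G, X ∈ U → X ∈ B j := fun X hX hXU =>
    hU's (a := ⟨X, by rw [hF]; exact hX⟩) hXU
  have hFU : ∀ X ∈ Q ∩ G, X ∈ U → ContinuousAt u X := by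
    intro X hX hXU
    have l1 := baire_lower hn hν hν1 hM hQ hU hG hu ha hac hub (fun X _ h => hcont X h) j
      (fun X hX hXU => (hUB X hX hXU).1) (fun X hX hXU => (hUB X hX hXU).2) hX hXU
    have l2 := baire_lower (u := fun X => -u X) hn hν hν1 hM hQ hU hG hu.neg ha hac
      (fun X hX => by rw [abs_neg]; exact hub X hX) (fun X _ h => (hcont X h).neg) j
      (fun X hX hXU t h1 h2 => by
        have := (hUB X hX hXU).1 t h1 h2
        rw [← abs_neg]; convert this using 2; ring)
      (fun X hX hXU x h1 h2 => by
        have := (hUB X hX hXU).2 x h1 h2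
        rw [← abs_neg]; convert this using 2; ring) hX hXU
    rw [Metric.continuousAt_iff']
    intro ε hε
    filter_upwards [l1 ε hε, l2 ε hε] with Z h1 h2
    rw [Real.dist_eq, abs_lt]
    constructor <;> linarith
  rw [hF] at hX0F
  have : X0 ∉ G := by
    rw [hGd, mem_compl_iff, not_not]
    show ∀ᶠ Y in 𝓝 X0, ContinuousAt u Y
    filter_upwards [hQ.mem_nhds hX0F.1, hU.mem_nhds hX0U'] with Y h1 h2
    by_cases h : Y ∈ G
    · exact hFU Y ⟨h1, h⟩ h2
    · exact hcont Y h
  exact this hX0F.2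

/-- A nonnegative continuous solution in the cylinder with boundary values `φ`. -/
structure PSol {n : ℕ} (ν : ℝ) (a : E n × ℝ → Fin n → Fin n → ℝ) (Ω : Set (E n))
    (u φ : E n × ℝ → ℝ) : Prop where
  opn : IsOpen Ω
  hν : 0 < ν
  sol : SolvesL a u (Cyl Ω)
  ell : Ell ν a (Cyl Ω)
  cont : ∀ X ∈ Cyl Ω, ContinuousAt u X
  nonneg : ∀ X ∈ Cyl Ω, 0 ≤ u X
  bd : ∀ Z ∈ pB Ω, Tendsto u (𝓝[Cyl Ω] Z) (𝓝 (φ Z))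
  phi_nonneg : ∀ Z, 0 ≤ φ Z

lemma mem_pB_of_closure {n : ℕ} {Ω : Set (E n)} (hΩ : IsOpen Ω) {Z : E n × ℝ}
    (h : Z ∈ closure (Cyl Ω)) (h2 : Z ∉ Cyl Ω) : Z ∈ pB Ω := by
  have h' : Z ∈ closure Ω ×ˢ Ici (0 : ℝ) := by
    have : closure (Cyl Ω) = closure Ω ×ˢ Ici (0 : ℝ) := by
      unfold Cyl CylFrom
      rw [closure_prod_eq, closure_Ioi]
    rwa [this] at h
  rcases eq_or_lt_of_le (show (0 : ℝ) ≤ Z.2 from h'.2) with h0 | h0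
  · right; exact ⟨h'.1, h0.symm⟩
  · left
    refine ⟨?_, h0⟩
    rw [hΩ.frontier_eq]
    exact ⟨h'.1, fun hin => h2 ⟨hin, h0⟩⟩

lemma tube_main {n : ℕ} {ν : ℝ} {a : E n × ℝ → Fin n → Fin n → ℝ} {Ω : Set (E n)}
    {u φ : E n × ℝ → ℝ} (h : PSol ν a Ω u φ) {p q : E n} {t0 t1 r c V : ℝ}
    (ht0 : 0 ≤ t0) (ht : t0 < t1) (hr : 0 < r) (hc : 0 < c)
    (hV : ‖(t1 - t0)⁻¹ • (q - p)‖ ≤ V)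
    (hinit : 0 < t0 → ∀ x ∈ Ω, ‖x - p‖ < r → c * (r ^ 2 - ‖x - p‖ ^ 2) ^ 2 ≤ u (x, t0))
    (hbd : ∀ Z ∈ pB Ω, Z ∈ tubeK p ((t1 - t0)⁻¹ • (q - p)) t0 t1 r →
      ‖tz p ((t1 - t0)⁻¹ • (q - p)) t0 Z‖ < r → c * r ^ 4 ≤ φ Z) :
    ∀ x ∈ Ω, ‖x - q‖ < r →
      c * Real.exp (-kap n ν r V * (t1 - t0)) * (r ^ 2 - ‖x - q‖ ^ 2) ^ 2 ≤ u (x, t1) := by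
  obtain ⟨v, hv⟩ : ∃ v, v = (t1 - t0)⁻¹ • (q - p) := ⟨_, rfl⟩
  obtain ⟨κ, hκ⟩ : ∃ κ, κ = kap n ν r V := ⟨_, rfl⟩
  rw [← hv] at hV hbd
  rw [← hκ]
  have hκ0 : 0 < κ := by rw [hκ]; exact kap_pos h.hν
  intro x hx hxq
  obtain ⟨D, hD⟩ : ∃ D, D = tubeD p v t0 t1 r ∩ Cyl Ω := ⟨_, rfl⟩
  have hDC : D ⊆ Cyl Ω := by rw [hD]; exact inter_subset_right
  have hDT : D ⊆ tubeD p v t0 t1 r := by rw [hD]; exact inter_subset_left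
  have htz : tz p v t0 (x, t1) = x - q := by
    simp only [tz, hv, smul_smul]
    rw [mul_inv_cancel₀ (by linarith), one_smul]; abel
  have hmem : (x, t1) ∈ D := by
    rw [hD]
    exact ⟨⟨ht, le_rfl, by rw [htz]; exact hxq⟩, hx, by simp; linarith⟩
  have hGc : Continuous (fun X => c * tubeG p v t0 r κ X) := by
    have := tubeG_cont p v t0 r κ
    fun_prop
  have hopen : IsOpen (Cyl Ω) := h.opn.prod isOpen_Ioi
  have := comparison (G := fun X => c * tubeG p v t0 r κ X) h.hν (h.sol.mono hDC) (h.ell.mono hDC)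
    (tubeK_compact p v t0 t1 r) (hDT.trans (tubeD_sub p v t0 t1 r))
    (fun X hX => (h.cont X (hDC hX)).continuousWithinAt) hGc.continuousOn
    (fun X hX => by
      rw [hκ]
      exact (tubeG_strictSub h.hν hr h.ell (hDC hX) p v t0 hV (hDT hX).2.2).const_mul hc)
    (fun X hX => by
      filter_upwards [tubeD_space (hDT hX), h.opn.mem_nhds (hDC hX).1] with y h1 h2
      rw [hD]; exact ⟨h1, h2, (hDC hX).2⟩)
    (fun X hX => by
      have : (0 : ℝ) < X.2 := (hDC hX).2
      filter_upwards [tubeD_time (hDT hX), mem_nhdsWithin_of_mem_nhds (lt_mem_nhds this)] with y h1 h2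
      rw [hD]; exact ⟨h1, (hDC hX).1, h2⟩)
    (fun Z hZ hZD ε hε => by
      have fin : ∀ L : ℝ, c * tubeG p v t0 r κ Z ≤ L → Tendsto u (𝓝[D] Z) (𝓝 L) →
          ∀ᶠ X in 𝓝[D] Z, c * tubeG p v t0 r κ X - ε < u X := by
        intro L hL hT
        have h1 := hT.sub ((hGc.continuousAt (x := Z)).continuousWithinAt (s := D)).tendsto
        have := h1.eventually (lt_mem_nhds (show -ε < L - c * tubeG p v t0 r κ Z by linarith))
        filter_upwards [this] with X hX
        linarith
      by_cases hZC : Z ∈ Cyl Ω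
      · refine fin (u Z) ?_ ((h.cont Z hZC).continuousWithinAt)
        have hZD' : Z ∉ tubeD p v t0 t1 r := fun hh => hZD (by rw [hD]; exact ⟨hh, hZC⟩)
        by_cases hlt : ‖tz p v t0 Z‖ < r
        · rcases tubeD_sub_tubeD Z hZ hZD' with h2 | h2
          · have h3 : tz p v t0 Z = Z.1 - p := by simp [tz, h2]
            have h4 := hinit (by rw [← h2]; exact hZC.2) Z.1 hZC.1 (by rw [← h3]; exact hlt)
            rw [← h2] at h4
            simp only [tubeG, h3, h2, sub_self, mul_zero, Real.exp_zero, one_mul]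
            exact h4
          · exact absurd h2 hlt.ne
        · have h2 : ‖tz p v t0 Z‖ = r := le_antisymm hZ.2.2 (not_lt.mp hlt)
          simp only [tubeG, h2, sub_self]
          simpa using h.nonneg Z hZC
      · by_cases hcl : Z ∈ closure (Cyl Ω)
        · have hpB := mem_pB_of_closure h.opn hcl hZC
          refine fin (φ Z) ?_ ((h.bd Z hpB).mono_left (nhdsWithin_mono _ hDC))
          by_cases hlt : ‖tz p v t0 Z‖ < r
          · have h1 := hbd Z hpB hZ hlt
            have h2 := tubeG_le p v hκ0.le (X := Z) hZ.1 hZ.2.2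
            nlinarith
          · have h2 : ‖tz p v t0 Z‖ = r := le_antisymm hZ.2.2 (not_lt.mp hlt)
            simp only [tubeG, h2, sub_self]
            simpa using h.phi_nonneg Z
        · have : 𝓝[D] Z = ⊥ := by
            rw [← notMem_closure_iff_nhdsWithin_eq_bot]
            exact fun hh => hcl (closure_mono hDC hh)
          rw [this]; exact eventually_bot)
    (x, t1) hmem
  simp only [tubeG, htz] at this
  rw [mul_assoc]; exact this

lemma tube_center {n : ℕ} {p q : E n} {t0 t1 r : ℝ} (ht : t0 < t1) {X : E n × ℝ}
    (hX : X ∈ tubeK p ((t1 - t0)⁻¹ • (q - p)) t0 t1 r) :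
    ∃ z ∈ segment ℝ p q, tz p ((t1 - t0)⁻¹ • (q - p)) t0 X = X.1 - z := by
  have h1 : 0 < t1 - t0 := by linarith
  refine ⟨p + ((X.2 - t0) * (t1 - t0)⁻¹) • (q - p), ?_, ?_⟩
  · rw [segment_eq_image']
    refine ⟨_, ⟨?_, ?_⟩, rfl⟩
    · have := hX.1
      have : 0 ≤ X.2 - t0 := by linarith
      positivity
    · rw [← div_eq_mul_inv, div_le_one h1]
      linarith [hX.2.1]
  · simp only [tz, smul_smul]; abel

/-- Propagation along an interior link. -/
lemma tube_link {n : ℕ} {ν : ℝ} {a : E n × ℝ → Fin n → Fin n → ℝ} {Ω : Set (E n)}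
    {u φ : E n × ℝ → ℝ} (h : PSol ν a Ω u φ) {p q : E n} {t0 t1 r c V : ℝ}
    (ht0 : 0 < t0) (ht : t0 < t1) (hr : 0 < r) (hc : 0 < c)
    (hV : ‖(t1 - t0)⁻¹ • (q - p)‖ ≤ V)
    (hlink : ∀ z ∈ segment ℝ p q, ball z r ⊆ Ω)
    (hinit : ∀ x ∈ Ω, ‖x - p‖ < r → c * (r ^ 2 - ‖x - p‖ ^ 2) ^ 2 ≤ u (x, t0)) :
    ∀ x ∈ Ω, ‖x - q‖ < r →
      c * Real.exp (-kap n ν r V * (t1 - t0)) * (r ^ 2 - ‖x - q‖ ^ 2) ^ 2 ≤ u (x, t1) := by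
  refine tube_main h ht0.le ht hr hc hV (fun _ => hinit) ?_
  intro Z hZ hZK hlt
  exfalso
  obtain ⟨z, hz, hzeq⟩ := tube_center ht hZK
  have hin : Z.1 ∈ Ω := hlink z hz (by rw [mem_ball, dist_eq_norm, ← hzeq]; exact hlt)
  rcases hZ with h1 | h1
  · have := h1.1
    rw [h.opn.frontier_eq] at this
    exact this.2 hin
  · have h2 : Z.2 = 0 := h1.2
    have := hZK.1
    linarith

/-- Cutoff. -/
def cut {n : ℕ} (Y Z : E n × ℝ) : ℝ :=
  max 0 (min (min 1 (2 - 2 * ‖Z.1 - Y.1‖)) (2 - 2 * |Z.2 - Y.2|))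

lemma cut_cont {n : ℕ} (Y : E n × ℝ) : Continuous (cut Y) := by
  unfold cut; fun_prop

lemma cut_nonneg {n : ℕ} (Y Z : E n × ℝ) : 0 ≤ cut Y Z := le_max_left _ _

lemma cut_le_one {n : ℕ} (Y Z : E n × ℝ) : cut Y Z ≤ 1 :=
  max_le zero_le_one ((min_le_left _ _).trans (min_le_left _ _))

lemma cut_one {n : ℕ} {Y Z : E n × ℝ} (h1 : ‖Z.1 - Y.1‖ ≤ 1 / 2) (h2 : |Z.2 - Y.2| ≤ 1 / 2) :
    1 ≤ cut Y Z :=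
  le_max_of_le_right (le_min (le_min le_rfl (by linarith)) (by linarith))

lemma cut_zero {n : ℕ} {Y Z : E n × ℝ} (h : Z ∉ Cr Y 1) : cut Y Z = 0 := by
  unfold cut
  refine max_eq_left ?_
  by_contra hcon
  push Not at hcon
  have h1 := (lt_min_iff.mp hcon).1
  have h2 := (lt_min_iff.mp hcon).2
  have h3 := (lt_min_iff.mp h1).2
  refine h ⟨?_, ?_⟩
  · rw [mem_ball, dist_eq_norm]; linarith
  · have h4 : |Z.2 - Y.2| < 1 := by linarith
    rw [abs_lt] at h4
    constructor <;> norm_num <;> linarith [h4.1, h4.2]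

def cA (n : ℕ) (ν μ lam : ℝ) : ℝ :=
  min (Real.exp (-kap n ν (1 / 8) 0)) (Real.exp (-kap n ν (μ * min (1 / 4) (1 / lam)) 3))

lemma cA_pos (n : ℕ) (ν μ lam : ℝ) : 0 < cA n ν μ lam := lt_min (Real.exp_pos _) (Real.exp_pos _)

lemma exp_kap_le {κ d : ℝ} (hκ : 0 ≤ κ) (hd : d ≤ 1) : Real.exp (-κ) ≤ Real.exp (-κ * d) := by
  rw [Real.exp_le_exp]; nlinarith

lemma lemmaA {n : ℕ} {ν μ lam r₀ : ℝ} {a : E n × ℝ → Fin n → Fin n → ℝ} {Ω : Set (E n)}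
    {u : E n × ℝ → ℝ} {Y : E n × ℝ} (h : PSol ν a Ω u (cut Y)) (hμ : μ ∈ Ioo (0 : ℝ) 1)
    (hlam : 1 ≤ lam) (hr0 : 4 ≤ lam * r₀) (hcork : Corkscrew Ω r₀ μ) (hY : Y ∈ pB Ω)
    {x : E n} (hx : x ∈ Ω) (hxy : ‖x - Y.1‖ < 1 / 8) {t : ℝ} (ht : t ∈ Ioc Y.2 (Y.2 + 1 / 64)) :
    cA n ν μ lam ≤ u (x, t) := by
  obtain ⟨y, s⟩ := Y
  simp only at hxy ht
  have hs0 : 0 ≤ s := by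
    rcases hY with h1 | h1
    · exact le_of_lt h1.2
    · exact le_of_eq h1.2.symm
  rcases lt_or_ge s (1 / 8) with hs | hs
  · have := tube_main h (p := x) (q := x) (t0 := 0) (t1 := t) (r := 1 / 8) (c := (1 / 8) ^ (-4 : ℤ))
      (V := 0) le_rfl (by linarith [ht.1]) (by norm_num) (by positivity) (by simp)
      (fun h0 => absurd h0 (lt_irrefl _))
      (fun Z hZ hZK hlt => by
        have h1 : tz x ((t - 0)⁻¹ • (x - x)) 0 Z = Z.1 - x := by simp [tz]
        rw [h1] at hlt
        have h2 : ((1 / 8 : ℝ)) ^ (-4 : ℤ) * (1 / 8) ^ 4 = 1 := by norm_num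
        rw [h2]
        refine cut_one ?_ ?_
        · have : Z.1 - y = (Z.1 - x) + (x - y) := by abel
          show ‖Z.1 - y‖ ≤ 1 / 2
          rw [this]
          linarith [norm_add_le (Z.1 - x) (x - y)]
        · show |Z.2 - s| ≤ 1 / 2
          rw [abs_le]
          constructor
          · linarith [hZK.1]
          · linarith [hZK.2.1, ht.2])
      x hx (by simp)
    refine le_trans ?_ this
    have e : ((1 / 8 : ℝ)) ^ (-4 : ℤ) * Real.exp (-kap n ν (1 / 8) 0 * (t - 0)) *
        ((1 / 8) ^ 2 - ‖x - x‖ ^ 2) ^ 2 = Real.exp (-kap n ν (1 / 8) 0 * (t - 0)) := by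
      simp only [sub_self, norm_zero]
      norm_num
      ring
    rw [e]
    exact (min_le_left _ _).trans (exp_kap_le (kap_pos h.hν).le (by linarith [ht.2]))
  · have hy : y ∈ frontier Ω := by
      rcases hY with h1 | h1
      · exact h1.1
      · have : s = 0 := h1.2
        linarith
    obtain ⟨rc, hrc⟩ : ∃ rc : ℝ, rc = min (1 / 4) (1 / lam) := ⟨_, rfl⟩
    have hlam0 : 0 < lam := by linarith
    have hrc0 : 0 < rc := by rw [hrc]; positivity
    have hrc4 : rc ≤ 1 / 4 := by rw [hrc]; exact min_le_left _ _
    have hrcl : rc < r₀ := by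
      have h1 : rc ≤ 1 / lam := by rw [hrc]; exact min_le_right _ _
      have h2 : 1 / lam < r₀ := by rw [div_lt_iff₀ hlam0]; linarith
      linarith
    obtain ⟨y2, hy2⟩ := (hcork y hy rc hrc0 hrcl).2
    have hμ0 := hμ.1
    have hr : 0 < μ * rc := by positivity
    have hrs : μ * rc ≤ 1 / 4 := by nlinarith [hμ.2]
    have hy2y : ‖y2 - y‖ < 1 / 4 := by
      have := (hy2 (mem_ball_self (by positivity : 0 < 2 * μ * rc))).1
      rw [mem_ball, dist_eq_norm] at this
      linarith
    have ht1 : s - 1 / 8 < t := by linarith [ht.1]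
    have := tube_main h (p := y2) (q := x) (t0 := s - 1 / 8) (t1 := t) (r := μ * rc)
      (c := ((μ * rc) ^ 4)⁻¹) (V := 3) (by linarith) ht1 hr (by positivity)
      (by
        have h1 : 1 / 8 ≤ t - (s - 1 / 8) := by linarith [ht.1]
        have h2 : ‖x - y2‖ ≤ 3 / 8 := by
          have : x - y2 = (x - y) - (y2 - y) := by abel
          rw [this]
          linarith [norm_sub_le (x - y) (y2 - y)]
        rw [norm_smul, norm_inv, Real.norm_eq_abs, abs_of_pos (by linarith), ← div_eq_inv_mul,
          div_le_iff₀ (by linarith)]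
        linarith)
      (fun _ z hz hzl => by
        exfalso
        refine (hy2 (a := z) ?_).2 hz
        rw [mem_ball, dist_eq_norm]; linarith)
      (fun Z hZ hZK hlt => by
        rw [inv_mul_cancel₀ (by positivity)]
        obtain ⟨z, hz, hzeq⟩ := tube_center ht1 hZK
        rw [hzeq] at hlt
        have hzy : ‖z - y‖ ≤ 1 / 4 := by
          have h1 : z ∈ closedBall y (1 / 4) := by
            refine (convex_closedBall y (1 / 4)).segment_subset ?_ ?_ hz
            · rw [mem_closedBall, dist_eq_norm]; exact hy2y.le
            · rw [mem_closedBall, dist_eq_norm]; linarith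
          simpa [dist_eq_norm] using h1
        refine cut_one ?_ ?_
        · have : Z.1 - y = (Z.1 - z) + (z - y) := by abel
          show ‖Z.1 - y‖ ≤ 1 / 2
          rw [this]
          linarith [norm_add_le (Z.1 - z) (z - y)]
        · show |Z.2 - s| ≤ 1 / 2
          rw [abs_le]
          constructor
          · linarith [hZK.1]
          · linarith [hZK.2.1, ht.2])
      x hx (by simpa using hr)
    refine le_trans ?_ this
    have e : ((μ * rc) ^ 4)⁻¹ * Real.exp (-kap n ν (μ * rc) 3 * (t - (s - 1 / 8))) *
        ((μ * rc) ^ 2 - ‖x - x‖ ^ 2) ^ 2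
        = Real.exp (-kap n ν (μ * rc) 3 * (t - (s - 1 / 8))) := by
      simp only [sub_self, norm_zero]
      have : (μ * rc) ≠ 0 := hr.ne'
      field_simp
      ring
    rw [e]
    refine (min_le_right _ _).trans ?_
    rw [← hrc]
    exact exp_kap_le (kap_pos h.hν).le (by linarith [ht.2])

/-- An interior link of radius `r` and length at most `B`. -/
def Lk {n : ℕ} (Ω : Set (E n)) (r B : ℝ) (p q : E n) : Prop :=
  ‖q - p‖ ≤ B ∧ ∀ z ∈ segment ℝ p q, ball z r ⊆ Ω

/-- A chain of `k` links. -/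
def Ch {n : ℕ} (Ω : Set (E n)) (r B : ℝ) : ℕ → E n → E n → Prop
  | 0, p, q => p = q
  | k + 1, p, q => ∃ w, Ch Ω r B k p w ∧ Lk Ω r B w q

lemma Lk.symm {n : ℕ} {Ω : Set (E n)} {r B : ℝ} {p q : E n} (h : Lk Ω r B p q) :
    Lk Ω r B q p := by
  refine ⟨by rw [norm_sub_rev]; exact h.1, fun z hz => h.2 z (by rw [segment_symm]; exact hz)⟩

lemma Ch.append {n : ℕ} {Ω : Set (E n)} {r B : ℝ} {p q : E n} {j : ℕ} (h : Ch Ω r B j p q) :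
    ∀ {k : ℕ} {w : E n}, Ch Ω r B k q w → Ch Ω r B (j + k) p w
  | 0, w, h' => by
    have : q = w := h'
    rw [← this]; exact h
  | k + 1, w, h' => by
    obtain ⟨z, h1, h2⟩ := h'
    exact ⟨z, h.append h1, h2⟩

lemma Lk.ch {n : ℕ} {Ω : Set (E n)} {r B : ℝ} {p q : E n} (h : Lk Ω r B p q) :
    Ch Ω r B 1 p q := ⟨p, rfl, h⟩

lemma Ch.symm {n : ℕ} {Ω : Set (E n)} {r B : ℝ} {p : E n} :
    ∀ {k : ℕ} {q : E n}, Ch Ω r B k p q → Ch Ω r B k q p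
  | 0, q, h => by have : p = q := h; exact this.symm
  | k + 1, q, h => by
    obtain ⟨z, h1, h2⟩ := h
    have := h2.symm.ch.append h1.symm
    rwa [add_comm] at this

lemma Lk.refl {n : ℕ} {Ω : Set (E n)} {r B : ℝ} (hB : 0 ≤ B) {p : E n} (h : ball p r ⊆ Ω) :
    Lk Ω r B p p := by
  refine ⟨by simpa using hB, fun z hz => ?_⟩
  rw [segment_same] at hz
  rw [hz]; exact h

lemma Ch.pad {n : ℕ} {Ω : Set (E n)} {r B : ℝ} (hB : 0 ≤ B) {p q : E n} {k : ℕ}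
    (h : Ch Ω r B k p q) (hq : ball q r ⊆ Ω) (j : ℕ) : Ch Ω r B (k + j) p q := by
  induction j with
  | zero => exact h
  | succ j ih => exact ⟨q, ih, Lk.refl hB hq⟩

lemma Lk.mono {n : ℕ} {Ω : Set (E n)} {r B r' B' : ℝ} (hr : r' ≤ r) (hB : B ≤ B') {p q : E n}
    (h : Lk Ω r B p q) : Lk Ω r' B' p q :=
  ⟨h.1.trans hB, fun z hz => (ball_subset_ball hr).trans (h.2 z hz)⟩

lemma chain_prop {n : ℕ} {ν : ℝ} {a : E n × ℝ → Fin n → Fin n → ℝ} {Ω : Set (E n)}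
    {u φ : E n × ℝ → ℝ} (h : PSol ν a Ω u φ) {p : E n} {t0 τ r B c V : ℝ}
    (ht0 : 0 < t0) (hτ : 0 < τ) (hr : 0 < r) (hc : 0 < c) (hV : B / τ ≤ V)
    (hinit : ∀ x ∈ Ω, ‖x - p‖ < r → c * (r ^ 2 - ‖x - p‖ ^ 2) ^ 2 ≤ u (x, t0)) :
    ∀ (k : ℕ) (q : E n), Ch Ω r B k p q → ∀ x ∈ Ω, ‖x - q‖ < r →
      c * Real.exp (-kap n ν r V * (k * τ)) * (r ^ 2 - ‖x - q‖ ^ 2) ^ 2 ≤ u (x, t0 + k * τ) := by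
  intro k
  induction k with
  | zero =>
    intro q hq x hx hxq
    have : p = q := hq
    subst this
    simpa using hinit x hx hxq
  | succ k ih =>
    rintro q ⟨w, h1, h2⟩ x hx hxq
    have hkτ : 0 ≤ k * τ := by positivity
    have h3 := tube_link h (p := w) (q := q) (t0 := t0 + k * τ) (t1 := t0 + (k + 1 : ℕ) * τ)
      (r := r) (c := c * Real.exp (-kap n ν r V * (k * τ))) (V := V) (by positivity)
      (by push_cast; linarith) hr (by positivity)
      (by
        have e : t0 + (k + 1 : ℕ) * τ - (t0 + k * τ) = τ := by push_cast; ring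
        rw [e, norm_smul, norm_inv, Real.norm_eq_abs, abs_of_pos hτ, ← div_eq_inv_mul]
        exact le_trans (by gcongr; exact h2.1) hV)
      h2.2 (ih w h1) x hx hxq
    refine le_trans (le_of_eq ?_) h3
    rw [mul_assoc c (Real.exp _) (Real.exp _), ← Real.exp_add]
    congr 3
    push_cast; ring

/-- A vertical direction and a gap function near the boundary point `u`. -/
structure Frame {n : ℕ} (Ω : Set (E n)) (u : E n) (r₀ M : ℝ) (e : E n) (gap : E n → ℝ) : Prop where
  unit : ‖e‖ = 1
  mem : ∀ z, ‖z - u‖ < r₀ → (z ∈ Ω ↔ 0 < gap z)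
  le : ∀ z t w, gap z + t - M * ‖w‖ ≤ gap (z + t • e + w)

lemma exists_frame {n : ℕ} {hn : 0 < n} {Ω : Set (E n)} {m r₀ : ℝ}
    (h : IsLipschitzDomain hn Ω m r₀) {y : E n} (hy : y ∈ frontier Ω) :
    ∃ e gap, Frame Ω y r₀ (1 + m) e gap := by
  obtain ⟨hopen, -, -, hm, hr0, hch⟩ := h
  obtain ⟨T, φ, hφ, hmem⟩ := hch y hy
  let l : Fin n := ⟨n - 1, Nat.sub_lt hn Nat.one_pos⟩
  let pj : E n → E (n - 1) := fun z => (EuclideanSpace.equiv (Fin (n - 1)) ℝ).symm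
            (fun i => z (Fin.castLE (Nat.sub_le n 1) i))
  have hpj : ∀ z i, pj z i = z (Fin.castLE (Nat.sub_le n 1) i) := fun z i => rfl
  have hinj : Function.Injective (Fin.castLE (Nat.sub_le n 1)) := Fin.castLE_injective _
  have hpjn : ∀ z, ‖pj z‖ ≤ ‖z‖ := by
    intro z
    rw [EuclideanSpace.norm_eq, EuclideanSpace.norm_eq]
    refine Real.sqrt_le_sqrt ?_
    simp only [hpj]
    calc ∑ i, ‖z (Fin.castLE (Nat.sub_le n 1) i)‖ ^ 2
        = ∑ j ∈ Finset.univ.map ⟨_, hinj⟩, ‖z j‖ ^ 2 := by rw [Finset.sum_map]; rfl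
      _ ≤ ∑ j, ‖z j‖ ^ 2 :=
        Finset.sum_le_sum_of_subset_of_nonneg (Finset.subset_univ _) (fun _ _ _ => by positivity)
  let e : E n := T.symm (EuclideanSpace.single l 1)
  have hTe : T e = EuclideanSpace.single l 1 := T.apply_symm_apply _
  refine ⟨e, fun z => T (z - y) l - φ (pj (T (z - y))), ?_, ?_, ?_⟩
  · simp [e]
  · intro z hz
    have := hmem z
    constructor
    · intro hzΩ
      have h2 := (this.mp ⟨hzΩ, by rw [mem_ball, dist_eq_norm]; exact hz⟩).2
      exact sub_pos.mpr h2
    · intro h2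
      exact (this.mpr ⟨hz, sub_pos.mp h2⟩).1
  · intro z t w
    have e1 : T (z + t • e + w - y) = T (z - y) + t • EuclideanSpace.single l (1 : ℝ) + T w := by
      rw [← hTe]
      simp only [map_sub, map_add, map_smul]
      abel
    have e2 : pj (T (z + t • e + w - y)) = pj (T (z - y)) + pj (T w) := by
      ext i
      have hne : Fin.castLE (Nat.sub_le n 1) i ≠ l := by
        intro hh
        have := congrArg Fin.val hh
        simp [l] at this
        omega
      rw [PiLp.add_apply, hpj, hpj, hpj, e1]
      simp [hne]
    have h1 : φ (pj (T (z + t • e + w - y))) - φ (pj (T (z - y))) ≤ m * ‖w‖ := by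
      have := hφ.dist_le_mul (pj (T (z + t • e + w - y))) (pj (T (z - y)))
      rw [Real.dist_eq, Real.coe_toNNReal _ hm.le, dist_eq_norm, e2, add_sub_cancel_left] at this
      have h3 := (le_abs_self _).trans this
      have h4 := hpjn (T w)
      rw [LinearIsometryEquiv.norm_map] at h4
      rw [e2]
      exact h3.trans (by gcongr)
    have h2 : T (z + t • e + w - y) l = T (z - y) l + t + T w l := by
      rw [e1]; simp
    have h3 : -‖w‖ ≤ T w l := by
      have := PiLp.norm_apply_le (T w) l
      rw [LinearIsometryEquiv.norm_map, Real.norm_eq_abs] at this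
      exact (abs_le.mp this).1
    simp only
    rw [h2]
    linarith

lemma Frame.ball_sub {n : ℕ} {Ω : Set (E n)} {u : E n} {r₀ M : ℝ} {e : E n} {gap : E n → ℝ}
    (h : Frame Ω u r₀ M e gap) (hM : 0 < M) {z : E n} {g : ℝ} (hg : g ≤ gap z)
    (hz : ‖z - u‖ + g / M ≤ r₀) : ball z (g / M) ⊆ Ω := by
  intro w hw
  rw [mem_ball, dist_eq_norm] at hw
  refine (h.mem w ?_).mpr ?_
  · have : w - u = (w - z) + (z - u) := by abel
    rw [this]
    linarith [norm_add_le (w - z) (z - u)]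
  · have := h.le z 0 (w - z)
    rw [zero_smul, add_zero, add_zero, add_sub_cancel] at this
    rw [lt_div_iff₀ hM] at hw
    nlinarith

lemma Frame.le_gap {n : ℕ} {Ω : Set (E n)} {u : E n} {r₀ M : ℝ} {e : E n} {gap : E n → ℝ}
    (h : Frame Ω u r₀ M e gap) {z : E n} {d : ℝ} (hd : 0 < d) (hb : ball z d ⊆ Ω)
    (hz : ‖z - u‖ + d ≤ r₀) : d ≤ gap z := by
  refine le_of_forall_lt fun t ht => ?_
  obtain ⟨t', h1, h2⟩ := exists_between (max_lt ht hd)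
  have ht' : 0 < t' := lt_of_le_of_lt (le_max_right _ _) h1
  have htt : t < t' := lt_of_le_of_lt (le_max_left _ _) h1
  have hn : ‖z - t' • e - z‖ < d := by
    rw [sub_sub_cancel_left, norm_neg, norm_smul, h.unit, Real.norm_eq_abs, abs_of_pos ht']
    linarith
  have hin : z - t' • e ∈ Ω := hb (by rw [mem_ball, dist_eq_norm]; exact hn)
  have h3 := (h.mem _ (by
    have : z - t' • e - u = (z - t' • e - z) + (z - u) := by abel
    rw [this]
    linarith [norm_add_le (z - t' • e - z) (z - u)])).mp hin
  have h4 := h.le (z - t' • e) t' 0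
  rw [sub_add_cancel, add_zero, norm_zero, mul_zero] at h4
  linarith

lemma Frame.lk {n : ℕ} {Ω : Set (E n)} {u : E n} {r₀ M : ℝ} {e : E n} {gap : E n → ℝ}
    (h : Frame Ω u r₀ M e gap) (hM : 0 < M) {p w : E n} {t g B : ℝ} (ht : 0 ≤ t)
    (hg0 : g ≤ gap p) (hg1 : g ≤ gap p + t - M * ‖w‖)
    (hp : ‖p - u‖ + t + ‖w‖ + g / M ≤ r₀) (hB : t + ‖w‖ ≤ B) :
    Lk Ω (g / M) B p (p + t • e + w) := by
  have hnw : ∀ s : ℝ, 0 ≤ s → s ≤ 1 → ‖(s * t) • e + s • w‖ ≤ t + ‖w‖ := by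
    intro s h0 h1
    refine (norm_add_le _ _).trans ?_
    rw [norm_smul, norm_smul, h.unit, Real.norm_eq_abs, Real.norm_eq_abs, abs_of_nonneg h0,
      abs_of_nonneg (by positivity)]
    have := norm_nonneg w
    nlinarith
  refine ⟨?_, ?_⟩
  · have e1 : p + t • e + w - p = ((1 : ℝ) * t) • e + (1 : ℝ) • w := by
      rw [one_mul, one_smul]; abel
    rw [e1]
    exact (hnw 1 zero_le_one le_rfl).trans hB
  · intro z hz
    rw [segment_eq_image'] at hz
    obtain ⟨s, ⟨hs0, hs1⟩, rfl⟩ := hz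
    have e1 : p + s • (p + t • e + w - p) = p + (s * t) • e + s • w := by
      module
    simp only
    rw [e1]
    refine h.ball_sub hM ?_ ?_
    · have h1 := h.le p (s * t) (s • w)
      rw [norm_smul, Real.norm_eq_abs, abs_of_nonneg hs0] at h1
      have h2 : g ≤ (1 - s) * gap p + s * (gap p + t - M * ‖w‖) := by
        nlinarith [mul_le_mul_of_nonneg_left hg0 (sub_nonneg.mpr hs1),
          mul_le_mul_of_nonneg_left hg1 hs0]
      nlinarith
    · have h3 : p + (s * t) • e + s • w - u = (p - u) + ((s * t) • e + s • w) := by abel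
      rw [h3]
      linarith [norm_add_le (p - u) ((s * t) • e + s • w), hnw s hs0 hs1]

lemma first_point {n : ℕ} {Ω : Set (E n)} {a b : E n} {η' η2 : ℝ}
    (h0 : 0 < η') (h2 : η' < η2) (ha : ball a η2 ⊆ Ω)
    (hnot : ¬ ∀ z ∈ segment ℝ a b, ball z η' ⊆ Ω) :
    ∃ τ ∈ Icc (0 : ℝ) 1, ∃ u ∈ frontier Ω, ‖a + τ • (b - a) - u‖ = η' ∧
      ball (a + τ • (b - a)) η' ⊆ Ω ∧
      ∀ z ∈ segment ℝ a (a + τ • (b - a)), ball z η' ⊆ Ω := by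
  push Not at hnot
  obtain ⟨z, hz, hzn⟩ := hnot
  obtain ⟨w, hw, hwn⟩ := not_subset.mp hzn
  have hne : (Ωᶜ).Nonempty := ⟨w, hwn⟩
  rw [segment_eq_image'] at hz
  obtain ⟨τz, hτz, rfl⟩ := hz
  let f : ℝ → ℝ := fun τ => infDist (a + τ • (b - a)) Ωᶜ
  have hf : Continuous f := (continuous_infDist_pt _).comp (by fun_prop)
  have hfb : ∀ τ, η' ≤ f τ → ball (a + τ • (b - a)) η' ⊆ Ω := by
    intro τ hτ
    refine (ball_subset_ball hτ).trans ?_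
    exact ball_infDist_compl_subset
  have hSc : IsCompact (Icc (0 : ℝ) 1 ∩ {τ | f τ ≤ η'}) :=
    isCompact_Icc.inter_right (isClosed_le hf continuous_const)
  obtain ⟨τ, ⟨hτI, hτf⟩, hτmin⟩ := hSc.exists_isLeast ⟨τz, hτz, by
    show infDist _ _ ≤ η'
    refine (infDist_le_dist_of_mem hwn).trans ?_
    rw [dist_comm]; exact (mem_ball.mp hw).le⟩
  have hlt : ∀ σ, 0 ≤ σ → σ < τ → η' < f σ := by
    intro σ hσ0 hσ
    by_contra hcon
    push Not at hcon
    have := hτmin ⟨⟨hσ0, hσ.le.trans hτI.2⟩, hcon⟩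
    linarith
  have hf0 : η2 ≤ f 0 := by
    show η2 ≤ infDist _ _
    rw [le_infDist hne]
    intro y hy
    by_contra hcon
    push Not at hcon
    refine hy (ha ?_)
    rw [mem_ball, dist_comm]
    simpa using hcon
  have hτ0 : 0 < τ := by
    rcases eq_or_lt_of_le hτI.1 with h | h
    · have : f τ ≤ η' := hτf
      rw [← h] at this
      linarith
    · exact h
  have hfe : η' ≤ f τ := by
    have hT : Tendsto f (𝓝[<] τ) (𝓝 (f τ)) := hf.continuousAt.continuousWithinAt.tendsto
    refine ge_of_tendsto hT ?_
    filter_upwards [Ioo_mem_nhdsLT hτ0] with σ hσ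
    exact (hlt σ hσ.1.le hσ.2).le
  have hin : a + τ • (b - a) ∈ Ω := hfb τ hfe (mem_ball_self h0)
  have huniv : Ω ≠ univ := fun hh => hwn (hh ▸ mem_univ w)
  obtain ⟨u, hu, hud⟩ := exists_mem_frontier_infDist_compl_eq_dist hin huniv
  refine ⟨τ, hτI, u, hu, ?_, hfb τ hfe, ?_⟩
  · rw [← dist_eq_norm, ← hud]
    exact le_antisymm hτf hfe
  · intro z hz
    rw [segment_eq_image'] at hz
    obtain ⟨s, ⟨hs0, hs1⟩, rfl⟩ := hz
    have e1 : a + s • (a + τ • (b - a) - a) = a + (s * τ) • (b - a) := by module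
    simp only
    rw [e1]
    refine hfb _ ?_
    rcases eq_or_lt_of_le hs1 with h | h
    · rw [h, one_mul]; exact hfe
    · exact (hlt _ (by positivity) (by nlinarith)).le

lemma shrink {n : ℕ} {e d : E n} {h M L : ℝ} (he : ‖e‖ = 1) (hd : ‖d‖ = 1)
    (hi : 0 ≤ inner ℝ e d) (hh : 0 < h) (hM : 1 ≤ M) (hL : 4 * M * h < L) :
    ‖h • e + (h / (2 * M) - L) • d‖ ≤ L - h / (4 * M) := by
  obtain ⟨k, hk⟩ : ∃ k, k = h / (4 * M) := ⟨_, rfl⟩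
  have hk0 : 0 < k := by rw [hk]; positivity
  have hkh : k * (4 * M) = h := by rw [hk]; field_simp
  have hk2 : h / (2 * M) = 2 * k := by rw [← hkh]; field_simp; ring
  have hkle : 4 * k ≤ h := by nlinarith
  have hLh : h < L := by nlinarith
  rw [hk2, ← hk]
  refine le_of_sq_le_sq ?_ (by linarith)
  rw [norm_add_sq_real, norm_smul, norm_smul, he, hd, inner_smul_left, inner_smul_right]
  simp only [Real.norm_eq_abs, mul_one, sq_abs, conj_trivial]
  have h1 : 0 ≤ h * ((L - 2 * k) * inner ℝ e d) :=
    mul_nonneg hh.le (mul_nonneg (by linarith) hi)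
  have h2 : h ^ 2 + k ^ 2 * 3 ≤ 2 * k * L := by
    have : 2 * k * (4 * M * h) ≤ 2 * k * L := by
      have := hL.le
      gcongr
    have h3 : 2 * k * (4 * M * h) = 2 * h ^ 2 := by
      calc 2 * k * (4 * M * h) = 2 * (k * (4 * M)) * h := by ring
        _ = 2 * h ^ 2 := by rw [hkh]; ring
    nlinarith
  nlinarith

set_option maxHeartbeats 1000000 in
lemma chain_step {n : ℕ} {hn : 0 < n} {Ω : Set (E n)} {m r₀ : ℝ}
    (hΩ : IsLipschitzDomain hn Ω m r₀) {M h D0 : ℝ} (hMm : M = 1 + m) (hM : 1 ≤ M) (hh : 0 < h)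
    (hr : 16 * M ^ 2 * h ≤ r₀) (hD0 : 0 ≤ D0) {a b : E n} (hD : ‖b - a‖ ≤ r₀ - 8 * h)
    (hDD : ‖b - a‖ ≤ D0) (ha : ball a (h / (2 * M)) ⊆ Ω) (hb : ball b (h / (2 * M)) ⊆ Ω) :
    Ch Ω (h / (4 * M) / M) (D0 + 16 * M ^ 2 * h) 4 a b ∨
    ∃ a' b', ball a' (h / (2 * M)) ⊆ Ω ∧ ball b' (h / (2 * M)) ⊆ Ω ∧
      ‖b' - a'‖ ≤ ‖b - a‖ - h / (4 * M) ∧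
      Ch Ω (h / (4 * M) / M) (D0 + 16 * M ^ 2 * h) 2 a a' ∧
      Ch Ω (h / (4 * M) / M) (D0 + 16 * M ^ 2 * h) 2 b' b := by
  have hM0 : 0 < M := by linarith
  have hη0 : 0 < h / (4 * M) := by positivity
  obtain ⟨η, hη⟩ : ∃ η, η = h / (4 * M) := ⟨_, rfl⟩
  have hη2 : h / (2 * M) = 2 * η := by rw [hη]; field_simp; norm_num
  have hηh : η ≤ h / 4 := by
    rw [hη, div_le_div_iff₀ (by positivity) (by norm_num)]; nlinarith
  have hMη : M * (2 * η) = h / 2 := by rw [hη]; field_simp; norm_num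
  have hrη : η / M ≤ η := div_le_self (hη ▸ hη0.le) hM
  have hMM : M ≤ M ^ 2 := by nlinarith
  have hMh : M * h ≤ M ^ 2 * h := by nlinarith
  have hhM : h ≤ M * h := by nlinarith
  rw [hη2] at ha hb ⊢
  rw [← hη] at hη0 ⊢
  have hB0 : 0 ≤ D0 + 16 * M ^ 2 * h := by positivity
  have hbr : ball b (η / M) ⊆ Ω := (ball_subset_ball (by linarith)).trans hb
  have har : ball a (η / M) ⊆ Ω := (ball_subset_ball (by linarith)).trans ha
  by_cases hlink : ∀ z ∈ segment ℝ a b, ball z η ⊆ Ω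
  · left
    have : Lk Ω (η / M) (D0 + 16 * M ^ 2 * h) a b :=
      Lk.mono hrη (by nlinarith) (⟨hDD, hlink⟩ : Lk Ω η D0 a b)
    exact this.ch.pad hB0 hbr 3
  obtain ⟨τ, ⟨hτ0, hτ1⟩, u, hu, hcu, hcball, hseg⟩ := first_point hη0 (by linarith) ha hlink
  obtain ⟨e, gap, F⟩ := exists_frame hΩ hu
  rw [← hMm] at F
  set c := a + τ • (b - a) with hc
  have hbc : b - c = (1 - τ) • (b - a) := by rw [hc]; module
  have hbcn : ‖b - c‖ = (1 - τ) * ‖b - a‖ := by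
    rw [hbc, norm_smul, Real.norm_eq_abs, abs_of_nonneg (by linarith)]
  have hbcle : ‖b - c‖ ≤ ‖b - a‖ := by
    rw [hbcn]; nlinarith [norm_nonneg (b - a)]
  have hca : ‖c - a‖ ≤ ‖b - a‖ := by
    have : c - a = τ • (b - a) := by rw [hc]; module
    rw [this, norm_smul, Real.norm_eq_abs, abs_of_nonneg hτ0]
    nlinarith [norm_nonneg (b - a)]
  have hbu : ‖b - u‖ ≤ ‖b - c‖ + η := by
    rw [← hcu]
    have : b - u = (b - c) + (c - u) := by abel
    rw [this]; exact norm_add_le _ _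
  have hgc : η ≤ gap c := F.le_gap hη0 hcball (by nlinarith)
  have hgb : 2 * η ≤ gap b := F.le_gap (by linarith) hb (by linarith)
  have lac : Lk Ω (η / M) (D0 + 16 * M ^ 2 * h) a c :=
    Lk.mono hrη (by nlinarith) (⟨hca.trans hDD, hseg⟩ : Lk Ω η D0 a c)
  rcases le_or_gt ‖b - c‖ (4 * M * h) with hl | hl
  · left
    obtain ⟨H, hH⟩ : ∃ H, H = 4 * M ^ 2 * h + η := ⟨_, rfl⟩
    have hH0 : 0 ≤ H := by rw [hH]; positivity
    have l1 : Lk Ω (η / M) (D0 + 16 * M ^ 2 * h) c (c + H • e + 0) := by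
      apply F.lk hM0 hH0 hgc
      · rw [norm_zero]; linarith
      · rw [norm_zero, hcu]; linarith
      · rw [norm_zero]; linarith
    have hg1 : η + H ≤ gap (c + H • e + 0) := by
      have := F.le c H 0
      rw [norm_zero] at this; linarith
    have hMl : M * ‖b - c‖ ≤ 4 * M ^ 2 * h := by nlinarith
    have l2 : Lk Ω (η / M) (D0 + 16 * M ^ 2 * h) (c + H • e + 0)
        (c + H • e + 0 + (0 : ℝ) • e + (b - c)) := by
      apply F.lk hM0 le_rfl
      · linarith
      · linarith
      · have : ‖c + H • e + 0 - u‖ ≤ η + H := by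
          have e1 : c + H • e + 0 - u = (c - u) + H • e := by abel
          rw [e1]
          refine (norm_add_le _ _).trans ?_
          rw [norm_smul, F.unit, hcu, Real.norm_eq_abs, abs_of_nonneg hH0, mul_one]
        linarith
      · linarith
    have e2 : c + H • e + 0 + (0 : ℝ) • e + (b - c) = b + H • e + 0 := by module
    rw [e2] at l2
    have l3 : Lk Ω (η / M) (D0 + 16 * M ^ 2 * h) b (b + H • e + 0) := by
      apply F.lk hM0 hH0
      · linarith
      · rw [norm_zero]; linarith
      · rw [norm_zero]; linarith
      · rw [norm_zero]; linarith
    exact (((lac.ch.append l1.ch).append l2.ch).append l3.symm.ch)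
  · right
    have hMh0 : 0 < M * h := by positivity
    have hD1 : 0 < ‖b - a‖ := by linarith
    set d : E n := ‖b - a‖⁻¹ • (b - a) with hd
    have hdn : ‖d‖ = 1 := by
      rw [hd, norm_smul, norm_inv, norm_norm, inv_mul_cancel₀ hD1.ne']
    have hba : b - a = ‖b - a‖ • d := by
      rw [hd, smul_smul, mul_inv_cancel₀ hD1.ne', one_smul]
    have hbc' : b - c = ‖b - c‖ • d := by
      rw [hbcn, mul_smul, ← hba, hbc]
    have hM2 : h / 2 / M = 2 * η := by rw [← hMη]; field_simp
    have hMn : M * ‖(2 * η) • d‖ = h / 2 := by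
      rw [norm_smul, hdn, mul_one, Real.norm_eq_abs, abs_of_nonneg (by linarith), hMη]
    have hMn0 : ‖(2 * η) • d‖ = 2 * η := by
      rw [norm_smul, hdn, mul_one, Real.norm_eq_abs, abs_of_nonneg (by linarith)]
    have hnb : ∀ p w : E n, ‖p + h • e + w - u‖ ≤ ‖p - u‖ + h + ‖w‖ := by
      intro p w
      have e1 : p + h • e + w - u = (p - u) + h • e + w := by abel
      rw [e1]
      refine (norm_add₃_le).trans ?_
      rw [norm_smul, F.unit, Real.norm_eq_abs, abs_of_pos hh, mul_one]
    rcases le_total 0 (inner ℝ e d) with hi | hi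
    · refine ⟨c + h • e + (2 * η) • d, b, ?_, hb, ?_, ?_, ?_⟩
      · refine (ball_subset_ball hM2.symm.le).trans (F.ball_sub hM0 ?_ ?_)
        · have := F.le c h ((2 * η) • d)
          linarith
        · have := hnb c ((2 * η) • d)
          rw [hM2]
          linarith
      · have := shrink F.unit hdn hi hh hM hl
        rw [hη2, ← hη] at this
        have e1 : b - (c + h • e + (2 * η) • d) = -(h • e + (2 * η - ‖b - c‖) • d) := by
          have : b - (c + h • e + (2 * η) • d) = (b - c) - h • e - (2 * η) • d := by abel
          rw [this, sub_smul, ← hbc']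
          abel
        rw [e1, norm_neg]
        linarith
      · refine lac.ch.append (Lk.ch ?_)
        apply F.lk hM0 hh.le hgc
        · linarith
        · linarith
        · linarith
      · exact (Lk.refl hB0 hbr).ch.pad hB0 hbr 1
    · refine ⟨a, b + h • e + -((2 * η) • d), ha, ?_, ?_, ?_, ?_⟩
      · refine (ball_subset_ball hM2.symm.le).trans (F.ball_sub hM0 ?_ ?_)
        · have := F.le b h (-((2 * η) • d))
          rw [norm_neg] at this
          linarith
        · have := hnb b (-((2 * η) • d))
          rw [norm_neg] at this
          rw [hM2]
          linarith
      · have := shrink (e := -e) (by rw [norm_neg, F.unit]) hdn (by rw [inner_neg_left]; linarith)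
          hh hM (lt_of_lt_of_le hl hbcle)
        rw [hη2, ← hη] at this
        have e1 : b + h • e + -((2 * η) • d) - a = -(h • (-e) + (2 * η - ‖b - a‖) • d) := by
          have : b + h • e + -((2 * η) • d) - a = (b - a) + h • e - (2 * η) • d := by abel
          rw [this, sub_smul, ← hba, smul_neg]
          abel
        rw [e1, norm_neg]
        exact this
      · exact (Lk.refl hB0 har).ch.pad hB0 har 1
      · refine Ch.symm (Ch.pad hB0 (k := 1) (Lk.ch ?_) ?_ 1)
        · apply F.lk hM0 hh.le
          · linarith
          · rw [norm_neg]; linarith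
          · rw [norm_neg]; linarith
          · rw [norm_neg]; linarith
        · refine F.ball_sub hM0 ?_ ?_
          · have := F.le b h (-((2 * η) • d))
            rw [norm_neg] at this
            linarith
          · have := hnb b (-((2 * η) • d))
            rw [norm_neg] at this
            linarith

lemma chain_exists {n : ℕ} {hn : 0 < n} {Ω : Set (E n)} {m r₀ : ℝ}
    (hΩ : IsLipschitzDomain hn Ω m r₀) {M h D0 : ℝ} (hMm : M = 1 + m) (hM : 1 ≤ M) (hh : 0 < h)
    (hr : 16 * M ^ 2 * h ≤ r₀) (hD0 : 0 ≤ D0) (k : ℕ) : ∀ {a b : E n},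
    ‖b - a‖ ≤ r₀ - 8 * h → ‖b - a‖ ≤ D0 → ball a (h / (2 * M)) ⊆ Ω → ball b (h / (2 * M)) ⊆ Ω →
    ‖b - a‖ ≤ k * (h / (4 * M)) →
    Ch Ω (h / (4 * M) / M) (D0 + 16 * M ^ 2 * h) (4 * k + 4) a b := by
  have hM0 : 0 < M := by linarith
  have hrad : h / (4 * M) / M ≤ h / (2 * M) := by
    refine (div_le_self (by positivity) hM).trans ?_
    gcongr; norm_num
  have hB0 : 0 ≤ D0 + 16 * M ^ 2 * h := by positivity
  induction k with
  | zero =>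
    intro a b _ _ ha hb hk
    have : b - a = 0 := by
      rw [← norm_le_zero_iff]; simpa using hk
    have hab : a = b := (sub_eq_zero.mp this).symm
    subst hab
    have hbr := (ball_subset_ball hrad).trans hb
    exact (Lk.refl hB0 hbr).ch.pad hB0 hbr 3
  | succ k ih =>
    intro a b h1 h2 ha hb hk
    have hbr := (ball_subset_ball hrad).trans hb
    rcases chain_step hΩ hMm hM hh hr hD0 h1 h2 ha hb with hs | ⟨a', b', ha', hb', hl, c1, c2⟩
    · have := hs.pad hB0 hbr (4 * (k + 1))
      rwa [add_comm 4 (4 * (k + 1))] at this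
    · have hp : 0 < h / (4 * M) := by positivity
      push_cast at hk
      have := ih (a := a') (b := b') (by linarith) (by linarith) ha' hb' (by linarith)
      have h3 := (c1.append this).append c2
      have e : 2 + (4 * k + 4) + 2 = 4 * (k + 1) + 4 := by ring
      rwa [e] at h3

lemma psol_of {n : ℕ} (hn : 0 < n) {ν : ℝ} (hν : ν ∈ Ioc (0 : ℝ) 1) {Ω : Set (E n)}
    (hΩ : IsOpen Ω) {a : E n × ℝ → Fin n → Fin n → ℝ} (ha : IsParabolicCoeff ν a (closure (Cyl Ω)))
    {ω : E n × ℝ → Measure (E n × ℝ)} (hω : IsCaloricMeasure a Ω ω) (Y : E n × ℝ) :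
    PSol ν a Ω (fun X => ∫ z, cut Y z ∂ω X) (cut Y) := by
  have habs : ∀ z, |cut Y z| ≤ 1 := fun z => by
    rw [abs_of_nonneg (cut_nonneg Y z)]; exact cut_le_one Y z
  obtain ⟨hs, hb⟩ := hω.2 (cut Y) (cut_cont Y) ⟨1, habs⟩
  have hell : Ell ν a (Cyl Ω) := ha.ell.mono subset_closure
  have hopen : IsOpen (Cyl Ω) := hΩ.prod isOpen_Ioi
  refine ⟨hΩ, hν.1, hs, hell, ?_, ?_, hb, cut_nonneg Y⟩
  · refine joint_cont hn hν.1 hν.2 (M := 1) one_pos hopen hs hell ?_ ?_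
    · intro i j
      exact (ha.1 i j).continuousOn.mono subset_closure
    · intro X hX
      have := (hω.1 X hX).1
      have h1 := norm_integral_le_of_norm_le_const (μ := ω X) (f := cut Y) (C := 1)
        (Eventually.of_forall habs)
      simpa using h1
  · intro X _
    exact integral_nonneg (cut_nonneg Y)

lemma u_le_measure {n : ℕ} {Ω : Set (E n)} {a : E n × ℝ → Fin n → Fin n → ℝ}
    {ω : E n × ℝ → Measure (E n × ℝ)} (hω : IsCaloricMeasure a Ω ω) (Y : E n × ℝ)
    {X : E n × ℝ} (hX : X ∈ Cyl Ω) {c : ℝ} (hc : c ≤ ∫ z, cut Y z ∂ω X) :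
    ENNReal.ofReal c ≤ ω X (pB Ω ∩ Cr Y 1) := by
  have hP := (hω.1 X hX).1
  have h0 : ω X (pB Ω)ᶜ = 0 := (hω.1 X hX).2
  have hint : Integrable (cut Y) (ω X) := by
    refine Integrable.of_bound (cut_cont Y).aestronglyMeasurable 1 (Eventually.of_forall fun z => ?_)
    rw [Real.norm_eq_abs, abs_of_nonneg (cut_nonneg Y z)]; exact cut_le_one Y z
  have hCm : MeasurableSet (Cr Y 1) := by
    have : IsOpen (Cr Y 1) := isOpen_ball.prod isOpen_Ioo
    exact this.measurableSet
  calc ENNReal.ofReal c ≤ ENNReal.ofReal (∫ z, cut Y z ∂ω X) := ENNReal.ofReal_le_ofReal hc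
    _ = ∫⁻ z, ENNReal.ofReal (cut Y z) ∂ω X :=
        ofReal_integral_eq_lintegral_ofReal hint (Eventually.of_forall (cut_nonneg Y))
    _ ≤ ∫⁻ z, (Cr Y 1).indicator 1 z ∂ω X := by
        refine lintegral_mono fun z => ?_
        by_cases hz : z ∈ Cr Y 1
        · rw [indicator_of_mem hz]
          exact (ENNReal.ofReal_le_ofReal (cut_le_one Y z)).trans (by simp)
        · rw [indicator_of_notMem hz, cut_zero hz]; simp
    _ = ω X (Cr Y 1) := lintegral_indicator_one hCm
    _ ≤ ω X ((pB Ω ∩ Cr Y 1) ∪ (pB Ω)ᶜ) := by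
        refine measure_mono fun z hz => ?_
        by_cases hzp : z ∈ pB Ω
        · exact Or.inl ⟨hzp, hz⟩
        · exact Or.inr hzp
    _ ≤ ω X (pB Ω ∩ Cr Y 1) + ω X (pB Ω)ᶜ := measure_union_le _ _
    _ = ω X (pB Ω ∩ Cr Y 1) := by rw [h0, add_zero]

lemma innerSet_ball {n : ℕ} {Ω : Set (E n)} {δ : ℝ} {x : E n} (hx : x ∈ innerSet Ω δ) :
    ball x δ ⊆ Ω := by
  by_cases hΩ : Ω = univ
  · rw [hΩ]; exact subset_univ _
  · obtain ⟨y, hy, hxy⟩ := exists_mem_frontier_infDist_compl_eq_dist hx.1 hΩ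
    have h1 : δ ≤ infDist x Ωᶜ := by
      rw [hxy]; exact hx.2.le.trans (infDist_le_dist_of_mem hy)
    exact (ball_subset_ball h1).trans ball_infDist_compl_subset

lemma exists_start {n : ℕ} {Ω : Set (E n)} {r₀ μ ς : ℝ} (hμ : μ ∈ Ioo (0 : ℝ) 1)
    (hcork : Corkscrew Ω r₀ μ) {y : E n} (hy : y ∈ closure Ω) (hς : 0 < ς) (hςr : ς < r₀) :
    ∃ b, ‖b - y‖ ≤ 2 * ς ∧ ball b (μ * ς) ⊆ Ω := by
  by_cases hb : ball y ς ⊆ Ω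
  · refine ⟨y, by simp [hς.le], (ball_subset_ball ?_).trans hb⟩
    nlinarith [hμ.2]
  · have hex : ∃ y' ∈ frontier Ω, ‖y' - y‖ < ς := by
      obtain ⟨w, hw, hwΩ⟩ := not_subset.mp hb
      by_cases hyΩ : y ∈ Ω
      · obtain ⟨y', hy', hd⟩ := exists_mem_frontier_infDist_compl_eq_dist hyΩ
          (fun hu => hwΩ (hu ▸ mem_univ w))
        refine ⟨y', hy', ?_⟩
        rw [← dist_eq_norm, dist_comm, ← hd]
        refine (infDist_le_dist_of_mem (show w ∈ Ωᶜ from hwΩ)).trans_lt ?_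
        rwa [dist_comm]
      · exact ⟨y, ⟨hy, fun hi => hyΩ (interior_subset hi)⟩, by simpa using hς⟩
    obtain ⟨y', hy', hyy⟩ := hex
    obtain ⟨⟨y₁, h1⟩, _⟩ := hcork y' hy' ς hς hςr
    have hpos : 0 < 2 * μ * ς := by have := hμ.1; positivity
    refine ⟨y₁, ?_, ?_⟩
    · have h2 := (h1 (mem_ball_self hpos)).1
      rw [mem_ball, dist_eq_norm] at h2
      have : y₁ - y = (y₁ - y') + (y' - y) := by abel
      rw [this]
      linarith [norm_add_le (y₁ - y') (y' - y)]
    · refine (ball_subset_ball ?_).trans (h1.trans inter_subset_right)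
      have : 0 < μ * ς := by have := hμ.1; positivity
      linarith

lemma chain_to {n : ℕ} {hn : 0 < n} {Ω : Set (E n)} {m r₀ : ℝ}
    (hΩ : IsLipschitzDomain hn Ω m r₀) {M h d0 d D0 μ : ℝ} (hμ : μ ∈ Ioo (0 : ℝ) 1)
    (hMm : M = 1 + m) (hM : 1 ≤ M) (hh : 0 < h) (hd0 : 0 < d0) (h16 : 16 * M ^ 2 * h ≤ d0)
    (hdd : d0 ≤ d) (hdr : d ≤ r₀) (hdD : d ≤ D0) (h32 : 32 * h ≤ μ * d0)
    (h8 : h ≤ μ * (μ * d0 / 8)) {k : ℕ} (hk : D0 ≤ k * (h / (4 * M)))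
    {x y b : E n} (hxb : ball x (μ * d) ⊆ Ω) (hxy : ‖x - y‖ < d)
    (hby : ‖b - y‖ ≤ 2 * (μ * d0 / 8)) (hbb : ball b (μ * (μ * d0 / 8)) ⊆ Ω) :
    Ch Ω (h / (4 * M) / M) (D0 + 16 * M ^ 2 * h) (4 * k + 5) b x := by
  have hM0 : 0 < M := by linarith
  obtain ⟨hμ0, hμ1⟩ := hμ
  have hh2 : h / (2 * M) ≤ h := div_le_self hh.le (by linarith)
  have hrad : h / (4 * M) / M ≤ h := (div_le_self (by positivity) hM).trans
    (div_le_self hh.le (by linarith))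
  have hμd : μ * d0 ≤ μ * d := by nlinarith
  have hμd0 : 0 < μ * d0 := by positivity
  set p : E n := x + (μ / 2) • (y - x) with hp
  have hyx : ‖y - x‖ < d := by rwa [norm_sub_rev]
  have hpx : ‖p - x‖ ≤ μ * d / 2 := by
    have : p - x = (μ / 2) • (y - x) := by rw [hp]; module
    rw [this, norm_smul, Real.norm_eq_abs, abs_of_pos (by positivity)]
    nlinarith
  have hpy : ‖y - p‖ ≤ (1 - μ / 2) * d := by
    have : y - p = (1 - μ / 2) • (y - x) := by rw [hp]; module
    rw [this, norm_smul, Real.norm_eq_abs, abs_of_pos (by linarith)]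
    exact mul_le_mul_of_nonneg_left hyx.le (by linarith)
  have hbp : ‖b - p‖ ≤ d - 8 * h := by
    have : b - p = (b - y) + (y - p) := by abel
    rw [this]
    linarith [norm_add_le (b - y) (y - p)]
  have hpball : ∀ z, ‖z - x‖ ≤ μ * d / 2 → ball z h ⊆ Ω := by
    intro z hz
    refine (ball_subset_ball' ?_).trans hxb
    rw [dist_eq_norm]; linarith
  have c1 := chain_exists hΩ hMm hM hh (h16.trans (hdd.trans hdr)) (by linarith) k
    (a := p) (b := b) (D0 := D0) (by linarith) (by linarith)
    ((ball_subset_ball hh2).trans (hpball p hpx))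
    ((ball_subset_ball (hh2.trans h8)).trans hbb) (by linarith)
  have hB : 0 ≤ 16 * M ^ 2 * h := by positivity
  have l : Lk Ω (h / (4 * M) / M) (D0 + 16 * M ^ 2 * h) p x := by
    refine ⟨?_, ?_⟩
    · rw [norm_sub_rev]; nlinarith
    · intro z hz
      refine (ball_subset_ball hrad).trans (hpball z ?_)
      rw [segment_eq_image'] at hz
      obtain ⟨s, ⟨hs0, hs1⟩, rfl⟩ := hz
      have e1 : p + s • (x - p) - x = (1 - s) • (p - x) := by module
      simp only
      rw [e1, norm_smul, Real.norm_eq_abs, abs_of_nonneg (by linarith)]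
      nlinarith [norm_nonneg (p - x)]
  exact c1.symm.append l.ch

lemma big_case {n : ℕ} {ν μ lam r B R ρ : ℝ} {Ω : Set (E n)}
    {a : E n × ℝ → Fin n → Fin n → ℝ} {u : E n × ℝ → ℝ} {Y : E n × ℝ}
    (hψ : PSol ν a Ω u (cut Y)) (hc : 0 < cA n ν μ lam)
    (hA : ∀ x ∈ Ω, ‖x - Y.1‖ < 1 / 8 → cA n ν μ lam ≤ u (x, Y.2 + 1 / 128))
    (hs : 0 ≤ Y.2) (hr : 0 < r) (hr1 : r ≤ 1 / 16) (hB : 0 ≤ B) {K : ℕ} (hK : 0 < K)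
    (hρ : 1 / 8 < ρ) (hρR : 2 * ρ ≤ R) {b x : E n} (hb : ‖b - Y.1‖ ≤ 1 / 16)
    (hx : x ∈ Ω) (hch : Ch Ω r B K b x) :
    cA n ν μ lam * Real.exp (-kap n ν r (B * (128 * K)) * (R ^ 2 / 4)) ≤ u (x, Y.2 + ρ ^ 2) := by
  have hK' : (0 : ℝ) < K := by exact_mod_cast hK
  obtain ⟨T, hT⟩ : ∃ T, T = ρ ^ 2 - 1 / 128 := ⟨_, rfl⟩
  have hT1 : 1 / 128 ≤ T := by nlinarith
  have hT2 : T ≤ R ^ 2 / 4 := by nlinarith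
  have hT0 : 0 < T := by linarith
  have hinit : ∀ z ∈ Ω, ‖z - b‖ < r →
      cA n ν μ lam / r ^ 4 * (r ^ 2 - ‖z - b‖ ^ 2) ^ 2 ≤ u (z, Y.2 + 1 / 128) := by
    intro z hz hzb
    refine le_trans ?_ (hA z hz ?_)
    · rw [div_mul_eq_mul_div, div_le_iff₀ (by positivity)]
      refine mul_le_mul_of_nonneg_left ?_ hc.le
      have h1 : 0 ≤ r ^ 2 - ‖z - b‖ ^ 2 := by nlinarith [norm_nonneg (z - b)]
      have h2 : r ^ 2 - ‖z - b‖ ^ 2 ≤ r ^ 2 := by nlinarith [sq_nonneg ‖z - b‖]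
      calc (r ^ 2 - ‖z - b‖ ^ 2) ^ 2 ≤ (r ^ 2) ^ 2 := pow_le_pow_left₀ h1 h2 2
        _ = r ^ 4 := by ring
    · have : z - Y.1 = (z - b) + (b - Y.1) := by abel
      rw [this]
      linarith [norm_add_le (z - b) (b - Y.1)]
  have hV : B / (T / K) ≤ B * (128 * K) := by
    rw [div_div_eq_mul_div, div_le_iff₀ hT0]
    have : 0 ≤ B * K := by positivity
    nlinarith
  have h := chain_prop hψ (t0 := Y.2 + 1 / 128) (τ := T / K) (c := cA n ν μ lam / r ^ 4)
    (by linarith) (by positivity) hr (by positivity) hV hinit K x hch x hx (by simpa using hr)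
  have e1 : (K : ℝ) * (T / K) = T := by field_simp
  have e2 : Y.2 + 1 / 128 + T = Y.2 + ρ ^ 2 := by rw [hT]; ring
  rw [e1, e2, sub_self, norm_zero] at h
  refine le_trans ?_ h
  have e3 : cA n ν μ lam / r ^ 4 * Real.exp (-kap n ν r (B * (128 * K)) * T) *
      (r ^ 2 - 0 ^ 2) ^ 2 = cA n ν μ lam * Real.exp (-kap n ν r (B * (128 * K)) * T) := by
    field_simp; ring
  rw [e3]
  refine mul_le_mul_of_nonneg_left (Real.exp_le_exp.mpr ?_) hc.le
  have hk := kap_pos (n := n) (r := r) (V := B * (128 * K)) hψ.hν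
  nlinarith

/-- **Estimate (4.14)**: for `Q = Ω × (0,∞)` over a Lipschitz domain with
`λr₀ ≥ 4`, `Y = (y,s) ∈ ∂_pQ`, and every `R` with `0 < R ≤ λr₀`, there is
`N₀ = N₀(n, ν, m, λ, R)` such that `ω^X(Δ₁(Y)) ≥ 1/N₀` for all
`X ∈ Ω⁺_ρ(Y) = (Ω^{μρ'} ∩ B_{ρ'}(y)) × {s + ρ²}` with `0 < 2ρ ≤ R`, where
`ρ' = min(ρ, r₀)`. -/
theorem caloric_measure_unit_surface_lower_bound (n : ℕ) (hn : 0 < n) (ν : ℝ)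
    (hν : ν ∈ Ioc (0 : ℝ) 1) (m lam μ R : ℝ) (hlam : 1 ≤ lam)
    (hμ : μ ∈ Ioo (0 : ℝ) 1) (hR : 0 < R) :
    ∃ N₀ : ℝ, 1 ≤ N₀ ∧
      ∀ (r₀ : ℝ) (Ω : Set (E n)), IsLipschitzDomain hn Ω m r₀ →
        Corkscrew Ω r₀ μ → 4 ≤ lam * r₀ → R ≤ lam * r₀ →
      ∀ (a : E n × ℝ → Fin n → Fin n → ℝ), IsParabolicCoeff ν a (closure (Cyl Ω)) →
      ∀ ω : E n × ℝ → Measure (E n × ℝ), IsCaloricMeasure a Ω ω →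
      ∀ Y ∈ pB Ω, ∀ ρ : ℝ, 0 < ρ → 2 * ρ ≤ R →
      ∀ x ∈ innerSet Ω (μ * min ρ r₀) ∩ ball Y.1 (min ρ r₀),
        ENNReal.ofReal (1 / N₀) ≤ ω (x, Y.2 + ρ ^ 2) (pB Ω ∩ Cr Y 1) := by
  obtain ⟨hμ0, hμ1⟩ := hμ
  have hμ' : μ ∈ Ioo (0 : ℝ) 1 := ⟨hμ0, hμ1⟩
  by_cases hm : 0 < m
  swap
  · exact ⟨1, le_rfl, fun r₀ Ω hΩ => absurd hΩ.2.2.2.1 hm⟩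
  have hlam0 : 0 < lam := by linarith
  obtain ⟨M, hMm⟩ : ∃ M, M = 1 + m := ⟨_, rfl⟩
  have hM : 1 ≤ M := by linarith
  have hM0 : 0 < M := by linarith
  obtain ⟨d0, hd0e⟩ : ∃ d0, d0 = min (1 / 8) (1 / lam) := ⟨_, rfl⟩
  have hd0 : 0 < d0 := by rw [hd0e]; positivity
  have hd8 : d0 ≤ 1 / 8 := by rw [hd0e]; exact min_le_left _ _
  have hdl : d0 ≤ 1 / lam := by rw [hd0e]; exact min_le_right _ _
  obtain ⟨h, hhe⟩ : ∃ h, h = μ ^ 2 * d0 / (32 * M ^ 2) := ⟨_, rfl⟩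
  have hh : 0 < h := by rw [hhe]; positivity
  have hμμ : μ ^ 2 ≤ μ := by nlinarith
  have hhM : h * (32 * M ^ 2) = μ ^ 2 * d0 := by rw [hhe]; field_simp
  have hM2 : 1 ≤ M ^ 2 := by nlinarith
  have hhM1 : h ≤ h * M ^ 2 := by nlinarith
  have hμd0 : 0 < μ * d0 := by positivity
  have hμ2d0 : μ ^ 2 * d0 ≤ μ * d0 := by nlinarith
  have hμd1 : μ * d0 ≤ d0 := by nlinarith
  obtain ⟨k, hk⟩ := exists_nat_ge (R / 2 / (h / (4 * M)))
  have hk' : R / 2 ≤ k * (h / (4 * M)) := by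
    rwa [div_le_iff₀ (by positivity)] at hk
  obtain ⟨c, hce⟩ : ∃ c, c = cA n ν μ lam * Real.exp (-kap n ν (h / (4 * M) / M)
    ((R / 2 + 16 * M ^ 2 * h) * (128 * (4 * k + 5 : ℕ))) * (R ^ 2 / 4)) := ⟨_, rfl⟩
  have hcA := cA_pos n ν μ lam
  have hc0 : 0 < c := by rw [hce]; positivity
  have hccA : c ≤ cA n ν μ lam := by
    rw [hce]
    have hkp := kap_pos (n := n) (r := h / (4 * M) / M)
      (V := (R / 2 + 16 * M ^ 2 * h) * (128 * (4 * k + 5 : ℕ))) hν.1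
    refine mul_le_of_le_one_right hcA.le (Real.exp_le_one_iff.mpr ?_)
    have : 0 ≤ R ^ 2 / 4 := by positivity
    nlinarith
  refine ⟨max 1 (1 / c), le_max_left _ _, ?_⟩
  intro r₀ Ω hΩ hcork h4 hRl a ha ω hω Y hY ρ hρ hρR x hx
  obtain ⟨hxi, hxb⟩ := hx
  have hψ := psol_of hn hν hΩ.1 ha hω Y
  have hs : 0 ≤ Y.2 := by
    rcases hY with hY | hY
    · exact le_of_lt hY.2
    · exact le_of_eq (mem_singleton_iff.mp hY.2).symm
  have hycl : Y.1 ∈ closure Ω := by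
    rcases hY with hY | hY
    · exact frontier_subset_closure hY.1
    · exact hY.1
  have hxΩ : x ∈ Ω := hxi.1
  have hρ2 : 0 < ρ ^ 2 := by positivity
  have hX : (x, Y.2 + ρ ^ 2) ∈ Cyl Ω := ⟨hxΩ, show (0 : ℝ) < Y.2 + ρ ^ 2 by linarith⟩
  refine u_le_measure hω Y hX ?_
  have hN : 1 / max 1 (1 / c) ≤ c := by
    rw [div_le_iff₀ (by positivity)]
    have := mul_le_mul_of_nonneg_left (le_max_right 1 (1 / c)) hc0.le
    rwa [mul_one_div_cancel hc0.ne'] at this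
  refine hN.trans ?_
  rw [mem_ball, dist_eq_norm] at hxb
  rcases le_or_gt ρ (1 / 8) with hρ8 | hρ8
  · refine hccA.trans ?_
    refine lemmaA hψ hμ' hlam h4 hcork hY hxΩ ?_ ⟨by linarith, by nlinarith⟩
    exact hxb.trans_le ((min_le_left _ _).trans hρ8)
  · have hr0 : 1 / lam ≤ r₀ := by
      rw [div_le_iff₀ hlam0]; linarith
    have hdd : d0 ≤ min ρ r₀ := le_min (hd8.trans hρ8.le) (hdl.trans hr0)
    have hς : 0 < μ * d0 / 8 := by positivity
    obtain ⟨b, hb1, hb2⟩ := exists_start hμ' hcork hycl hς (by linarith)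
    have hch := chain_to hΩ (M := M) (h := h) (d0 := d0) (d := min ρ r₀) (D0 := R / 2) hμ'
      hMm hM hh hd0 (by linarith) hdd (min_le_right _ _)
      ((min_le_left _ _).trans (by linarith)) (by linarith) (by linarith) hk'
      (innerSet_ball hxi) hxb hb1 hb2
    have hrad : h / (4 * M) / M ≤ h := (div_le_self (by positivity) hM).trans
      (div_le_self hh.le (by linarith))
    rw [hce]
    exact big_case (B := R / 2 + 16 * M ^ 2 * h) (K := 4 * k + 5) hψ hcA
      (fun z hz hzy => lemmaA hψ hμ' hlam h4 hcork hY hz hzy ⟨by linarith, by linarith⟩)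
      hs (by positivity) (by linarith) (by positivity) (by omega) hρ8 hρR (by linarith) hxΩ hch
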